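/- Assume the conventions: X is an infinite, connected, locally finite, vertex-transitive simple graph satisfying (UBQ) with separation constant σ > 0. If X is not Gromov hyperbolic, then X has quadratic growth. -/

import Mathlib

open SimpleGraph

/-- Closed `r`-neighbourhood of a set `A` in the graph metric of `X`. -/
def gnbhd {V : Type*} (X : SimpleGraph V) (A : Set V) (r : ℝ) : Set V :=
  {v : V | ∃ a ∈ A, (X.dist v a : ℝ) ≤ r}

/-- The induced subgraph on `Z` is connected. -/
def ConnSet {V : Type*} (X : SimpleGraph V) (Z : Set V) : Prop :=
  (X.induce Z).Connected

/-- `U` is a connected component of the subset `S` of the vertex set: `U` is a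
nonempty connected subset of `S` which is maximal among connected subsets of `S`. -/
def IsCompOf {V : Type*} (X : SimpleGraph V) (U S : Set V) : Prop :=
  U ⊆ S ∧ U.Nonempty ∧ ConnSet X U ∧
    ∀ U' : Set V, U ⊆ U' → U' ⊆ S → ConnSet X U' → U' = U

/-- A subset `Z` is narrow if it is quasi-isometric to a subset of `ℝ`
with respect to the ambient graph metric. -/
def Narrow {V : Type*} (X : SimpleGraph V) (Z : Set V) : Prop :=
  ∃ (lam c : ℝ) (f : Z → ℝ), 1 ≤ lam ∧ 0 ≤ c ∧
    ∀ x y : Z, |f x - f y| ≤ lam * (X.dist x.1 y.1 : ℝ) + c ∧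
      (X.dist x.1 y.1 : ℝ) ≤ lam * |f x - f y| + c

/-- A subset is wide if it is not narrow. -/
def Wide {V : Type*} (X : SimpleGraph V) (Z : Set V) : Prop := ¬ Narrow X Z

/-- `ρ : ℤ → V` is a bi-infinite `(lam, c)`-quasi-geodesic path. -/
def IsBiQG {V : Type*} (X : SimpleGraph V) (lam c : ℝ) (ρ : ℤ → V) : Prop :=
  (∀ n : ℤ, X.Adj (ρ n) (ρ (n + 1))) ∧
    ∀ s t : ℤ, |(s : ℝ) - (t : ℝ)| / lam - c ≤ (X.dist (ρ s) (ρ t) : ℝ)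

/-- A bi-infinite quasi-geodesic: a bi-infinite path which is a
`(lam, c)`-quasi-geodesic for some `lam ≥ 1`, `c ≥ 0`. -/
def IsBiQuasiGeodesic {V : Type*} (X : SimpleGraph V) (ρ : ℤ → V) : Prop :=
  ∃ lam c : ℝ, 1 ≤ lam ∧ 0 ≤ c ∧ IsBiQG X lam c ρ

/-- The subset `S` has exactly two wide connected components. -/
def TwoWideComps {V : Type*} (X : SimpleGraph V) (S : Set V) : Prop :=
  ∃ U₁ U₂ : Set V, U₁ ≠ U₂ ∧
    IsCompOf X U₁ S ∧ IsCompOf X U₂ S ∧ Wide X U₁ ∧ Wide X U₂ ∧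
    ∀ U : Set V, IsCompOf X U S → Wide X U → U = U₁ ∨ U = U₂

/-- The uniformly bisecting quasi-geodesics property with separation constant `σ`. -/
def UBQ {V : Type*} (X : SimpleGraph V) (σ : ℝ) : Prop :=
  ∀ ρ : ℤ → V, IsBiQuasiGeodesic X ρ →
    TwoWideComps X ((gnbhd X (Set.range ρ) σ)ᶜ)

/-- One-way infinite path. -/
def IsRay {V : Type*} (X : SimpleGraph V) (w : ℕ → V) : Prop :=
  ∀ n : ℕ, X.Adj (w n) (w (n + 1))

/-- `d(w t, A) → ∞` as `t → ∞`. -/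
def DivergesFrom {V : Type*} (X : SimpleGraph V) (w : ℕ → V) (A : Set V) : Prop :=
  ∀ M : ℝ, ∃ N : ℕ, ∀ t : ℕ, N ≤ t → ∀ a ∈ A, M < (X.dist (w t) a : ℝ)

/-- `(w₁, w₂)` is a pair of witnesses for the bi-infinite quasi-geodesic `ρ`:
they are one-way infinite simple paths lying in distinct wide components of the
complement of `N_σ(ρ(ℤ))`, both diverging from `ρ`. -/
def WitnessPair {V : Type*} (X : SimpleGraph V) (σ : ℝ) (ρ : ℤ → V)
    (w₁ w₂ : ℕ → V) : Prop :=
  IsRay X w₁ ∧ Function.Injective w₁ ∧ IsRay X w₂ ∧ Function.Injective w₂ ∧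
  (∃ U₁ U₂ : Set V, U₁ ≠ U₂ ∧
    IsCompOf X U₁ ((gnbhd X (Set.range ρ) σ)ᶜ) ∧ Wide X U₁ ∧
    IsCompOf X U₂ ((gnbhd X (Set.range ρ) σ)ᶜ) ∧ Wide X U₂ ∧
    Set.range w₁ ⊆ U₁ ∧ Set.range w₂ ⊆ U₂) ∧
  DivergesFrom X w₁ (Set.range ρ) ∧ DivergesFrom X w₂ (Set.range ρ)

/-- Concatenation of the reversal of the ray `a` with the ray `b`, as a
bi-infinite path (`t ↦ a (-t)` for `t ≤ 0` and `t ↦ b t` for `t ≥ 0`). -/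
def biconcat {V : Type*} (a b : ℕ → V) : ℤ → V :=
  fun t => if t < 0 then a (-t).toNat else b t.toNat

/-- One-way infinite `(lam, c)`-quasi-geodesic ray. -/
def IsQGRay {V : Type*} (X : SimpleGraph V) (lam c : ℝ) (γ : ℕ → V) : Prop :=
  IsRay X γ ∧
    ∀ s t : ℕ, |(s : ℝ) - (t : ℝ)| / lam - c ≤ (X.dist (γ s) (γ t) : ℝ)

/-- An `(R, r, lam, c)`-cross-examiner, with the three rays `γ i`, the three
witnesses `w i` and the three finite paths `q i` (of length `qn i`) indexed by
`ZMod 3` (where the paper's index `3` corresponds to `0 : ZMod 3`). -/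
def IsCrossExaminer {V : Type*} (X : SimpleGraph V) (σ R r lam c : ℝ) (v₀ : V)
    (γ w : ZMod 3 → ℕ → V) (q : ZMod 3 → ℕ → V) (qn : ZMod 3 → ℕ) : Prop :=
  1 ≤ lam ∧ 0 ≤ c ∧ 10 * σ < r ∧ r < R ∧
  (∀ i : ZMod 3, IsQGRay X lam c (γ i) ∧ γ i 0 = v₀ ∧ IsRay X (w i) ∧
    (∀ j : ℕ, j < qn i → X.Adj (q i j) (q i (j + 1)))) ∧
  ∀ i : ZMod 3,
    -- (CE1)
    IsBiQG X lam c (biconcat (γ (i + 1)) (γ (i + 2))) ∧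
    -- (CE2)
    (∃ U : Set V,
      IsCompOf X U (Set.range (biconcat (γ (i + 1)) (γ (i + 2))) \
        gnbhd X (q 0 '' Set.Iic (qn 0) ∪ q 1 '' Set.Iic (qn 1) ∪ q 2 '' Set.Iic (qn 2))
          (10 * σ)) ∧ w i 0 ∈ U ∧ v₀ ∈ U) ∧
    -- (CE3)
    WitnessPair X σ (biconcat (γ (i + 1)) (γ (i + 2))) (w i) (γ i) ∧
    -- (CE4)
    (∀ t : ℕ, r < (t : ℝ) → ∀ s : ℤ,
      10 * σ < (X.dist (w i t) (biconcat (γ (i + 1)) (γ (i + 2)) s) : ℝ)) ∧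
    -- (CE5)
    (q i 0 ∈ Set.range (γ (i + 1)) ∧ q i (qn i) ∈ Set.range (γ (i + 2)) ∧
      (q i '' Set.Iic (qn i)) ∩
        gnbhd X (Set.range (w (i + 1)) ∪ Set.range (w (i + 2)) ∪ Set.range (γ i))
          (10 * σ) = ∅) ∧
    -- (CE6)
    q i '' Set.Iic (qn i) ⊆ gnbhd X {v₀} (R - 10 * σ) \ gnbhd X {v₀} (r + 10 * σ)

/-- `X` has quadratic growth. -/
def QuadGrowth {V : Type*} (X : SimpleGraph V) : Prop :=
  ∃ C : ℝ, 0 < C ∧ ∀ v : V, ∀ n : ℕ, 1 ≤ n →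
    ({u : V | X.dist u v ≤ n}.ncard : ℝ) ≤ C * (n : ℝ) ^ 2

/-- The set of vertices at distance exactly `1` from `A`. -/
def vertexBoundary {V : Type*} (X : SimpleGraph V) (A : Set V) : Set V :=
  {v : V | v ∉ A ∧ ∃ a ∈ A, X.Adj v a}

/-- The depth of `A`: `inf {r ≥ 0 : A ⊆ N_r(∂A)}`. -/
noncomputable def gdepth {V : Type*} (X : SimpleGraph V) (A : Set V) : ℝ :=
  sInf {r : ℝ | 0 ≤ r ∧ A ⊆ gnbhd X (vertexBoundary X A) r}

/-- A `(lam, c)`-quasi-circle of length `n ≥ 1`: a closed path all of whose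
subpaths of length at most `n / 2` are `(lam, c)`-quasi-geodesics. -/
def IsQuasiCircle {V : Type*} (X : SimpleGraph V) (lam c : ℝ) (n : ℕ)
    (C : ZMod n → V) : Prop :=
  1 ≤ n ∧ (∀ k : ZMod n, X.Adj (C k) (C (k + 1))) ∧
    ∀ (k : ZMod n) (m s t : ℕ), 2 * m ≤ n → s ≤ m → t ≤ m →
      |(s : ℝ) - (t : ℝ)| / lam - c ≤
        (X.dist (C (k + (s : ZMod n))) (C (k + (t : ZMod n))) : ℝ)

/-- A truncated `(lam, c)`-quasi-circle with major face `F` (of length `nF`) and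
minor face `f` (of length `nf`): `F` is the initial part of a `(lam, c)`-quasi-circle
and `f` is a `(lam, c)`-quasi-geodesic with the same endpoints as the remaining part. -/
def IsTruncQuasiCircle {V : Type*} (X : SimpleGraph V) (lam c : ℝ)
    (F : ℕ → V) (nF : ℕ) (f : ℕ → V) (nf : ℕ) : Prop :=
  (∀ i : ℕ, i < nF → X.Adj (F i) (F (i + 1))) ∧
  (∀ i : ℕ, i < nf → X.Adj (f i) (f (i + 1))) ∧
  f 0 = F nF ∧ f nf = F 0 ∧
  (∀ s t : ℕ, s ≤ nf → t ≤ nf →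
    |(s : ℝ) - (t : ℝ)| / lam - c ≤ (X.dist (f s) (f t) : ℝ)) ∧
  ∃ (n : ℕ) (C : ZMod n → V), IsQuasiCircle X lam c n C ∧ nF ≤ n ∧
    ∀ i : ℕ, i ≤ nF → C (i : ZMod n) = F i

/-- The graph `X`, with its graph metric, is quasi-isometric to the metric space `Y`. -/
def QIto {V : Type*} (X : SimpleGraph V) (Y : Type*) [PseudoMetricSpace Y] : Prop :=
  ∃ (lam c : ℝ) (f : V → Y), 1 ≤ lam ∧ 0 ≤ c ∧
    (∀ x x' : V, (X.dist x x' : ℝ) / lam - c ≤ dist (f x) (f x') ∧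
      dist (f x) (f x') ≤ lam * (X.dist x x' : ℝ) + c) ∧
    ∀ y : Y, ∃ x : V, dist y (f x) ≤ c

/-- The Gromov product `(x · y)_w` in the graph metric. -/
noncomputable def gromovProd {V : Type*} (X : SimpleGraph V) (w x y : V) : ℝ :=
  ((X.dist x w : ℝ) + (X.dist y w : ℝ) - (X.dist x y : ℝ)) / 2

/-- `X` is Gromov hyperbolic. -/
def GromovHyperbolic {V : Type*} (X : SimpleGraph V) : Prop :=
  ∃ δ : ℝ, 0 ≤ δ ∧ ∀ w x y z : V,
    min (gromovProd X w x z) (gromovProd X w y z) - δ ≤ gromovProd X w x y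

/-! ### Vertex-transitive graphs and their balls -/

/-- An infinite, connected, locally finite, vertex-transitive graph. -/
structure TransGraph {V : Type*} (X : SimpleGraph V) : Prop where
  inf : Infinite V
  conn : X.Connected
  lf : ∀ v : V, (X.neighborSet v).Finite
  trans : ∀ u v : V, ∃ φ : X ≃g X, φ u = v

/-- Closed neighbourhood of integer radius. -/
def nb {V : Type*} (X : SimpleGraph V) (A : Set V) (s : ℕ) : Set V :=
  {v : V | ∃ a ∈ A, X.dist v a ≤ s}

theorem gnbhd_eq_nb {V : Type*} (X : SimpleGraph V) (A : Set V) {r : ℝ} (hr : 0 ≤ r) :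
    gnbhd X A r = nb X A ⌊r⌋₊ := by
  ext v
  simp [gnbhd, nb, Nat.le_floor_iff hr]

theorem dist_iso_le {V : Type*} {X : SimpleGraph V} (hc : X.Connected) (φ : X ≃g X) (u v : V) :
    X.dist (φ u) (φ v) ≤ X.dist u v := by
  obtain ⟨p, hp⟩ := hc.exists_walk_length_eq_dist u v
  have := dist_le (p.map φ.toHom)
  rw [Walk.length_map, hp] at this
  exact this

namespace TransGraph

variable {V : Type*} {X : SimpleGraph V} (hX : TransGraph X)
include hX

theorem dist_iso (φ : X ≃g X) (u v : V) : X.dist (φ u) (φ v) = X.dist u v := by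
  apply le_antisymm (dist_iso_le hX.conn φ u v)
  have := dist_iso_le hX.conn φ.symm (φ u) (φ v)
  simpa using this

theorem tri (u v w : V) : X.dist u w ≤ X.dist u v + X.dist v w := hX.conn.dist_triangle

theorem dist_eq_zero {u v : V} : X.dist u v = 0 ↔ u = v := hX.conn.dist_eq_zero_iff

theorem dist_adj {u v : V} (h : X.Adj u v) : X.dist u v = 1 := by
  have := hX.conn
  exact dist_eq_one_iff_adj.2 h

theorem exists_adj_dist (u v : V) {n : ℕ} (h : X.dist u v = n + 1) :
    ∃ w, X.Adj u w ∧ X.dist w v = n := by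
  obtain ⟨p, hp⟩ := hX.conn.exists_walk_length_eq_dist u v
  cases p with
  | nil => simp at h
  | @cons _ w _ ha q =>
    refine ⟨w, ha, ?_⟩
    have h1 := dist_le q
    have h2 := hX.tri u w v
    rw [hX.dist_adj ha] at h2
    simp only [Walk.length_cons] at hp
    omega

theorem finite_ball (v : V) (r : ℕ) : {u : V | X.dist u v ≤ r}.Finite := by
  induction r with
  | zero =>
    apply (Set.finite_singleton v).subset
    intro u hu
    exact hX.dist_eq_zero.1 (Nat.le_zero.1 hu)
  | succ r ih =>
    apply (ih.union (ih.biUnion fun w _ => hX.lf w)).subset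
    intro u hu
    rcases Nat.lt_or_ge r (X.dist u v) with h | h
    · right
      obtain ⟨w, h1, h2⟩ := hX.exists_adj_dist u v (n := r) (le_antisymm hu h)
      simp only [Set.mem_iUnion]
      exact ⟨w, h2.le, h1.symm⟩
    · left; exact h

omit hX in
/-- The closed ball of radius `r`, as a finite set. -/
noncomputable def ball (hX : TransGraph X) (v : V) (r : ℕ) : Finset V :=
  (hX.finite_ball v r).toFinset

@[simp] theorem mem_ball {v u : V} {r : ℕ} : u ∈ hX.ball v r ↔ X.dist u v ≤ r := by
  simp [ball]

theorem card_ball_iso (v : V) (r : ℕ) (φ : X ≃g X) :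
    (hX.ball (φ v) r).card = (hX.ball v r).card := by
  symm
  apply Finset.card_bij (fun u _ => φ u)
  · intro u hu
    simpa [hX.dist_iso] using hu
  · intro a _ b _ h
    exact φ.injective h
  · intro b hb
    refine ⟨φ.symm b, ?_, by simp⟩
    rw [mem_ball] at hb ⊢
    rw [← hX.dist_iso φ]
    simpa using hb

theorem card_ball_eq (u v : V) (r : ℕ) : (hX.ball u r).card = (hX.ball v r).card := by
  obtain ⟨φ, rfl⟩ := hX.trans v u
  exact hX.card_ball_iso v r φ

omit hX in
/-- A base vertex. -/
noncomputable def base (hX : TransGraph X) : V := (hX.inf.nonempty).some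

omit hX in
/-- The volume growth function. -/
noncomputable def vol (hX : TransGraph X) (r : ℕ) : ℕ := (hX.ball hX.base r).card

theorem card_ball (v : V) (r : ℕ) : (hX.ball v r).card = hX.vol r := hX.card_ball_eq _ _ _

theorem ball_subset {u v : V} {r r' : ℕ} (h : X.dist u v + r ≤ r') :
    hX.ball u r ⊆ hX.ball v r' := by
  intro w hw
  rw [mem_ball] at *
  have := hX.tri w u v
  omega

theorem vol_mono {r r' : ℕ} (h : r ≤ r') : hX.vol r ≤ hX.vol r' :=
  Finset.card_le_card (hX.ball_subset (by simpa using h))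

theorem vol_pos (r : ℕ) : 0 < hX.vol r :=
  Finset.card_pos.2 ⟨hX.base, by simp⟩

/-- Along a geodesic one finds a point at any intermediate distance. -/
theorem exists_between (u v : V) {a b : ℕ} (h : X.dist u v = a + b) :
    ∃ w, X.dist u w = a ∧ X.dist w v = b := by
  induction a generalizing u with
  | zero => exact ⟨u, by simp, by simpa using h⟩
  | succ a ih =>
    obtain ⟨w, h1, h2⟩ := hX.exists_adj_dist u v (n := a + b) (by omega)
    obtain ⟨x, h3, h4⟩ := ih w h2
    refine ⟨x, ?_, h4⟩
    have := hX.tri u w x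
    have := hX.tri u x v
    rw [hX.dist_adj h1] at *
    omega

theorem vol_add (a b : ℕ) : hX.vol (a + b) ≤ hX.vol a * hX.vol b := by
  classical
  have : hX.ball hX.base (a + b) ⊆ (hX.ball hX.base a).biUnion fun w => hX.ball w b := by
    intro u hu
    rw [mem_ball] at hu
    rw [Finset.mem_biUnion]
    by_cases h : X.dist u hX.base ≤ b
    · exact ⟨hX.base, by simp, by simpa using h⟩
    · obtain ⟨w, h1, h2⟩ := hX.exists_between u hX.base (a := b) (b := X.dist u hX.base - b)
        (by omega)
      exact ⟨w, by rw [mem_ball]; omega, by rw [mem_ball]; omega⟩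
  refine (Finset.card_le_card this).trans ?_
  refine (Finset.card_biUnion_le).trans ?_
  rw [Finset.sum_congr rfl (fun w _ => hX.card_ball w b)]
  simp [vol]

end TransGraph

/-! ### Connected components of vertex sets -/

/-- `u` and `v` are joined by a path inside `S`. -/
def JoinedWithin {V : Type*} (X : SimpleGraph V) (S : Set V) (u v : V) : Prop :=
  u ∈ S ∧ Relation.ReflTransGen (fun a b => X.Adj a b ∧ b ∈ S) u v

namespace JoinedWithin

variable {V : Type*} {X : SimpleGraph V} {S T : Set V} {u v w : V}

theorem refl (h : u ∈ S) : JoinedWithin X S u u := ⟨h, .refl⟩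

theorem right_mem (h : JoinedWithin X S u v) : v ∈ S := by
  obtain ⟨h1, h2⟩ := h
  cases h2 with
  | refl => exact h1
  | tail _ h => exact h.2

theorem trans (h : JoinedWithin X S u v) (h' : JoinedWithin X S v w) : JoinedWithin X S u w :=
  ⟨h.1, h.2.trans h'.2⟩

theorem of_adj (hu : u ∈ S) (hv : v ∈ S) (h : X.Adj u v) : JoinedWithin X S u v :=
  ⟨hu, .single ⟨h, hv⟩⟩

theorem symm (h : JoinedWithin X S u v) : JoinedWithin X S v u := by
  obtain ⟨h1, h2⟩ := h
  induction h2 with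
  | refl => exact .refl h1
  | @tail b c hab hbc ih => exact (of_adj hbc.2 (JoinedWithin.right_mem ⟨h1, hab⟩) hbc.1.symm).trans ih

theorem mono (hST : S ⊆ T) (h : JoinedWithin X S u v) : JoinedWithin X T u v :=
  ⟨hST h.1, Relation.ReflTransGen.mono (fun _ _ h => ⟨h.1, hST h.2⟩) _ _ h.2⟩

end JoinedWithin

/-- The set of points joined to `u` inside `S`. -/
def compOf {V : Type*} (X : SimpleGraph V) (S : Set V) (u : V) : Set V :=
  {v | JoinedWithin X S u v}

section Components

variable {V : Type*} {X : SimpleGraph V} {S T Z : Set V} {u v w : V}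

theorem connSet_iff : ConnSet X Z ↔ Z.Nonempty ∧ ∀ u ∈ Z, ∀ v ∈ Z, JoinedWithin X Z u v := by
  constructor
  · intro h
    have hne : Z.Nonempty := by
      obtain ⟨x⟩ := h.nonempty
      exact ⟨x.1, x.2⟩
    refine ⟨hne, fun u hu v hv => ?_⟩
    have := h.preconnected ⟨u, hu⟩ ⟨v, hv⟩
    rw [SimpleGraph.reachable_iff_reflTransGen] at this
    refine ⟨hu, ?_⟩
    exact Relation.ReflTransGen.lift (p := fun a b => X.Adj a b ∧ b ∈ Z)
      (fun x : Z => (x : V)) (fun a b hab => ⟨hab, b.2⟩) _ _ this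
  · rintro ⟨⟨z, hz⟩, h⟩
    have : Nonempty Z := ⟨⟨z, hz⟩⟩
    refine ⟨?_⟩
    rintro ⟨u, hu⟩ ⟨v, hv⟩
    obtain ⟨h1, h2⟩ := h u hu v hv
    induction h2 with
    | refl => exact .refl _
    | @tail b c hab hbc ih =>
      have hb : b ∈ Z := JoinedWithin.right_mem ⟨h1, hab⟩
      exact (ih hb).trans (SimpleGraph.Adj.reachable (show (X.induce Z).Adj ⟨b, hb⟩ ⟨c, hv⟩ from hbc.1))

theorem compOf_subset : compOf X S u ⊆ S := fun _ h => h.right_mem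

theorem JoinedWithin.in_compOf (h : JoinedWithin X S u v) : JoinedWithin X (compOf X S u) u v := by
  obtain ⟨h1, h2⟩ := h
  induction h2 with
  | refl => exact .refl (.refl h1)
  | @tail b c hab hbc ih =>
    exact ih.trans (.of_adj ih.right_mem ⟨h1, hab.tail hbc⟩ hbc.1)

theorem self_mem_compOf (h : u ∈ S) : u ∈ compOf X S u := .refl h

theorem connSet_compOf (h : u ∈ S) : ConnSet X (compOf X S u) :=
  connSet_iff.2 ⟨⟨u, self_mem_compOf h⟩, fun _ ha _ hb => (JoinedWithin.in_compOf ha).symm.trans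
    (JoinedWithin.in_compOf hb)⟩

theorem isCompOf_compOf (h : u ∈ S) : IsCompOf X (compOf X S u) S := by
  refine ⟨compOf_subset, ⟨u, self_mem_compOf h⟩, connSet_compOf h, ?_⟩
  intro U' h1 h2 h3
  apply Set.Subset.antisymm _ h1
  intro v hv
  exact ((connSet_iff.1 h3).2 u (h1 (self_mem_compOf h)) v hv).mono h2

theorem ConnSet.subset_compOf (hZ : ConnSet X Z) (hZS : Z ⊆ S) (hu : u ∈ Z) :
    Z ⊆ compOf X S u := fun v hv => ((connSet_iff.1 hZ).2 u hu v hv).mono hZS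

theorem IsCompOf.eq_compOf {U : Set V} (h : IsCompOf X U S) (hu : u ∈ U) : U = compOf X S u := by
  obtain ⟨h1, h2, h3, h4⟩ := h
  exact (h4 _ (h3.subset_compOf h1 hu) compOf_subset (connSet_compOf (h1 hu))).symm

theorem compOf_eq (h : v ∈ compOf X S u) : compOf X S v = compOf X S u := by
  ext w
  exact ⟨fun hw => JoinedWithin.trans h hw, fun hw => JoinedWithin.trans (JoinedWithin.symm h) hw⟩

end Components

/-! ### Quasi-geodesic lines, wide components and growth -/

/-- The bisection property with integer separation constant. -/
def Bisects {V : Type*} (X : SimpleGraph V) (s : ℕ) : Prop :=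
  ∀ ρ : ℤ → V, IsBiQuasiGeodesic X ρ → TwoWideComps X (nb X (Set.range ρ) s)ᶜ

theorem UBQ.bisects {V : Type*} {X : SimpleGraph V} {σ : ℝ} (hσ : 0 < σ) (h : UBQ X σ) :
    Bisects X ⌊σ⌋₊ := by
  intro ρ hρ
  rw [← gnbhd_eq_nb X _ hσ.le]
  exact h ρ hρ

section Bisect

variable {V : Type*} {X : SimpleGraph V} {s : ℕ} {ρ : ℤ → V}

theorem Bisects.exists_two (h : Bisects X s) (hρ : IsBiQuasiGeodesic X ρ) :
    ∃ u₁ ∈ (nb X (Set.range ρ) s)ᶜ, ∃ u₂ ∈ (nb X (Set.range ρ) s)ᶜ,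
      ¬ JoinedWithin X (nb X (Set.range ρ) s)ᶜ u₁ u₂ ∧
      Wide X (compOf X (nb X (Set.range ρ) s)ᶜ u₁) ∧
      Wide X (compOf X (nb X (Set.range ρ) s)ᶜ u₂) := by
  obtain ⟨U₁, U₂, hne, h1, h2, w1, w2, -⟩ := h ρ hρ
  obtain ⟨u₁, hu₁⟩ := h1.2.1
  obtain ⟨u₂, hu₂⟩ := h2.2.1
  have e1 := h1.eq_compOf hu₁
  have e2 := h2.eq_compOf hu₂
  refine ⟨u₁, h1.1 hu₁, u₂, h2.1 hu₂, fun hj => hne ?_, e1 ▸ w1, e2 ▸ w2⟩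
  rw [e1, e2]
  exact (compOf_eq hj).symm

theorem Bisects.not_three (h : Bisects X s) (hρ : IsBiQuasiGeodesic X ρ) {u : Fin 3 → V}
    (hu : ∀ i, u i ∈ (nb X (Set.range ρ) s)ᶜ)
    (hw : ∀ i, Wide X (compOf X (nb X (Set.range ρ) s)ᶜ (u i)))
    (h01 : ¬ JoinedWithin X (nb X (Set.range ρ) s)ᶜ (u 0) (u 1))
    (h02 : ¬ JoinedWithin X (nb X (Set.range ρ) s)ᶜ (u 0) (u 2))
    (h12 : ¬ JoinedWithin X (nb X (Set.range ρ) s)ᶜ (u 1) (u 2)) : False := by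
  obtain ⟨U₁, U₂, hne, -, -, -, -, hall⟩ := h ρ hρ
  have key : ∀ i j, compOf X (nb X (Set.range ρ) s)ᶜ (u i) = compOf X (nb X (Set.range ρ) s)ᶜ (u j) →
      JoinedWithin X (nb X (Set.range ρ) s)ᶜ (u i) (u j) := by
    intro i j hij
    have : u j ∈ compOf X (nb X (Set.range ρ) s)ᶜ (u i) := by
      rw [hij]; exact self_mem_compOf (hu j)
    exact this
  have a0 := hall _ (isCompOf_compOf (hu 0)) (hw 0)
  have a1 := hall _ (isCompOf_compOf (hu 1)) (hw 1)
  have a2 := hall _ (isCompOf_compOf (hu 2)) (hw 2)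
  rcases a0 with a0 | a0 <;> rcases a1 with a1 | a1
  · exact h01 (key _ _ (a0.trans a1.symm))
  · rcases a2 with a2 | a2
    · exact h02 (key _ _ (a0.trans a2.symm))
    · exact h12 (key _ _ (a1.trans a2.symm))
  · rcases a2 with a2 | a2
    · exact h12 (key _ _ (a1.trans a2.symm))
    · exact h02 (key _ _ (a0.trans a2.symm))
  · exact h01 (key _ _ (a0.trans a1.symm))

end Bisect

namespace TransGraph

variable {V : Type*} {X : SimpleGraph V} (hX : TransGraph X)
include hX

theorem dist_path_le {ρ : ℤ → V} (hρ : ∀ n : ℤ, X.Adj (ρ n) (ρ (n + 1))) (a b : ℤ) :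
    X.dist (ρ a) (ρ b) ≤ (a - b).natAbs := by
  have key : ∀ (n : ℕ) (a : ℤ), X.dist (ρ a) (ρ (a + n)) ≤ n := by
    intro n
    induction n with
    | zero => simp
    | succ n ih =>
      intro a
      have h1 := ih a
      have h2 := hX.tri (ρ a) (ρ (a + n)) (ρ (a + n + 1))
      rw [hX.dist_adj (hρ _)] at h2
      push_cast
      rw [← add_assoc]
      omega
  rcases le_total a b with h | h
  · have := key (b - a).toNat a
    rw [Int.toNat_of_nonneg (by omega)] at this
    rw [show a + (b - a) = b by ring] at this
    omega
  · have := key (a - b).toNat b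
    rw [Int.toNat_of_nonneg (by omega)] at this
    rw [show b + (a - b) = a by ring, SimpleGraph.dist_comm] at this
    omega

theorem narrow_of_subset_nb {ρ : ℤ → V} (hρ : IsBiQuasiGeodesic X ρ) {Z : Set V} {D : ℕ}
    (hZ : Z ⊆ nb X (Set.range ρ) D) : Narrow X Z := by
  obtain ⟨lam, c, hl, hc, hadj, hq⟩ := hρ
  have : ∀ z : Z, ∃ t : ℤ, X.dist z.1 (ρ t) ≤ D := by
    intro z
    obtain ⟨a, ⟨t, rfl⟩, h⟩ := hZ z.2
    exact ⟨t, h⟩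
  choose f hf using this
  refine ⟨lam, lam * (2 * D + c) + 2 * D, fun z => (f z : ℝ), hl, by positivity, fun x y => ?_⟩
  have h1 := hq (f x) (f y)
  have hl0 : 0 < lam := by linarith
  have h2 : |(f x : ℝ) - f y| ≤ lam * (X.dist (ρ (f x)) (ρ (f y)) + c) := by
    rw [sub_le_iff_le_add, div_le_iff₀ hl0] at h1
    linarith
  have t1 := hX.tri (ρ (f x)) x.1 (ρ (f y))
  have t2 := hX.tri x.1 y.1 (ρ (f y))
  have t3 := hX.tri x.1 (ρ (f x)) y.1
  have t4 := hX.tri (ρ (f x)) (ρ (f y)) y.1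
  have e1 := SimpleGraph.dist_comm (G := X) (u := x.1) (v := ρ (f x))
  have e2 := SimpleGraph.dist_comm (G := X) (u := y.1) (v := ρ (f y))
  have p := hX.dist_path_le hadj (f x) (f y)
  have h3 : (X.dist (ρ (f x)) (ρ (f y)) : ℝ) ≤ X.dist x.1 y.1 + 2 * D := by
    have := hf x; have := hf y
    have : X.dist (ρ (f x)) (ρ (f y)) ≤ X.dist x.1 y.1 + 2 * D := by omega
    exact_mod_cast this
  have h4 : (X.dist x.1 y.1 : ℝ) ≤ |(f x : ℝ) - f y| + 2 * D := by
    have := hf x; have := hf y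
    have h : X.dist x.1 y.1 ≤ (f x - f y).natAbs + 2 * D := by omega
    have h' : ((f x - f y).natAbs : ℝ) = |(f x : ℝ) - f y| := by
      rw [Nat.cast_natAbs]; push_cast; rfl
    rw [← h']
    exact_mod_cast h
  constructor
  · have := mul_le_mul_of_nonneg_left h3 hl0.le
    have hD : (0 : ℝ) ≤ D := by positivity
    nlinarith
  · have hD : (0 : ℝ) ≤ D := by positivity
    have h5 : 0 ≤ |(f x : ℝ) - f y| := abs_nonneg _
    nlinarith

theorem exists_far_of_wide {ρ : ℤ → V} (hρ : IsBiQuasiGeodesic X ρ) {Z : Set V}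
    (hZ : Wide X Z) (D : ℕ) : ∃ z ∈ Z, ∀ t, D < X.dist z (ρ t) := by
  by_contra hcon
  push Not at hcon
  apply hZ
  apply hX.narrow_of_subset_nb hρ (D := D)
  intro z hz
  obtain ⟨t, ht⟩ := hcon z hz
  exact ⟨_, ⟨t, rfl⟩, ht⟩

theorem exists_at_dist {s : ℕ} (hB : Bisects X s) {ρ : ℤ → V} (hρ : IsBiQuasiGeodesic X ρ) (n : ℕ) :
    ∃ y t₀, X.dist y (ρ t₀) = n ∧ ∀ t, n ≤ X.dist y (ρ t) := by
  obtain ⟨u, hu, -, -, -, hw, -⟩ := hB.exists_two hρ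
  obtain ⟨z, -, hz⟩ := hX.exists_far_of_wide hρ hw n
  obtain ⟨t₀, ht₀⟩ : ∃ t₀, ∀ t, X.dist z (ρ t₀) ≤ X.dist z (ρ t) := by
    obtain ⟨t₀, -, ht₀⟩ := (measure (fun t => X.dist z (ρ t))).wf.has_min Set.univ ⟨0, trivial⟩
    exact ⟨t₀, fun t => not_lt.1 (ht₀ t trivial)⟩
  obtain ⟨w, h1, h2⟩ := hX.exists_between z (ρ t₀) (a := X.dist z (ρ t₀) - n) (b := n)
    (by have := hz t₀; omega)
  refine ⟨w, t₀, h2, fun t => ?_⟩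
  have := hX.tri z w (ρ t)
  have := ht₀ t
  have := hz t₀
  omega

theorem card_mul_vol_le {ι : Type*} (I : Finset ι) (f : ι → V) {r R : ℕ} (x : V)
    (hsep : ∀ i ∈ I, ∀ j ∈ I, i ≠ j → 2 * r < X.dist (f i) (f j))
    (hin : ∀ i ∈ I, X.dist (f i) x + r ≤ R) : I.card * hX.vol r ≤ hX.vol R := by
  classical
  rw [← hX.card_ball x R]
  have : I.biUnion (fun i => hX.ball (f i) r) ⊆ hX.ball x R :=
    Finset.biUnion_subset.2 fun i hi => hX.ball_subset (hin i hi)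
  refine le_trans (le_of_eq ?_) (Finset.card_le_card this)
  rw [Finset.card_biUnion]
  · simp [hX.card_ball]
  · intro i hi j hj hij
    rw [Function.onFun, Finset.disjoint_left]
    intro u hu hu'
    rw [mem_ball] at hu hu'
    have := hsep i hi j hj hij
    have := hX.tri (f i) u (f j)
    have := SimpleGraph.dist_comm (G := X) (u := u) (v := f i)
    omega

/-- A bi-infinite geodesic. -/
def _root_.IsGeodLine (X : SimpleGraph V) (ℓ : ℤ → V) : Prop :=
  ∀ i j : ℤ, X.dist (ℓ i) (ℓ j) = (i - j).natAbs

omit hX in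
theorem _root_.IsGeodLine.adj {ℓ : ℤ → V} (h : IsGeodLine X ℓ) (n : ℤ) :
    X.Adj (ℓ n) (ℓ (n + 1)) := by
  rw [← dist_eq_one_iff_adj, h]
  simp

omit hX in
theorem _root_.IsGeodLine.isBiQuasiGeodesic {ℓ : ℤ → V} (h : IsGeodLine X ℓ) :
    IsBiQuasiGeodesic X ℓ := by
  refine ⟨1, 0, le_rfl, le_rfl, h.adj, fun a b => ?_⟩
  rw [h, Nat.cast_natAbs]
  simp

theorem four_mul_vol_le {s : ℕ} (hB : Bisects X s) {ℓ : ℤ → V} (hℓ : IsGeodLine X ℓ) (r : ℕ) :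
    4 * hX.vol r ≤ hX.vol (3 * r + 1) := by
  obtain ⟨y, t₀, h1, h2⟩ := hX.exists_at_dist hB hℓ.isBiQuasiGeodesic (2 * r + 1)
  have h2' : ∀ t, 2 * r + 1 ≤ X.dist (ℓ t) y := fun t => by
    rw [SimpleGraph.dist_comm]; exact h2 t
  have := hX.card_mul_vol_le (Finset.univ : Finset (Fin 4))
    ![y, ℓ t₀, ℓ (t₀ + (2 * r + 1)), ℓ (t₀ - (2 * r + 1))] (r := r) (R := 3 * r + 1) (ℓ t₀) ?_ ?_
  · simpa using this
  · intro i _ j _ hij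
    fin_cases i <;> fin_cases j <;> first | exact absurd rfl hij | skip
    all_goals simp
    all_goals first | exact h2 _ | exact h2' _ | (rw [hℓ]; omega)
  · intro i _
    fin_cases i
    · simp [h1]; omega
    all_goals simp
    · omega
    all_goals (rw [hℓ]; omega)

theorem four_pow_le_vol {s : ℕ} (hB : Bisects X s) {ℓ : ℤ → V} (hℓ : IsGeodLine X ℓ) (j : ℕ) :
    4 ^ j ≤ hX.vol ((3 ^ j - 1) / 2) := by
  induction j with
  | zero => simpa using Nat.succ_le_of_lt (hX.vol_pos 0)
  | succ j ih =>
    have h := hX.four_mul_vol_le hB hℓ ((3 ^ j - 1) / 2)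
    have h3 : 1 ≤ 3 ^ j := Nat.one_le_pow _ _ (by norm_num)
    have hodd : 3 ^ j % 2 = 1 := by
      rw [Nat.pow_mod]; simp
    have e : 3 * ((3 ^ j - 1) / 2) + 1 = (3 ^ (j + 1) - 1) / 2 := by
      rw [pow_succ]; omega
    rw [← e, pow_succ]
    omega

theorem not_ball_subset_of_narrow {s : ℕ} (hB : Bisects X s) {ℓ : ℤ → V} (hℓ : IsGeodLine X ℓ)
    {A : Set V} (hA : Narrow X A) : ∃ r, ∀ x, ¬ ((hX.ball x r : Set V) ⊆ A) := by
  classical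
  obtain ⟨lam, c, f, hl, hc, hf⟩ := hA
  by_contra hcon
  push Not at hcon
  set k := ⌈lam + c⌉₊ with hk
  have key : ∀ r : ℕ, (hX.vol r : ℝ) ≤ (2 * (lam * r + c) + 2) * hX.vol k := by
    intro r
    obtain ⟨x, hx⟩ := hcon r
    set g : V → ℝ := fun u => if h : u ∈ A then f ⟨u, h⟩ else 0 with hg
    have hgA : ∀ u ∈ A, ∀ v ∈ A, |g u - g v| ≤ lam * X.dist u v + c ∧
        (X.dist u v : ℝ) ≤ lam * |g u - g v| + c := by
      intro u hu v hv
      have := hf ⟨u, hu⟩ ⟨v, hv⟩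
      simpa [hg, hu, hv] using this
    have hxA : x ∈ A := hx (by simp)
    have hlr : 0 ≤ lam * r + c := by positivity
    set N := ⌊2 * (lam * r + c)⌋₊ + 1 with hN
    set F : V → ℕ := fun u => ⌊g u - (g x - (lam * r + c))⌋₊ with hF
    have hmap : ∀ u ∈ hX.ball x r, 0 ≤ g u - (g x - (lam * r + c)) ∧
        g u - (g x - (lam * r + c)) ≤ 2 * (lam * r + c) := by
      intro u hu
      have h1 := (hgA u (hx hu) x hxA).1
      have h2 : (X.dist u x : ℝ) ≤ r := by exact_mod_cast (hX.mem_ball.1 hu)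
      have h3 : lam * X.dist u x ≤ lam * r := mul_le_mul_of_nonneg_left h2 (by linarith)
      have h4 := abs_le.1 h1
      constructor <;> linarith
    have h1 : (hX.ball x r).card ≤ hX.vol k * (Finset.range N).card := by
      apply Finset.card_le_mul_card_image_of_maps_to (f := F)
      · intro u hu
        rw [Finset.mem_range, hN, Nat.lt_succ_iff]
        exact Nat.floor_le_floor (hmap u hu).2
      · intro b hb
        by_cases hne : ((hX.ball x r).filter (fun u => F u = b)).Nonempty
        · obtain ⟨w, hw⟩ := hne
          rw [← hX.card_ball w k]
          apply Finset.card_le_card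
          intro u hu
          rw [Finset.mem_filter] at hu hw
          rw [mem_ball]
          have := (hgA u (hx hu.1) w (hx hw.1)).2
          have hd : |g u - g w| ≤ 1 := by
            have a1 := Nat.floor_le (hmap u hu.1).1
            have a2 := Nat.lt_floor_add_one (g u - (g x - (lam * r + c)))
            have b1 := Nat.floor_le (hmap w hw.1).1
            have b2 := Nat.lt_floor_add_one (g w - (g x - (lam * r + c)))
            have e1 : ⌊g u - (g x - (lam * r + c))⌋₊ = b := hu.2
            have e2 : ⌊g w - (g x - (lam * r + c))⌋₊ = b := hw.2
            rw [e1] at a1 a2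
            rw [e2] at b1 b2
            rw [abs_le]; constructor <;> linarith
          have h5 : (X.dist u w : ℝ) ≤ lam + c := by nlinarith
          have := h5.trans (Nat.le_ceil _)
          exact_mod_cast this
        · rw [Finset.not_nonempty_iff_eq_empty] at hne
          rw [hne]; simp
    rw [hX.card_ball, Finset.card_range] at h1
    have h2 : (N : ℝ) ≤ 2 * (lam * r + c) + 2 := by
      have := Nat.floor_le (show 0 ≤ 2 * (lam * r + c) by positivity)
      rw [hN]; push_cast; linarith
    have h3 : (hX.vol r : ℝ) ≤ hX.vol k * N := by exact_mod_cast h1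
    calc (hX.vol r : ℝ) ≤ hX.vol k * N := h3
      _ ≤ hX.vol k * (2 * (lam * r + c) + 2) := by gcongr
      _ = _ := by ring
  have lim : ∃ j : ℕ, (2 * (lam + c) + 2) * hX.vol k < (4 / 3 : ℝ) ^ j :=
    pow_unbounded_of_one_lt _ (by norm_num)
  obtain ⟨j, hj⟩ := lim
  have h1 := key ((3 ^ j - 1) / 2)
  have h2 := hX.four_pow_le_vol hB hℓ j
  have h2' : (4 : ℝ) ^ j ≤ hX.vol ((3 ^ j - 1) / 2) := by exact_mod_cast h2
  have h3 : (((3 ^ j - 1) / 2 : ℕ) : ℝ) ≤ 3 ^ j := by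
    have : (3 ^ j - 1) / 2 ≤ 3 ^ j := (Nat.div_le_self _ _).trans (Nat.sub_le _ _)
    exact_mod_cast this
  have h4 : (1 : ℝ) ≤ 3 ^ j := one_le_pow₀ (by norm_num)
  have h5 : (2 * (lam * ((3 ^ j - 1) / 2 : ℕ) + c) + 2) * hX.vol k ≤
      ((2 * (lam + c) + 2) * hX.vol k) * 3 ^ j := by
    have : 2 * (lam * (((3 ^ j - 1) / 2 : ℕ) : ℝ) + c) + 2 ≤ (2 * (lam + c) + 2) * 3 ^ j := by
      nlinarith [mul_le_mul_of_nonneg_left h3 (show 0 ≤ lam by linarith)]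
    calc _ ≤ ((2 * (lam + c) + 2) * 3 ^ j) * (hX.vol k : ℝ) := by gcongr
      _ = _ := by ring
  rw [div_pow, lt_div_iff₀ (by positivity)] at hj
  linarith

end TransGraph

/-! ### Geodesic lines in non-hyperbolic graphs -/

/-- `p` lies on some geodesic from `x` to `y`. -/
def OnGeod {V : Type*} (X : SimpleGraph V) (x y p : V) : Prop :=
  X.dist x p + X.dist p y = X.dist x y

/-- `γ` is isometric on the integer interval `[a, b]`. -/
def GeodOn {V : Type*} (X : SimpleGraph V) (γ : ℤ → V) (a b : ℤ) : Prop :=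
  ∀ i j : ℤ, a ≤ i → i ≤ b → a ≤ j → j ≤ b → X.dist (γ i) (γ j) = (i - j).natAbs

/-- A set which embeds isometrically in `ℤ`. -/
def LineSet {V : Type*} (X : SimpleGraph V) (P : Set V) : Prop :=
  ∃ f : V → ℤ, ∀ u ∈ P, ∀ v ∈ P, X.dist u v = (f u - f v).natAbs

theorem GeodOn.lineSet {V : Type*} {X : SimpleGraph V} {γ : ℤ → V} {a b : ℤ} (h : GeodOn X γ a b) :
    LineSet X (γ '' Set.Icc a b) := by
  refine ⟨fun u => X.dist u (γ a), ?_⟩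
  rintro _ ⟨i, ⟨hi, hi'⟩, rfl⟩ _ ⟨j, ⟨hj, hj'⟩, rfl⟩
  dsimp only
  rw [h i j hi hi' hj hj', h i a hi hi' le_rfl (by omega), h j a hj hj' le_rfl (by omega)]
  omega

theorem IsGeodLine.lineSet {V : Type*} {X : SimpleGraph V} {ℓ : ℤ → V} (h : IsGeodLine X ℓ) :
    LineSet X (Set.range ℓ) := by
  have hinj : ∀ i j, ℓ i = ℓ j → i = j := fun i j hij => by
    have := h i j
    rw [hij, SimpleGraph.dist_self] at this
    omega
  refine ⟨Function.invFun ℓ, ?_⟩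
  rintro _ ⟨i, rfl⟩ _ ⟨j, rfl⟩
  rw [h, Function.leftInverse_invFun (fun i j => hinj i j), Function.leftInverse_invFun
    (fun i j => hinj i j)]

namespace TransGraph

variable {V : Type*} {X : SimpleGraph V} (hX : TransGraph X)
include hX

theorem dist_path_le_on {γ : ℤ → V} {a b : ℤ}
    (h : ∀ i, a ≤ i → i < b → X.Adj (γ i) (γ (i + 1))) {i : ℤ} (hi : a ≤ i) (n : ℕ)
    (hn : i + n ≤ b) : X.dist (γ i) (γ (i + n)) ≤ n := by
  induction n with
  | zero => simp
  | succ n ih =>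
    have h1 := ih (by push_cast at hn; omega)
    have h2 := hX.tri (γ i) (γ (i + n)) (γ (i + n + 1))
    rw [hX.dist_adj (h _ (by omega) (by push_cast at hn; omega))] at h2
    push_cast
    rw [← add_assoc]
    omega

theorem geodOn_of_dist {γ : ℤ → V} {a b : ℤ} (hab : a ≤ b)
    (h : ∀ i, a ≤ i → i < b → X.Adj (γ i) (γ (i + 1)))
    (hd : b - a ≤ X.dist (γ a) (γ b)) : GeodOn X γ a b := by
  have key : ∀ i j : ℤ, a ≤ i → i ≤ j → j ≤ b → X.dist (γ i) (γ j) = (i - j).natAbs := by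
    intro i j hi hij hj
    have e1 := hX.dist_path_le_on h (i := a) le_rfl (i - a).toNat (by omega)
    have e2 := hX.dist_path_le_on h (i := i) hi (j - i).toNat (by omega)
    have e3 := hX.dist_path_le_on h (i := j) (by omega) (b - j).toNat (by omega)
    rw [show a + ((i - a).toNat : ℤ) = i by omega] at e1
    rw [show i + ((j - i).toNat : ℤ) = j by omega] at e2
    rw [show j + ((b - j).toNat : ℤ) = b by omega] at e3
    have t1 := hX.tri (γ a) (γ i) (γ b)
    have t2 := hX.tri (γ i) (γ j) (γ b)
    omega
  intro i j hi hi' hj hj'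
  rcases le_total i j with hij | hij
  · exact key i j hi hij hj'
  · rw [SimpleGraph.dist_comm, key j i hj hij hi']; omega

theorem exists_seg_path (u v : V) : ∃ γ : ℤ → V, γ 0 = u ∧ γ (X.dist u v) = v ∧
    ∀ i : ℤ, 0 ≤ i → i < X.dist u v → X.Adj (γ i) (γ (i + 1)) := by
  obtain ⟨p, hp⟩ := hX.conn.exists_walk_length_eq_dist u v
  refine ⟨fun i => p.getVert i.toNat, by simp, by simp [← hp], fun i hi hi' => ?_⟩
  have := p.adj_getVert_succ (i := i.toNat) (by omega)
  rwa [show i.toNat + 1 = (i + 1).toNat by omega] at this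

theorem exists_seg (u v : V) : ∃ γ : ℤ → V, γ 0 = u ∧ γ (X.dist u v) = v ∧
    (∀ i : ℤ, 0 ≤ i → i < X.dist u v → X.Adj (γ i) (γ (i + 1))) ∧ GeodOn X γ 0 (X.dist u v) := by
  obtain ⟨γ, h1, h2, h3⟩ := hX.exists_seg_path u v
  refine ⟨γ, h1, h2, h3, hX.geodOn_of_dist (by omega) h3 ?_⟩
  rw [h1, h2]; omega

/-- Graphs with slim geodesic triangles are hyperbolic. -/
theorem gromovHyperbolic_of_slim {S : ℕ} (hS : ∀ x y z p : V, OnGeod X x y p →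
    ∃ q, (OnGeod X x z q ∨ OnGeod X z y q) ∧ X.dist p q ≤ S) : GromovHyperbolic X := by
  have hle : ∀ x z w q : V, OnGeod X x z q →
      X.dist x w + X.dist z w ≤ 2 * X.dist w q + X.dist x z := by
    intro x z w q hq
    unfold OnGeod at hq
    have := hX.tri x q w
    have := hX.tri z q w
    have := SimpleGraph.dist_comm (G := X) (u := z) (v := q)
    have := SimpleGraph.dist_comm (G := X) (u := w) (v := q)
    omega
  have hproj : ∀ x y w : V, ∃ p, OnGeod X x y p ∧
      2 * X.dist w p + X.dist x y ≤ X.dist x w + X.dist y w + 4 * S + 2 := by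
    intro x y w
    have core : ∀ p q₁ q₂, OnGeod X x y p → OnGeod X x w q₁ → OnGeod X w y q₂ → X.dist p q₁ ≤ S →
        X.dist p q₂ ≤ S + 1 →
        2 * X.dist w p + X.dist x y ≤ X.dist x w + X.dist y w + 4 * S + 2 := by
      intro p q₁ q₂ hp h1 h2 d1 d2
      unfold OnGeod at *
      have := hX.tri x q₁ p
      have := hX.tri w q₁ p
      have := hX.tri w q₂ p
      have := hX.tri p q₂ y
      have := SimpleGraph.dist_comm (G := X) (u := q₁) (v := p)
      have := SimpleGraph.dist_comm (G := X) (u := q₂) (v := p)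
      have := SimpleGraph.dist_comm (G := X) (u := q₁) (v := w)
      have := SimpleGraph.dist_comm (G := X) (u := y) (v := w)
      have := SimpleGraph.dist_comm (G := X) (u := x) (v := w)
      omega
    obtain ⟨p, ⟨hp, q₁, h1, d1⟩, hmin⟩ := (measure (fun p => X.dist p y)).wf.has_min
      {p | OnGeod X x y p ∧ ∃ q, OnGeod X x w q ∧ X.dist p q ≤ S}
      ⟨x, by simp [OnGeod], x, by simp [OnGeod], by simp⟩
    refine ⟨p, hp, ?_⟩
    by_cases hpy : X.dist p y = 0
    · exact core p q₁ y hp h1 (by simp [OnGeod]) d1 (by omega)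
    · obtain ⟨p', ha, hp'⟩ := hX.exists_adj_dist p y (n := X.dist p y - 1) (by omega)
      have hda := hX.dist_adj ha
      have hbt : OnGeod X x y p' := by
        unfold OnGeod at *
        have := hX.tri x p p'
        have := hX.tri x p' y
        omega
      obtain ⟨q, hq, hd⟩ := hS x y w p' hbt
      rcases hq with hq | hq
      · exact absurd (show X.dist p' y < X.dist p y by omega) (hmin p' ⟨hbt, q, hq, hd⟩)
      · refine core p q₁ q hp h1 hq d1 ?_
        have := hX.tri p p' q
        omega
  refine ⟨3 * S + 1, by positivity, fun w x y z => ?_⟩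
  obtain ⟨p, hp, h1⟩ := hproj x y w
  obtain ⟨q, hq, hd⟩ := hS x y z p hp
  have t := hX.tri w p q
  have h1' : 2 * (X.dist w p : ℝ) + X.dist x y ≤ X.dist x w + X.dist y w + 4 * S + 2 := by
    exact_mod_cast h1
  have t' : (X.dist w q : ℝ) ≤ X.dist w p + S := by
    have : X.dist w q ≤ X.dist w p + S := by omega
    exact_mod_cast this
  unfold gromovProd
  rcases hq with hq | hq
  · have h2 := hle x z w q hq
    have h2' : (X.dist x w : ℝ) + X.dist z w ≤ 2 * X.dist w q + X.dist x z := by exact_mod_cast h2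
    have := min_le_left (((X.dist x w : ℝ) + X.dist z w - X.dist x z) / 2)
      (((X.dist y w : ℝ) + X.dist z w - X.dist y z) / 2)
    linarith
  · have h2 := hle z y w q hq
    have h2' : (X.dist z w : ℝ) + X.dist y w ≤ 2 * X.dist w q + X.dist z y := by exact_mod_cast h2
    rw [SimpleGraph.dist_comm (u := z) (v := y)] at h2'
    have := min_le_right (((X.dist x w : ℝ) + X.dist z w - X.dist x z) / 2)
      (((X.dist y w : ℝ) + X.dist z w - X.dist y z) / 2)
    linarith

theorem exists_fat (hnh : ¬ GromovHyperbolic X) (o : V) (S : ℕ) :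
    ∃ (α : ℤ → V) (a b : ℕ) (z : V), S < a ∧ S < b ∧ α 0 = o ∧ GeodOn X α (-a) b ∧
      ∀ q, (OnGeod X (α (-a)) z q ∨ OnGeod X z (α b) q) → S < X.dist o q := by
  have : ∃ x y z p : V, OnGeod X x y p ∧ ∀ q, (OnGeod X x z q ∨ OnGeod X z y q) → S < X.dist p q := by
    by_contra hcon
    push Not at hcon
    exact hnh (hX.gromovHyperbolic_of_slim (S := S) hcon)
  obtain ⟨x, y, z, p, hp, hq⟩ := this
  obtain ⟨φ, hφ⟩ := hX.trans p o
  obtain ⟨γ₁, s1, e1, a1⟩ := hX.exists_seg_path o (φ x)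
  obtain ⟨γ₂, s2, e2, a2⟩ := hX.exists_seg_path o (φ y)
  have hx : X.dist o (φ x) = X.dist p x := by rw [← hφ, hX.dist_iso]
  have hy : X.dist o (φ y) = X.dist p y := by rw [← hφ, hX.dist_iso]
  have hbx : S < X.dist p x := hq x (Or.inl (by simp [OnGeod]))
  have hby : S < X.dist p y := hq y (Or.inr (by simp [OnGeod]))
  set α : ℤ → V := fun t => if 0 ≤ t then γ₂ t else γ₁ (-t) with hα
  have ea : α (-(X.dist p x : ℤ)) = φ x := by
    have : ¬ (0 ≤ -(X.dist p x : ℤ)) := by omega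
    simp only [hα, this, if_false, neg_neg]
    rw [← hx, e1]
  have eb : α (X.dist p y : ℤ) = φ y := by
    have : 0 ≤ (X.dist p y : ℤ) := by omega
    simp only [hα, this, if_true]
    rw [← hy, e2]
  refine ⟨α, X.dist p x, X.dist p y, φ z, hbx, hby, by simp [hα, s2], ?_, ?_⟩
  · apply hX.geodOn_of_dist (by omega)
    · intro i hi hi'
      by_cases h0 : 0 ≤ i
      · have : 0 ≤ i + 1 := by omega
        simp only [hα, h0, this, if_true]
        exact a2 i h0 (by omega)
      · by_cases h1 : i = -1
        · subst h1
          simp only [hα]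
          norm_num
          rw [s2, ← s1]
          have := a1 0 le_rfl (by omega)
          exact this.symm
        · have h2 : ¬ (0 ≤ i + 1) := by omega
          simp only [hα, h0, h2, if_false]
          have := a1 (-(i + 1)) (by omega) (by omega)
          rw [show -(i + 1) + 1 = -i by ring] at this
          exact this.symm
    · rw [ea, eb, hX.dist_iso]
      unfold OnGeod at hp
      rw [SimpleGraph.dist_comm] at hp
      omega
  · intro q hq'
    rw [ea, eb] at hq'
    have h1 := hq (φ.symm q) ?_
    · rw [← hX.dist_iso φ, hφ] at h1
      simpa using h1
    · unfold OnGeod at *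
      rw [← hX.dist_iso φ x, ← hX.dist_iso φ _ z, ← hX.dist_iso φ x z, ← hX.dist_iso φ z,
        ← hX.dist_iso φ _ y, ← hX.dist_iso φ z y]
      simpa using hq'

omit hX in
theorem _root_.JoinedWithin.of_path {Q : Set V} {γ : ℤ → V} {a b : ℤ} (hab : a ≤ b)
    (h : ∀ i, a ≤ i → i < b → X.Adj (γ i) (γ (i + 1))) (hQ : ∀ i, a ≤ i → i ≤ b → γ i ∈ Q) :
    JoinedWithin X Q (γ a) (γ b) := by
  have key : ∀ n : ℕ, a + n ≤ b → JoinedWithin X Q (γ a) (γ (a + n)) := by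
    intro n
    induction n with
    | zero => intro _; simpa using JoinedWithin.refl (hQ a le_rfl hab)
    | succ n ih =>
      intro hn
      push_cast at hn ⊢
      refine (ih (by omega)).trans ?_
      rw [← add_assoc]
      exact .of_adj (hQ _ (by omega) (by omega)) (hQ _ (by omega) (by omega))
        (h _ (by omega) (by omega))
  have := key (b - a).toNat (by omega)
  rwa [show a + ((b - a).toNat : ℤ) = b by omega] at this

omit hX in
theorem _root_.GeodOn.adj {γ : ℤ → V} {a b : ℤ} (h : GeodOn X γ a b) {i : ℤ} (hi : a ≤ i)
    (hi' : i < b) : X.Adj (γ i) (γ (i + 1)) := by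
  rw [← dist_eq_one_iff_adj, h i (i + 1) hi (by omega) (by omega) (by omega)]
  omega

omit hX in
theorem _root_.GeodOn.mono {γ : ℤ → V} {a b a' b' : ℤ} (h : GeodOn X γ a b) (ha : a ≤ a')
    (hb : b' ≤ b) : GeodOn X γ a' b' := fun i j h1 h2 h3 h4 =>
  h i j (by omega) (by omega) (by omega) (by omega)

omit hX in
theorem _root_.GeodOn.onGeod {γ : ℤ → V} {b : ℕ} (h : GeodOn X γ 0 b) {i : ℤ} (hi : 0 ≤ i)
    (hi' : i ≤ b) : OnGeod X (γ 0) (γ b) (γ i) := by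
  unfold OnGeod
  rw [h 0 i le_rfl (by omega) hi hi', h i b hi hi' (by omega) le_rfl,
    h 0 b le_rfl (by omega) (by omega) le_rfl]
  omega

/-- In a non-hyperbolic graph there is a geodesic line whose points can be joined by paths,
made of boundedly many geodesics, which stay far away from the origin of the line. -/
theorem exists_line (hnh : ¬ GromovHyperbolic X) : ∃ ℓ : ℤ → V, IsGeodLine X ℓ ∧
    ∀ M : ℕ, ∃ P : Fin 4 → Set V, (∀ k, LineSet X (P k)) ∧
      JoinedWithin X ({v | M ≤ X.dist (ℓ 0) v} ∩ ⋃ k, P k) (ℓ (-M)) (ℓ M) := by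
  set o := hX.base
  choose α a b z ha hb h0 hg hfar using hX.exists_fat hnh o
  let U : Ultrafilter ℕ := Filter.hyperfilter ℕ
  have hU : ∀ n : ℕ, ∀ᶠ S in (U : Filter ℕ), n ≤ S := fun n =>
    Nat.hyperfilter_le_atTop (Filter.eventually_ge_atTop n)
  have hlim : ∀ t : ℤ, ∃ v, ∀ᶠ S in (U : Filter ℕ), α S t = v := by
    intro t
    have : ∀ᶠ S in (U : Filter ℕ), ∃ v ∈ {v | X.dist v o ≤ t.natAbs}, α S t = v := by
      filter_upwards [hU t.natAbs] with S hS
      refine ⟨_, ?_, rfl⟩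
      have h1 := ha S
      have h2 := hb S
      have := hg S t 0 (by omega) (by omega) (by omega) (by omega)
      rw [h0] at this
      change X.dist (α S t) o ≤ t.natAbs
      omega
    obtain ⟨v, -, hv⟩ := (Ultrafilter.eventually_exists_mem_iff (hX.finite_ball o t.natAbs)).1 this
    exact ⟨v, hv⟩
  choose ℓ hℓ using hlim
  have hℓ0 : ℓ 0 = o := by
    obtain ⟨S, hS⟩ := (hℓ 0).exists
    rw [← hS, h0]
  refine ⟨ℓ, ?_, ?_⟩
  · intro i j
    obtain ⟨S, hS, h1, h2⟩ := ((hU (i.natAbs + j.natAbs)).and ((hℓ i).and (hℓ j))).exists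
    have := ha S
    have := hb S
    rw [← h1, ← h2]
    exact hg S i j (by omega) (by omega) (by omega) (by omega)
  · intro M
    obtain ⟨S, hS, h1, h2⟩ := ((hU M).and ((hℓ (-M)).and (hℓ M))).exists
    have haS := ha S
    have hbS := hb S
    obtain ⟨γ₁, s1, e1, a1, g1⟩ := hX.exists_seg (α S (-(a S))) (z S)
    obtain ⟨γ₂, s2, e2, a2, g2⟩ := hX.exists_seg (z S) (α S (b S))
    have G1 := (hg S).mono (a' := -(a S)) (b' := -M) le_rfl (by omega)
    have G2 := (hg S).mono (a' := M) (b' := b S) (by omega) (by omega)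
    let P : Fin 4 → Set V := ![α S '' Set.Icc (-(a S) : ℤ) (-M),
      γ₁ '' Set.Icc (0 : ℤ) (X.dist (α S (-(a S))) (z S)),
      γ₂ '' Set.Icc (0 : ℤ) (X.dist (z S) (α S (b S))), α S '' Set.Icc (M : ℤ) (b S)]
    refine ⟨P, ?_, ?_⟩
    · intro k
      fin_cases k
      · exact G1.lineSet
      · exact g1.lineSet
      · exact g2.lineSet
      · exact G2.lineSet
    · rw [← h1, ← h2, hℓ0]
      have dα : ∀ i : ℤ, -(a S) ≤ i → i ≤ b S → X.dist o (α S i) = i.natAbs := by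
        intro i hi hi'
        have := hg S 0 i (by omega) (by omega) (by omega) (by omega)
        rw [h0] at this
        rw [this]; omega
      have j1 := JoinedWithin.of_path (X := X) (γ := α S) (a := -(a S)) (b := -M) (by omega)
        (fun i hi hi' => G1.adj hi hi')
        (Q := {v | M ≤ X.dist o v} ∩ ⋃ k, P k)
        (fun i hi hi' => ⟨by
          have := dα i hi (by omega)
          change M ≤ X.dist o (α S i)
          omega, Set.mem_iUnion.2 ⟨0, i, ⟨hi, hi'⟩, rfl⟩⟩)
      have j2 := JoinedWithin.of_path (X := X) (γ := γ₁) (a := 0)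
        (b := X.dist (α S (-(a S))) (z S)) (by omega)
        (fun i hi hi' => g1.adj hi hi')
        (Q := {v | M ≤ X.dist o v} ∩ ⋃ k, P k)
        (fun i hi hi' => ⟨by
          have := g1.onGeod hi hi'
          rw [s1, e1] at this
          have := hfar S _ (Or.inl this)
          change M ≤ X.dist o (γ₁ i)
          omega, Set.mem_iUnion.2 ⟨1, i, ⟨hi, hi'⟩, rfl⟩⟩)
      have j3 := JoinedWithin.of_path (X := X) (γ := γ₂) (a := 0)
        (b := X.dist (z S) (α S (b S))) (by omega)
        (fun i hi hi' => g2.adj hi hi')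
        (Q := {v | M ≤ X.dist o v} ∩ ⋃ k, P k)
        (fun i hi hi' => ⟨by
          have := g2.onGeod hi hi'
          rw [s2, e2] at this
          have := hfar S _ (Or.inr this)
          change M ≤ X.dist o (γ₂ i)
          omega, Set.mem_iUnion.2 ⟨2, i, ⟨hi, hi'⟩, rfl⟩⟩)
      have j4 := JoinedWithin.of_path (X := X) (γ := α S) (a := M) (b := b S) (by omega)
        (fun i hi hi' => G2.adj hi hi')
        (Q := {v | M ≤ X.dist o v} ∩ ⋃ k, P k)
        (fun i hi hi' => ⟨by
          have := dα i (by omega) hi'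
          change M ≤ X.dist o (α S i)
          omega, Set.mem_iUnion.2 ⟨3, i, ⟨hi, hi'⟩, rfl⟩⟩)
      rw [s1, e1] at j2
      rw [s2, e2] at j3
      exact ((j1.symm.trans j2).trans j3).trans j4.symm

end TransGraph

/-! ### Deep narrow components -/

theorem JoinedWithin.exists_path {V : Type*} {X : SimpleGraph V} {Q : Set V} {u v : V}
    (h : JoinedWithin X Q u v) : ∃ (n : ℕ) (q : ℤ → V), q 0 = u ∧ q n = v ∧
      (∀ i : ℤ, 0 ≤ i → i < n → X.Adj (q i) (q (i + 1))) ∧ ∀ i : ℤ, 0 ≤ i → i ≤ n → q i ∈ Q := by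
  obtain ⟨h1, h2⟩ := h
  induction h2 with
  | refl =>
    exact ⟨0, fun _ => u, rfl, rfl, fun i hi hi' => absurd hi' (by simpa using hi), fun _ _ _ => h1⟩
  | @tail b c hab hbc ih =>
    obtain ⟨n, q, q0, qn, qa, qQ⟩ := ih
    refine ⟨n + 1, fun i => if i ≤ n then q i else c, ?_, ?_, ?_, ?_⟩
    · have : (0 : ℤ) ≤ n := by omega
      simp [q0]
    · simp
    · intro i hi hi'
      push_cast at hi'
      by_cases hin : i = n
      · subst hin
        simp [qn, hbc.1]
      · have a1 : i ≤ n := by omega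
        have a2 : i + 1 ≤ n := by omega
        simp only [a1, a2, if_true]
        exact qa i hi (by omega)
    · intro i hi hi'
      dsimp only
      split_ifs with h
      · exact qQ i hi h
      · exact hbc.2

namespace TransGraph

variable {V : Type*} {X : SimpleGraph V} (hX : TransGraph X)
include hX

theorem joined_ball (o : V) (r : ℕ) {z : V} (hz : X.dist z o ≤ r) :
    JoinedWithin X {v | X.dist v o ≤ r} z o := by
  obtain ⟨γ, h1, h2, h3, h4⟩ := hX.exists_seg z o
  have := JoinedWithin.of_path (X := X) (Q := {v | X.dist v o ≤ r}) (a := 0) (b := X.dist z o)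
    (by omega) h3 (fun i hi hi' => by
      have := h4 i (X.dist z o) hi hi' (by omega) le_rfl
      rw [h2] at this
      change X.dist (γ i) o ≤ r
      omega)
  rwa [h1, h2] at this

/-- Replacing the portion of a geodesic line between two points by another path. -/
theorem exists_splice {ℓ : ℤ → V} (hℓ : IsGeodLine X ℓ) (a b : ℤ) {n : ℕ} {q : ℤ → V}
    (q0 : q 0 = ℓ a) (qn : q n = ℓ b) (qa : ∀ i : ℤ, 0 ≤ i → i < n → X.Adj (q i) (q (i + 1))) :
    ∃ ρ : ℤ → V, IsBiQuasiGeodesic X ρ ∧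
      Set.range ρ = ℓ '' Set.Iic a ∪ q '' Set.Icc 0 (n : ℤ) ∪ ℓ '' Set.Ici b := by
  set ρ : ℤ → V := fun t => if t ≤ a then ℓ t else if t ≤ a + n then q (t - a)
    else ℓ (b + (t - a - n)) with hρ
  have r1 : ∀ t, t ≤ a → ρ t = ℓ t := fun t h => by simp [hρ, h]
  have r2 : ∀ t, a ≤ t → t ≤ a + n → ρ t = q (t - a) := fun t h h' => by
    by_cases h0 : t = a
    · subst h0; simp [hρ, q0]
    · have : ¬ t ≤ a := by omega
      simp [hρ, this, h']
  have r3 : ∀ t, a + n ≤ t → ρ t = ℓ (b + (t - a - n)) := fun t h => by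
    by_cases h0 : t = a + n
    · rw [r2 t (by omega) (by omega), h0]
      rw [show a + (n : ℤ) - a = n by ring, qn]
      congr 1; ring
    · have h1 : ¬ t ≤ a := by omega
      have h2 : ¬ t ≤ a + n := by omega
      simp [hρ, h1, h2]
  refine ⟨ρ, ?_, ?_⟩
  · have hclose : ∀ t, X.dist (ρ t) (ℓ t) ≤ 2 * n + (b - a - n).natAbs := by
      intro t
      rcases le_total t a with h | h
      · rw [r1 t h]; simp
      rcases le_total t (a + n) with h' | h'
      · rw [r2 t h h']
        have e1 := hX.dist_path_le_on qa (i := 0) le_rfl (t - a).toNat (by omega)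
        rw [show (0 : ℤ) + ((t - a).toNat : ℤ) = t - a by omega, q0, SimpleGraph.dist_comm] at e1
        have := hX.tri (q (t - a)) (ℓ a) (ℓ t)
        have := hℓ a t
        omega
      · rw [r3 t h', hℓ]; omega
    refine ⟨1, 2 * (2 * n + (b - a - n).natAbs : ℕ), le_rfl, by positivity, ?_, ?_⟩
    · intro t
      rcases lt_or_ge t a with h | h
      · rw [r1 t h.le, r1 (t + 1) (by omega)]; exact hℓ.adj t
      rcases lt_or_ge t (a + n) with h' | h'
      · rw [r2 t h h'.le, r2 (t + 1) (by omega) (by omega)]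
        rw [show t + 1 - a = t - a + 1 by ring]
        exact qa _ (by omega) (by omega)
      · rw [r3 t h', r3 (t + 1) (by omega)]
        rw [show b + (t + 1 - a - n) = b + (t - a - n) + 1 by ring]
        exact hℓ.adj _
    · intro i j
      have h1 := hclose i
      have h2 := hclose j
      have t1 := hX.tri (ℓ i) (ρ i) (ℓ j)
      have t2 := hX.tri (ρ i) (ρ j) (ℓ j)
      rw [hℓ, SimpleGraph.dist_comm (u := ℓ i)] at t1
      have h : (i - j).natAbs ≤ X.dist (ρ i) (ρ j) + 2 * (2 * n + (b - a - n).natAbs) := by omega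
      have h' : ((i - j).natAbs : ℝ) = |(i : ℝ) - j| := by
        rw [Nat.cast_natAbs]; push_cast; rfl
      have h'' : ((i - j).natAbs : ℝ) ≤ X.dist (ρ i) (ρ j) +
          2 * (2 * n + (b - a - n).natAbs : ℕ) := by exact_mod_cast h
      rw [h'] at h''
      rw [div_one]
      linarith
  · ext v
    constructor
    · rintro ⟨t, rfl⟩
      rcases le_total t a with h | h
      · exact Or.inl (Or.inl ⟨t, h, (r1 t h).symm⟩)
      rcases le_total t (a + n) with h' | h'
      · exact Or.inl (Or.inr ⟨t - a, ⟨by omega, by omega⟩, (r2 t h h').symm⟩)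
      · exact Or.inr ⟨_, by simp only [Set.mem_Ici]; omega, (r3 t h').symm⟩
    · rintro ((⟨t, h, rfl⟩ | ⟨t, ⟨h, h'⟩, rfl⟩) | ⟨t, h, rfl⟩)
      · exact ⟨t, r1 t h⟩
      · exact ⟨t + a, by rw [r2 _ (by omega) (by omega)]; congr 1; ring⟩
      · simp only [Set.mem_Ici] at h
        exact ⟨t - b + a + n, by rw [r3 _ (by omega)]; congr 1; ring⟩

theorem exists_deep_pocket {s : ℕ} (hB : Bisects X s) (hnh : ¬ GromovHyperbolic X) (D : ℕ) :
    ∃ (P : Fin 5 → Set V) (c : Set V) (u : V), (∀ k, LineSet X (P k)) ∧ c ⊆ (⋃ k, P k) ∧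
      c.Nonempty ∧ (∀ a ∈ c, D < X.dist u a) ∧ u ∈ (nb X c s)ᶜ ∧
      Narrow X (compOf X (nb X c s)ᶜ u) := by
  by_contra hcon
  push Not at hcon
  obtain ⟨ℓ, hℓ, hq⟩ := hX.exists_line hnh
  obtain ⟨u₁, -, u₂, -, hu12, hw1, hw2⟩ := hB.exists_two hℓ.isBiQuasiGeodesic
  obtain ⟨z₁, hz₁, hf₁⟩ := hX.exists_far_of_wide hℓ.isBiQuasiGeodesic hw1 (D + s)
  obtain ⟨z₂, hz₂, hf₂⟩ := hX.exists_far_of_wide hℓ.isBiQuasiGeodesic hw2 (D + s)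
  set r := X.dist z₁ (ℓ 0) + X.dist z₂ (ℓ 0) with hr
  set M := r + D + s + 1 with hM
  obtain ⟨P, hP, hj⟩ := hq M
  obtain ⟨n, q, q0, qn, qa, qQ⟩ := hj.exists_path
  obtain ⟨ρ, hρ, hρr⟩ := hX.exists_splice hℓ (-M) M q0 qn qa
  obtain ⟨c, hc, hcr⟩ := hX.exists_splice hℓ M (-M) (n := n) (q := fun i => q (n - i)) (by simp [qn])
    (by simp [q0]) (fun i hi hi' => by
      have := qa (n - (i + 1)) (by omega) (by omega)
      rw [show (n : ℤ) - (i + 1) + 1 = n - i by ring] at this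
      exact this.symm)
  have hqrev : (fun i => q (n - i)) '' Set.Icc 0 (n : ℤ) = q '' Set.Icc 0 (n : ℤ) := by
    ext v
    constructor
    · rintro ⟨i, ⟨h, h'⟩, rfl⟩
      exact ⟨n - i, ⟨by omega, by omega⟩, rfl⟩
    · rintro ⟨i, ⟨h, h'⟩, rfl⟩
      exact ⟨n - i, ⟨by omega, by omega⟩, by simp⟩
  rw [hqrev] at hcr
  have hcr' : Set.range c = Set.range ℓ ∪ q '' Set.Icc 0 (n : ℤ) := by
    rw [hcr]
    ext v
    constructor
    · rintro ((⟨t, h, rfl⟩ | h) | ⟨t, h, rfl⟩)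
      · exact Or.inl ⟨t, rfl⟩
      · exact Or.inr h
      · exact Or.inl ⟨t, rfl⟩
    · rintro (⟨t, rfl⟩ | h)
      · rcases le_total t M with h | h
        · exact Or.inl (Or.inl ⟨t, h, rfl⟩)
        · exact Or.inr ⟨t, by simp only [Set.mem_Ici]; omega, rfl⟩
      · exact Or.inl (Or.inr h)
  have hρc : Set.range ρ ⊆ Set.range c := by
    rw [hρr, hcr']
    rintro v ((⟨t, h, rfl⟩ | h) | ⟨t, h, rfl⟩)
    · exact Or.inl ⟨t, rfl⟩
    · exact Or.inr h
    · exact Or.inl ⟨t, rfl⟩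
  have hℓc : Set.range ℓ ⊆ Set.range c := by rw [hcr']; exact Set.subset_union_left
  have hcP : Set.range c ⊆ ⋃ k, (Fin.cons (Set.range ℓ) P : Fin 5 → Set V) k := by
    rw [hcr']
    rintro v (h | ⟨i, ⟨h, h'⟩, rfl⟩)
    · exact Set.mem_iUnion.2 ⟨0, h⟩
    · obtain ⟨k, hk⟩ := Set.mem_iUnion.1 (qQ i h h').2
      exact Set.mem_iUnion.2 ⟨k.succ, by simpa using hk⟩
  have hLS : ∀ k, LineSet X ((Fin.cons (Set.range ℓ) P : Fin 5 → Set V) k) := by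
    intro k
    refine Fin.cases ?_ ?_ k
    · simpa using hℓ.lineSet
    · intro i; simpa using hP i
  have hqfar : ∀ i : ℤ, 0 ≤ i → i ≤ n → M ≤ X.dist (ℓ 0) (q i) := fun i h h' => (qQ i h h').1
  have hρfar : ∀ a ∈ Set.range ρ, M ≤ X.dist (ℓ 0) a := by
    rw [hρr]
    rintro v ((⟨t, h, rfl⟩ | ⟨i, ⟨h, h'⟩, rfl⟩) | ⟨t, h, rfl⟩)
    · simp only [Set.mem_Iic] at h
      rw [hℓ]; omega
    · exact hqfar i h h'
    · simp only [Set.mem_Ici] at h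
      rw [hℓ]; omega
  have hdeep : ∀ z, (∀ a ∈ Set.range c, D + s < X.dist z a) → z ∈ (nb X (Set.range c) s)ᶜ ∧
      Wide X (compOf X (nb X (Set.range c) s)ᶜ z) := by
    intro z hz
    have hzc : z ∈ (nb X (Set.range c) s)ᶜ := by
      rintro ⟨a, ha, hd⟩
      have := hz a ha
      omega
    exact ⟨hzc, hcon _ _ z hLS hcP (Set.range_nonempty c)
      (fun a ha => by have := hz a ha; omega) hzc⟩
  have hzfar : ∀ z, X.dist z (ℓ 0) ≤ r → (∀ t, D + s < X.dist z (ℓ t)) →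
      ∀ a ∈ Set.range c, D + s < X.dist z a := by
    intro z hz hzl
    rw [hcr']
    rintro a (⟨t, rfl⟩ | ⟨i, ⟨h, h'⟩, rfl⟩)
    · exact hzl t
    · have := hqfar i h h'
      have := hX.tri (ℓ 0) z (q i)
      rw [SimpleGraph.dist_comm (u := ℓ 0) (v := z)] at this
      omega
  have hz₁c := hzfar z₁ (by omega) hf₁
  have hz₂c := hzfar z₂ (by omega) hf₂
  have hballρ : {v | X.dist v (ℓ 0) ≤ r} ⊆ (nb X (Set.range ρ) s)ᶜ := by
    rintro v hv ⟨a, ha, hd⟩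
    have := hρfar a ha
    have := hX.tri (ℓ 0) v a
    rw [SimpleGraph.dist_comm (u := ℓ 0) (v := v)] at this
    have : X.dist v (ℓ 0) ≤ r := hv
    omega
  have hj1 := (hX.joined_ball (ℓ 0) r (z := z₁) (by omega)).mono hballρ
  have hj2 := (hX.joined_ball (ℓ 0) r (z := z₂) (by omega)).mono hballρ
  obtain ⟨u, hu, huw⟩ : ∃ u, ¬ JoinedWithin X (nb X (Set.range ρ) s)ᶜ u (ℓ 0) ∧
      Wide X (compOf X (nb X (Set.range ρ) s)ᶜ u) := by
    obtain ⟨v₁, -, v₂, -, hv12, hv1, hv2⟩ := hB.exists_two hρ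
    by_cases h : JoinedWithin X (nb X (Set.range ρ) s)ᶜ v₁ (ℓ 0)
    · exact ⟨v₂, fun h' => hv12 (h.trans h'.symm), hv2⟩
    · exact ⟨v₁, h, hv1⟩
  obtain ⟨z₃, hz₃, hf₃⟩ := hX.exists_far_of_wide hc huw (D + s)
  have hz₃c : ∀ a ∈ Set.range c, D + s < X.dist z₃ a := by
    rintro _ ⟨t, rfl⟩
    exact hf₃ t
  have hmono : ∀ {A B : Set V}, A ⊆ B → (nb X B s)ᶜ ⊆ (nb X A s)ᶜ := by
    rintro A B hAB v hv ⟨a, ha, hd⟩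
    exact hv ⟨a, hAB ha, hd⟩
  refine hB.not_three hc (u := ![z₁, z₂, z₃]) ?_ ?_ ?_ ?_ ?_
  · intro i
    fin_cases i
    · exact (hdeep z₁ hz₁c).1
    · exact (hdeep z₂ hz₂c).1
    · exact (hdeep z₃ hz₃c).1
  · intro i
    fin_cases i
    · exact (hdeep z₁ hz₁c).2
    · exact (hdeep z₂ hz₂c).2
    · exact (hdeep z₃ hz₃c).2
  · intro h
    have h' : JoinedWithin X _ z₁ z₂ := h.mono (hmono hℓc)
    exact hu12 ((JoinedWithin.trans hz₁ h').trans (JoinedWithin.symm hz₂))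
  · intro h
    have h' : JoinedWithin X _ z₁ z₃ := h.mono (hmono hρc)
    exact hu ((JoinedWithin.trans hz₃ h'.symm).trans hj1)
  · intro h
    have h' : JoinedWithin X _ z₂ z₃ := h.mono (hmono hρc)
    exact hu ((JoinedWithin.trans hz₃ h'.symm).trans hj2)

end TransGraph

/-! ### Counting in pockets -/

/-- A pocket of depth `h`: a set `A` around `ζ` which is separated from its complement by the
`s`-neighbourhood of a set `c` covered by five geodesics. -/
structure Pocket {V : Type*} (X : SimpleGraph V) (s : ℕ) (P : Fin 5 → Set V) (c A : Set V) (ζ : V)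
    (h : ℕ) : Prop where
  line : ∀ k, LineSet X (P k)
  sub : c ⊆ ⋃ k, P k
  mem : ζ ∈ A
  shallow : A ⊆ nb X c h
  deep : ∀ a ∈ c, h ≤ X.dist ζ a
  closed : ∀ x ∈ A, ∀ y, X.Adj x y → y ∈ A ∨ y ∈ nb X c s

namespace TransGraph

variable {V : Type*} {X : SimpleGraph V} (hX : TransGraph X)
include hX

theorem exists_pocket {s : ℕ} (hB : Bisects X s) (hnh : ¬ GromovHyperbolic X) (D : ℕ) :
    ∃ P c A ζ h, D < h ∧ Pocket X s P c A ζ h := by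
  obtain ⟨P, c, u, hP, hcP, hne, hu, huS, hnar⟩ := hX.exists_deep_pocket hB hnh D
  obtain ⟨ℓ, hℓ, -⟩ := hX.exists_line hnh
  obtain ⟨r, hr⟩ := hX.not_ball_subset_of_narrow hB hℓ hnar
  set S := (nb X c s)ᶜ with hS
  set A := compOf X S u with hA
  have hproj : ∀ x : V, ∃ a ∈ c, ∀ b ∈ c, X.dist x a ≤ X.dist x b := by
    intro x
    obtain ⟨a, ha, hmin⟩ := (measure (fun a => X.dist x a)).wf.has_min c hne
    exact ⟨a, ha, fun b hb => not_lt.1 (hmin b hb)⟩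
  choose π hπc hπ using hproj
  have hbd : ∀ x ∈ A, X.dist x (π x) ≤ r + s := by
    intro x hx
    by_contra hcon
    push Not at hcon
    apply hr x
    intro v hv
    have hv' : X.dist v x ≤ r := by simpa using hv
    have hj := (hX.joined_ball x r hv').mono (T := S) (by
      rintro w hw ⟨a, ha, hd⟩
      have := hπ x a ha
      have := hX.tri x w a
      rw [SimpleGraph.dist_comm (u := x) (v := w)] at this
      have : X.dist w x ≤ r := hw
      omega)
    exact JoinedWithin.trans hx hj.symm
  obtain ⟨ζ, hζ, hmax⟩ : ∃ ζ ∈ A, ∀ x ∈ A, X.dist x (π x) ≤ X.dist ζ (π ζ) := by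
    obtain ⟨ζ, hζ, hmin⟩ := (measure (fun x => r + s - X.dist x (π x))).wf.has_min A
      ⟨u, self_mem_compOf huS⟩
    refine ⟨ζ, hζ, fun x hx => ?_⟩
    have := hmin x hx
    have h1 := hbd x hx
    have h2 := hbd ζ hζ
    change ¬ (r + s - X.dist x (π x) < r + s - X.dist ζ (π ζ)) at this
    omega
  refine ⟨P, c, A, ζ, X.dist ζ (π ζ), ?_, hP, hcP, hζ, ?_, ?_, ?_⟩
  · have := hmax u (self_mem_compOf huS)
    have := hu (π u) (hπc u)
    omega
  · intro x hx
    exact ⟨π x, hπc x, hmax x hx⟩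
  · exact hπ ζ
  · intro x hx y hxy
    by_cases hy : y ∈ nb X c s
    · exact Or.inr hy
    · left
      exact JoinedWithin.trans hx (.of_adj (compOf_subset hx) hy hxy)

theorem _root_.LineSet.exists_cover {P : Set V} (hP : LineSet X P) (y : V) (T : ℕ) {h : ℕ}
    (hh : 0 < h) : ∃ R : Finset V, R.card ≤ 4 * T / h + 1 ∧
      ∀ u ∈ P, X.dist u y ≤ T → ∃ r ∈ R, X.dist u r < h := by
  classical
  obtain ⟨f, hf⟩ := hP
  by_cases hne : ∃ p ∈ P, X.dist p y ≤ T
  · obtain ⟨p, hp, hpy⟩ := hne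
    set F : V → ℕ := fun u => (f u - f p + 2 * T).toNat / h
    have hF : ∀ u ∈ P, X.dist u y ≤ T → (f u - f p).natAbs ≤ 2 * T := by
      intro u hu hd
      rw [← hf u hu p hp]
      have := hX.tri u y p
      rw [SimpleGraph.dist_comm (u := y)] at this
      omega
    set g : ℕ → V := fun i => if h : ∃ u ∈ P, X.dist u y ≤ T ∧ F u = i then h.choose else p
    refine ⟨(Finset.range (4 * T / h + 1)).image g, ?_, ?_⟩
    · exact Finset.card_image_le.trans (by simp)
    · intro u hu hd
      have hex : ∃ u' ∈ P, X.dist u' y ≤ T ∧ F u' = F u := ⟨u, hu, hd, rfl⟩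
      refine ⟨g (F u), Finset.mem_image_of_mem _ ?_, ?_⟩
      · rw [Finset.mem_range, Nat.lt_succ_iff]
        have := hF u hu hd
        exact Nat.div_le_div_right (by omega)
      · have hg : g (F u) = hex.choose := by simp only [g, hex, dif_pos]
        obtain ⟨h1, h2, h3⟩ := hex.choose_spec
        rw [hg, hf u hu _ h1]
        set w := hex.choose
        have e1 := hF u hu hd
        have e2 := hF w h1 h2
        have m1 := Nat.div_add_mod (f u - f p + 2 * T).toNat h
        have m2 := Nat.div_add_mod (f w - f p + 2 * T).toNat h
        have l1 := Nat.mod_lt (f u - f p + 2 * T).toNat hh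
        have l2 := Nat.mod_lt (f w - f p + 2 * T).toNat hh
        have h3' : (f w - f p + 2 * T).toNat / h = (f u - f p + 2 * T).toNat / h := h3
        rw [h3'] at m2
        omega
  · push Not at hne
    exact ⟨∅, by simp, fun u hu hd => absurd hd (not_le.2 (hne u hu))⟩

section

variable {s : ℕ} {P : Fin 5 → Set V} {c A : Set V} {ζ : V} {h : ℕ}

theorem card_inter_nb_le (hP : ∀ k, LineSet X (P k)) (hc : c ⊆ ⋃ k, P k) (y : V) (T : ℕ) {h : ℕ}
    (hh : 0 < h) {t : ℕ} {Z : Finset V} (hZ : ∀ z ∈ Z, X.dist z y ≤ T) (hZc : (Z : Set V) ⊆ nb X c t) :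
    Z.card ≤ 5 * (4 * (T + t) / h + 1) * hX.vol (t + (h - 1)) := by
  classical
  choose R hR hcov using fun k => _root_.LineSet.exists_cover hX (hP k) y (T + t) hh
  have : Z ⊆ Finset.univ.biUnion fun k : Fin 5 => (R k).biUnion fun r => hX.ball r (t + (h - 1)) := by
    intro z hz
    obtain ⟨a, ha, hza⟩ := hZc hz
    obtain ⟨k, hk⟩ := Set.mem_iUnion.1 (hc ha)
    have h1 := hX.tri a z y
    rw [SimpleGraph.dist_comm (u := a) (v := z)] at h1
    have h2 := hZ z hz
    obtain ⟨r, hr, hd⟩ := hcov k a hk (by omega)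
    simp only [Finset.mem_biUnion, Finset.mem_univ, true_and]
    refine ⟨k, r, hr, ?_⟩
    rw [mem_ball]
    have := hX.tri z a r
    omega
  refine (Finset.card_le_card this).trans (Finset.card_biUnion_le.trans ?_)
  calc _ ≤ ∑ k : Fin 5, (4 * (T + t) / h + 1) * hX.vol (t + (h - 1)) := by
        apply Finset.sum_le_sum
        intro k _
        refine Finset.card_biUnion_le.trans ?_
        simp only [hX.card_ball, Finset.sum_const, smul_eq_mul]
        exact Nat.mul_le_mul_right _ (hR k)
    _ = _ := by simp; ring

theorem Pocket.card_nb_le (hp : Pocket X s P c A ζ h) (y : V) (T : ℕ) {Z : Finset V}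
    (hZ : ∀ z ∈ Z, X.dist z y ≤ T) (hZc : (Z : Set V) ⊆ nb X c s) :
    Z.card ≤ 5 * (4 * (T + s) + 1) * hX.vol s := by
  simpa using hX.card_inter_nb_le hp.line hp.sub y T (h := 1) one_pos hZ hZc

theorem Pocket.card_le (hp : Pocket X s P c A ζ h) (hh : 0 < h) (y : V) (k : ℕ) {Z : Finset V}
    (hZ : ∀ z ∈ Z, X.dist z y ≤ k * h) (hZA : (Z : Set V) ⊆ A) :
    Z.card ≤ 5 * (4 * k + 5) * hX.vol (2 * h) := by
  refine (hX.card_inter_nb_le hp.line hp.sub y (k * h) hh hZ (hZA.trans hp.shallow)).trans ?_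
  have : 4 * (k * h + h) / h = 4 * k + 4 := by
    rw [show 4 * (k * h + h) = (4 * k + 4) * h by ring, Nat.mul_div_cancel _ hh]
  rw [this]
  exact Nat.mul_le_mul_left _ (hX.vol_mono (by omega))

theorem Pocket.ball_subset (hp : Pocket X s P c A ζ h) {r : ℕ} (hr : r + s < h) {x : V}
    (hx : X.dist x ζ ≤ r) : x ∈ A := by
  have hj := (hX.joined_ball ζ r hx).symm
  obtain ⟨-, h2⟩ := hj
  clear hx
  induction h2 with
  | refl => exact hp.mem
  | @tail b d _ hbd ih =>
    rcases hp.closed b ih d hbd.1 with h | ⟨a, ha, hd⟩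
    · exact h
    · have := hp.deep a ha
      have := hX.tri ζ d a
      rw [SimpleGraph.dist_comm (u := ζ) (v := d)] at this
      have : X.dist d ζ ≤ r := hbd.2
      omega

/-- A pocket occupies at most half of every ball of radius proportional to its depth. -/
theorem Pocket.card_le_half (hB : Bisects X s) {ℓ : ℤ → V} (hℓ : IsGeodLine X ℓ)
    (hp : Pocket X s P c A ζ h) (hh : 0 < h) (y : V)
    {Z : Finset V} (hZ : ∀ z ∈ Z, X.dist z y ≤ 3 ^ 19 * h) (hZA : (Z : Set V) ⊆ A) :
    2 * Z.card ≤ hX.vol (3 ^ 19 * h) := by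
  have h1 := Pocket.card_le hX hp hh y _ hZ hZA
  have h2 : ∀ j, 4 ^ j * hX.vol (2 * h) ≤ hX.vol (3 ^ j * (2 * h + 1) - 1) := by
    intro j
    induction j with
    | zero => simp
    | succ j ih =>
      have e := hX.four_mul_vol_le hB hℓ (3 ^ j * (2 * h + 1) - 1)
      have e1 : 3 * (3 ^ j * (2 * h + 1) - 1) + 1 ≤ 3 ^ (j + 1) * (2 * h + 1) - 1 := by
        have : 0 < 3 ^ j * (2 * h + 1) := by positivity
        rw [pow_succ, mul_right_comm]
        omega
      have e2 := hX.vol_mono e1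
      rw [pow_succ]
      linarith
  have h3 := h2 18
  have h4 : hX.vol (3 ^ 18 * (2 * h + 1) - 1) ≤ hX.vol (3 ^ 19 * h) := hX.vol_mono (by omega)
  have h5 : 5 * (4 * 3 ^ 19 + 5) * 2 ≤ 4 ^ 18 := by norm_num
  calc 2 * Z.card ≤ 2 * (5 * (4 * 3 ^ 19 + 5) * hX.vol (2 * h)) := by omega
    _ = 5 * (4 * 3 ^ 19 + 5) * 2 * hX.vol (2 * h) := by ring
    _ ≤ 4 ^ 18 * hX.vol (2 * h) := Nat.mul_le_mul_right _ h5
    _ ≤ _ := h3.trans h4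

end

/-! ### Amenability -/

omit hX in
open Classical in
/-- The outer vertex boundary of a finite set. -/
noncomputable def bdry (hX : TransGraph X) (L : Finset V) : Finset V :=
  (L.biUnion fun v => hX.ball v 1) \ L

theorem mem_bdry {L : Finset V} {v : V} : v ∈ hX.bdry L ↔ v ∉ L ∧ ∃ u ∈ L, X.Adj u v := by
  classical
  simp only [bdry, Finset.mem_sdiff, Finset.mem_biUnion, mem_ball]
  constructor
  · rintro ⟨⟨u, hu, hd⟩, hv⟩
    refine ⟨hv, u, hu, ?_⟩
    rw [← dist_eq_one_iff_adj, SimpleGraph.dist_comm]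
    have : X.dist v u ≠ 0 := fun h => hv (by rw [hX.dist_eq_zero] at h; exact h ▸ hu)
    omega
  · rintro ⟨hv, u, hu, ha⟩
    exact ⟨⟨u, hu, by rw [SimpleGraph.dist_comm, hX.dist_adj ha]⟩, hv⟩

theorem vol_le_pow (n : ℕ) : hX.vol n ≤ hX.vol 1 ^ n := by
  induction n with
  | zero =>
    have : hX.ball hX.base 0 = {hX.base} := by ext; simp [hX.dist_eq_zero]
    simp [vol, this]
  | succ n ih =>
    rw [pow_succ]
    exact (hX.vol_add n 1).trans (Nat.mul_le_mul_right _ ih)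

theorem exists_foelner {s : ℕ} (hB : Bisects X s) (hnh : ¬ GromovHyperbolic X) {ε : ℝ} (hε : 0 < ε) :
    ∃ L : Finset V, L.Nonempty ∧ ((hX.bdry L).card : ℝ) ≤ ε * L.card := by
  classical
  by_contra hcon
  push Not at hcon
  set b : ℝ := 1 + ε / 2 with hb
  have hb1 : 1 < b := by rw [hb]; linarith
  obtain ⟨k, hk⟩ : ∃ k : ℕ, 2 * (hX.vol 1 : ℝ) ^ 2 < b ^ k := pow_unbounded_of_one_lt _ hb1
  have hvolexp : ∀ r : ℕ, (1 + ε) ^ r ≤ hX.vol r := by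
    intro r
    induction r with
    | zero => simpa using Nat.succ_le_of_lt (hX.vol_pos 0)
    | succ r ih =>
      have h1 := hcon (hX.ball hX.base r) ⟨hX.base, by simp⟩
      have h2 : hX.bdry (hX.ball hX.base r) ∪ hX.ball hX.base r ⊆ hX.ball hX.base (r + 1) := by
        intro v hv
        rw [Finset.mem_union, mem_bdry] at hv
        rw [mem_ball]
        rcases hv with ⟨-, u, hu, ha⟩ | hv
        · have := hX.tri v u hX.base
          rw [SimpleGraph.dist_comm (u := v) (v := u), hX.dist_adj ha] at this
          rw [mem_ball] at hu
          omega
        · rw [mem_ball] at hv; omega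
      have h3 := Finset.card_le_card h2
      rw [Finset.card_union_of_disjoint (by simp [bdry, Finset.sdiff_disjoint])] at h3
      have h3' : ((hX.bdry (hX.ball hX.base r)).card : ℝ) + hX.vol r ≤ hX.vol (r + 1) := by
        exact_mod_cast h3
      have h1' : ε * hX.vol r < (hX.bdry (hX.ball hX.base r)).card := h1
      rw [pow_succ]
      nlinarith
  have hlin : ∃ N : ℕ, ∀ h : ℕ, N ≤ h →
      5 * (4 * ((((k + 1) * h + 1 : ℕ) : ℝ) + s) + 1) * hX.vol s ≤ ε / 2 * hX.vol (h - s - 1) ∧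
      (5 * (4 * (k + 1) + 5) : ℝ) < 2 ^ h := by
    have t1 : Filter.Tendsto (fun r : ℕ => (r : ℝ) ^ 1 * (1 / (1 + ε)) ^ r) Filter.atTop (nhds 0) :=
      tendsto_pow_const_mul_const_pow_of_abs_lt_one 1 (by
        rw [abs_of_pos (by positivity), div_lt_one (by linarith)]; linarith)
    set K : ℝ := 5 * (4 * ((k + 1) * (s + 2) + 1 + s) + 1) * hX.vol s + 1 with hK
    have hKpos : 0 < K := by positivity
    have t2 := (t1.eventually (gt_mem_nhds (show (0 : ℝ) < ε / 2 / K by positivity)))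
    obtain ⟨N, hN⟩ := Filter.eventually_atTop.1 t2
    obtain ⟨N', hN'⟩ := pow_unbounded_of_one_lt (5 * (4 * (k + 1) + 5) : ℝ) (one_lt_two)
    refine ⟨N + N' + s + 2, fun h hh => ⟨?_, ?_⟩⟩
    · set r := h - s - 1 with hr
      have hrN : N ≤ r := by omega
      have h1 := hN r hrN
      rw [pow_one, one_div, inv_pow, ← div_eq_mul_inv, div_lt_div_iff₀ (by positivity) hKpos] at h1
      have h2 := hvolexp r
      have hr1 : (1 : ℝ) ≤ r := by
        have : 1 ≤ r := by omega
        exact_mod_cast this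
      have e : (h : ℝ) = r + s + 1 := by
        have : h = r + s + 1 := by omega
        exact_mod_cast this
      have hvs : (0 : ℝ) ≤ hX.vol s := by positivity
      have hfin : 5 * (4 * ((((k + 1) * h + 1 : ℕ) : ℝ) + s) + 1) ≤
          r * (5 * (4 * ((k + 1) * (s + 2) + 1 + s) + 1)) := by
        push_cast
        rw [e]
        have hk0 : (0 : ℝ) ≤ k := by positivity
        have hs0 : (0 : ℝ) ≤ s := by positivity
        have a1 : (k + 1 : ℝ) * (r + s + 1) ≤ (k + 1) * ((s + 2) * r) := by
          apply mul_le_mul_of_nonneg_left _ (by linarith); nlinarith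
        nlinarith
      calc _ ≤ (r : ℝ) * (5 * (4 * ((k + 1) * (s + 2) + 1 + s) + 1)) * (hX.vol s : ℝ) := by gcongr
        _ ≤ r * K := by rw [hK]; nlinarith
        _ ≤ ε / 2 * (1 + ε) ^ r := h1.le
        _ ≤ _ := by gcongr
    · exact hN'.trans_le (pow_le_pow_right₀ (by norm_num) (by omega))
  obtain ⟨N, hN⟩ := hlin
  obtain ⟨P, c, A, ζ, h, hh, hp⟩ := hX.exists_pocket hB hnh (N + s + 1)
  obtain ⟨hN1, hN2⟩ := hN h (by omega)
  set Ar : ℕ → Finset V := fun r => (hX.ball ζ r).filter (· ∈ A) with hAr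
  have hbase : hX.vol (h - s - 1) ≤ (Ar (h - s - 1)).card := by
    rw [← hX.card_ball ζ]
    apply Finset.card_le_card
    intro v hv
    rw [hAr, Finset.mem_filter]
    exact ⟨hv, Pocket.ball_subset hX hp (r := h - s - 1) (by omega) (by simpa using hv)⟩
  have hgrow : ∀ n : ℕ, n ≤ k * h → b ^ n * hX.vol (h - s - 1) ≤ ((Ar (h - s - 1 + n)).card : ℝ) := by
    intro n
    induction n with
    | zero => intro _; simpa using hbase
    | succ n ih =>
      intro hn
      have ih' := ih (by omega)
      set r := h - s - 1 + n with hr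
      have hne : (Ar r).Nonempty := ⟨ζ, by simp [hAr, hp.mem]⟩
      have h1 := hcon (Ar r) hne
      set Z := (hX.bdry (Ar r)).filter (· ∈ nb X c s) with hZ
      have hbd : ∀ v ∈ hX.bdry (Ar r), X.dist v ζ ≤ r + 1 := by
        intro v hv
        rw [mem_bdry] at hv
        obtain ⟨-, u, hu, ha⟩ := hv
        simp only [hAr, Finset.mem_filter, mem_ball] at hu
        have := hX.tri v u ζ
        rw [SimpleGraph.dist_comm (u := v) (v := u), hX.dist_adj ha] at this
        omega
      have hsub : hX.bdry (Ar r) ∪ Ar r ⊆ Ar (r + 1) ∪ Z := by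
        intro v hv
        rw [Finset.mem_union] at hv ⊢
        rcases hv with hv | hv
        · have hd := hbd v hv
          have hv' := hv
          rw [mem_bdry] at hv'
          obtain ⟨-, u, hu, ha⟩ := hv'
          simp only [hAr, Finset.mem_filter, mem_ball] at hu
          rcases hp.closed u hu.2 v ha with hvA | hvQ
          · left; simp [hAr, hd, hvA]
          · right; simp [hZ, hv, hvQ]
        · left
          simp only [hAr, Finset.mem_filter, mem_ball] at hv ⊢
          exact ⟨by omega, hv.2⟩
      have h2 := (Finset.card_le_card hsub).trans (Finset.card_union_le _ _)
      rw [Finset.card_union_of_disjoint (by simp [bdry, Finset.sdiff_disjoint])] at h2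
      have h3 := Pocket.card_nb_le hX hp ζ ((k + 1) * h + 1) (Z := Z)
        (fun z hz => by
          have := hbd z (Finset.mem_filter.1 hz).1
          have e : (k + 1) * h = k * h + h := by ring
          omega)
        (fun z hz => (Finset.mem_filter.1 hz).2)
      have h3' : (Z.card : ℝ) ≤ 5 * (4 * ((((k + 1) * h + 1 : ℕ) : ℝ) + s) + 1) * hX.vol s := by
        exact_mod_cast h3
      have h2' : ((hX.bdry (Ar r)).card : ℝ) + (Ar r).card ≤ (Ar (r + 1)).card + Z.card := by
        exact_mod_cast h2
      have h4 : (hX.vol (h - s - 1) : ℝ) ≤ (Ar r).card := by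
        have : (1 : ℝ) ≤ b ^ n := one_le_pow₀ hb1.le
        have hv : (0 : ℝ) ≤ hX.vol (h - s - 1) := by positivity
        nlinarith
      have h5 : (Z.card : ℝ) ≤ ε / 2 * (Ar r).card :=
        (h3'.trans hN1).trans (by gcongr)
      have h6 : b * (Ar r).card ≤ ((Ar (r + 1)).card : ℝ) := by rw [hb]; linarith
      rw [← add_assoc, ← hr, pow_succ]
      calc b ^ n * b * hX.vol (h - s - 1) = b * (b ^ n * hX.vol (h - s - 1)) := by ring
        _ ≤ b * (Ar r).card := by gcongr
        _ ≤ _ := h6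
  have hup := Pocket.card_le hX hp (by omega) ζ (k + 1) (Z := Ar (h - s - 1 + k * h))
    (fun z hz => by
      simp only [hAr, Finset.mem_filter, mem_ball] at hz
      have e : (k + 1) * h = k * h + h := by ring
      omega)
    (fun z hz => (Finset.mem_filter.1 hz).2)
  have hup' : ((Ar (h - s - 1 + k * h)).card : ℝ) ≤ 5 * (4 * (k + 1) + 5) * hX.vol (2 * h) := by
    exact_mod_cast hup
  have h1 := hgrow (k * h) le_rfl
  have hv1 : (1 : ℝ) ≤ hX.vol (h - s - 1) := by exact_mod_cast hX.vol_pos _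
  have hv2 : (hX.vol (2 * h) : ℝ) ≤ (hX.vol 1 ^ 2) ^ h := by
    rw [← pow_mul]; exact_mod_cast hX.vol_le_pow (2 * h)
  have h2 : (2 * (hX.vol 1 : ℝ) ^ 2) ^ h ≤ b ^ (k * h) := by
    rw [pow_mul]; gcongr
  rw [mul_pow] at h2
  have hpos : (0 : ℝ) < (hX.vol 1 ^ 2 : ℝ) ^ h := by
    have : (0 : ℝ) < hX.vol 1 := by exact_mod_cast hX.vol_pos 1
    positivity
  have h3 : (2 : ℝ) ^ h * (hX.vol 1 ^ 2 : ℝ) ^ h ≤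
      5 * (4 * (k + 1) + 5) * (hX.vol 1 ^ 2 : ℝ) ^ h := by
    have hbp : 0 ≤ b ^ (k * h) := by positivity
    calc _ ≤ b ^ (k * h) := h2
      _ ≤ b ^ (k * h) * hX.vol (h - s - 1) := by nlinarith
      _ ≤ _ := h1
      _ ≤ _ := hup'
      _ ≤ _ := by gcongr
  have h4 := le_of_mul_le_mul_right h3 hpos
  linarith

end TransGraph

/-! ### Mass transport and recurrent quadratic volume bounds -/

namespace TransGraph

variable {V : Type*} {X : SimpleGraph V} (hX : TransGraph X)
include hX

theorem sum_ball_iso {M : Type*} [AddCommMonoid M] (φ : X ≃g X) (v : V) (r : ℕ) (f : V → M) :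
    ∑ u ∈ hX.ball (φ v) r, f u = ∑ u ∈ hX.ball v r, f (φ u) := by
  symm
  refine Finset.sum_nbij' φ φ.symm ?_ ?_ ?_ ?_ ?_
  · intro u hu
    simpa [hX.dist_iso] using hu
  · intro u hu
    rw [mem_ball] at hu ⊢
    rw [← hX.dist_iso φ]
    simpa using hu
  all_goals simp

theorem exists_bdry_near {L : Finset V} {x y : V} {T : ℕ} (hx : x ∈ L) (hy : y ∉ L)
    (h : X.dist y x ≤ T) : ∃ z ∈ hX.bdry L, X.dist x z ≤ T := by
  induction T generalizing y with
  | zero => exact absurd ((hX.dist_eq_zero.1 (Nat.le_zero.1 h)) ▸ hx) hy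
  | succ T ih =>
    by_cases h' : X.dist y x ≤ T
    · obtain ⟨z, hz, hd⟩ := ih hy h'
      exact ⟨z, hz, by omega⟩
    · obtain ⟨w, hw, hd⟩ := hX.exists_adj_dist y x (n := T) (by omega)
      by_cases hwL : w ∈ L
      · exact ⟨y, hX.mem_bdry.2 ⟨hy, w, hwL, hw.symm⟩, by rwa [SimpleGraph.dist_comm]⟩
      · obtain ⟨z, hz, hd⟩ := ih hwL hd.le
        exact ⟨z, hz, by omega⟩

/-- The mass transport principle. -/
theorem mass_transport
    (hF : ∀ ε : ℝ, 0 < ε → ∃ L : Finset V, L.Nonempty ∧ ((hX.bdry L).card : ℝ) ≤ ε * L.card)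
    (F : V → V → ℝ) (h0 : ∀ x y, 0 ≤ F x y) (hinv : ∀ (φ : X ≃g X) x y, F (φ x) (φ y) = F x y)
    (T : ℕ) (x : V) : ∑ y ∈ hX.ball x T, F y x ≤ ∑ y ∈ hX.ball x T, F x y := by
  classical
  have hb : ∀ z, ∑ y ∈ hX.ball z T, F y z = ∑ y ∈ hX.ball x T, F y x := by
    intro z
    obtain ⟨φ, rfl⟩ := hX.trans x z
    rw [hX.sum_ball_iso]
    simp [hinv]
  have ha : ∀ z, ∑ y ∈ hX.ball z T, F z y = ∑ y ∈ hX.ball x T, F x y := by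
    intro z
    obtain ⟨φ, rfl⟩ := hX.trans x z
    rw [hX.sum_ball_iso]
    simp [hinv]
  set a := ∑ y ∈ hX.ball x T, F x y
  set b := ∑ y ∈ hX.ball x T, F y x with hbdef
  have hb0 : 0 ≤ b := Finset.sum_nonneg fun _ _ => h0 _ _
  by_contra hcon
  push Not at hcon
  have hbpos : 0 < b := lt_of_le_of_lt (Finset.sum_nonneg fun _ _ => h0 _ _) hcon
  have hvT : (0 : ℝ) < hX.vol T := by exact_mod_cast hX.vol_pos T
  obtain ⟨L, hLne, hL⟩ := hF ((b - a) / (2 * b * hX.vol T)) (by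
    apply div_pos (by linarith) (by positivity))
  set N := (hX.bdry L).biUnion fun z => hX.ball z T
  have hN : (N.card : ℝ) ≤ (hX.bdry L).card * hX.vol T := by
    have : N.card ≤ (hX.bdry L).card * hX.vol T := by
      refine Finset.card_biUnion_le.trans ?_
      simp [hX.card_ball]
    exact_mod_cast this
  have h1 : ∑ z ∈ L, ∑ y ∈ hX.ball z T, F y z ≤
      ∑ z ∈ L, ∑ y ∈ L.filter (fun y => X.dist y z ≤ T), F y z + ∑ z ∈ N, b := by
    calc ∑ z ∈ L, ∑ y ∈ hX.ball z T, F y z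
        ≤ ∑ z ∈ L, (∑ y ∈ L.filter (fun y => X.dist y z ≤ T), F y z + if z ∈ N then b else 0) := by
          apply Finset.sum_le_sum
          intro z hz
          by_cases hzN : z ∈ N
          · rw [if_pos hzN, hb]
            have : 0 ≤ ∑ y ∈ L.filter (fun y => X.dist y z ≤ T), F y z :=
              Finset.sum_nonneg fun _ _ => h0 _ _
            linarith
          · rw [if_neg hzN, add_zero]
            apply Finset.sum_le_sum_of_subset_of_nonneg _ fun _ _ _ => h0 _ _
            intro y hy
            rw [mem_ball] at hy
            rw [Finset.mem_filter]
            refine ⟨?_, hy⟩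
            by_contra hyL
            obtain ⟨w, hw, hd⟩ := hX.exists_bdry_near hz hyL hy
            exact hzN (Finset.mem_biUnion.2 ⟨w, hw, by simpa using hd⟩)
      _ ≤ _ := by
          rw [Finset.sum_add_distrib, ← Finset.sum_filter]
          gcongr
          intro z hz
          exact (Finset.mem_filter.1 hz).2
  have h2 : ∑ z ∈ L, ∑ y ∈ L.filter (fun y => X.dist y z ≤ T), F y z ≤ L.card * a := by
    simp only [Finset.sum_filter]
    rw [Finset.sum_comm, ← nsmul_eq_mul]
    apply Finset.sum_le_card_nsmul
    intro y hy
    rw [← Finset.sum_filter, ← ha y]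
    apply Finset.sum_le_sum_of_subset_of_nonneg _ fun _ _ _ => h0 _ _
    intro z hz
    rw [Finset.mem_filter, SimpleGraph.dist_comm] at hz
    simpa using hz.2
  simp only [hb, Finset.sum_const, nsmul_eq_mul] at h1
  have hc : (0 : ℝ) < L.card := by exact_mod_cast Finset.card_pos.2 hLne
  have h3 : (N.card : ℝ) * b ≤ (b - a) / 2 * L.card := by
    calc (N.card : ℝ) * b ≤ ((b - a) / (2 * b * hX.vol T) * L.card) * hX.vol T * b := by
          gcongr; exact hN.trans (by gcongr)
      _ = (b - a) / 2 * L.card := by field_simp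
  nlinarith

omit hX in
open Classical in
/-- Expected number of visits at `z` of the random geodesic from `w` towards `y`, at distance `n`
from `y`. -/
noncomputable def visits (hX : TransGraph X) (y : V) : ℕ → V → V → ℝ
  | 0, w, z => if z = w then 1 else 0
  | n + 1, w, z => (if z = w then 1 else 0) +
      (∑ w' ∈ (hX.ball w 1).filter (fun w' => X.dist w' y = n), visits hX y n w' z) /
        ((hX.ball w 1).filter (fun w' => X.dist w' y = n)).card

theorem visits_nonneg (y : V) (n : ℕ) (w z : V) : 0 ≤ hX.visits y n w z := by
  induction n generalizing w with
  | zero => rw [visits]; split_ifs <;> norm_num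
  | succ n ih =>
    rw [visits]
    apply add_nonneg
    · split_ifs <;> norm_num
    · exact div_nonneg (Finset.sum_nonneg fun _ _ => ih _) (by positivity)

theorem visits_eq_zero {y : V} {n : ℕ} {w z : V} (hw : X.dist w y = n) (hz : n < X.dist z y) :
    hX.visits y n w z = 0 := by
  induction n generalizing w with
  | zero =>
    rw [visits, if_neg]
    rintro rfl; omega
  | succ n ih =>
    rw [visits, if_neg (by rintro rfl; omega), Finset.sum_eq_zero, zero_div, add_zero]
    intro w' hw'
    exact ih (Finset.mem_filter.1 hw').2 (by omega)

theorem sum_visits_le (y : V) (n : ℕ) (w : V) (Z : Finset V) :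
    ∑ z ∈ Z, hX.visits y n w z ≤ n + 1 := by
  classical
  have h0 : ∑ z ∈ Z, (if z = w then (1 : ℝ) else 0) ≤ 1 := by
    rw [Finset.sum_ite_eq']; split_ifs <;> norm_num
  induction n generalizing w with
  | zero => simpa [visits] using h0
  | succ n ih =>
    simp only [visits]
    rw [Finset.sum_add_distrib, ← Finset.sum_div, Finset.sum_comm]
    have h1 : (∑ w' ∈ (hX.ball w 1).filter (fun w' => X.dist w' y = n),
        ∑ z ∈ Z, hX.visits y n w' z) / ((hX.ball w 1).filter (fun w' => X.dist w' y = n)).card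
        ≤ n + 1 := by
      apply div_le_of_le_mul₀ (by positivity) (by positivity)
      rw [mul_comm, ← nsmul_eq_mul]
      apply Finset.sum_le_card_nsmul
      intro w' _
      exact ih w' (by rw [Finset.sum_ite_eq']; split_ifs <;> norm_num)
    push_cast
    linarith

theorem visits_iso (φ : X ≃g X) (y : V) (n : ℕ) (w z : V) :
    hX.visits (φ y) n (φ w) (φ z) = hX.visits y n w z := by
  classical
  induction n generalizing w with
  | zero => simp [visits]
  | succ n ih =>
    rw [visits, visits, Finset.card_eq_sum_ones, Finset.card_eq_sum_ones]
    simp only [Finset.sum_filter]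
    rw [hX.sum_ball_iso, hX.sum_ball_iso]
    simp [hX.dist_iso, ih]

theorem one_le_sum_visits {A Q : Set V} (hA : ∀ x ∈ A, ∀ y, X.Adj x y → y ∈ A ∨ y ∈ Q)
    {y w : V} {n : ℕ} (hw : X.dist w y = n) (hy : y ∈ A) (hwA : w ∉ A) {Z : Finset V}
    (hZ : ∀ z ∈ Q, X.dist z y ≤ n → z ∈ Z) : 1 ≤ ∑ z ∈ Z, hX.visits y n w z := by
  classical
  induction n generalizing w with
  | zero => exact absurd ((hX.dist_eq_zero.1 hw) ▸ hy) hwA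
  | succ n ih =>
    simp only [visits]
    rw [Finset.sum_add_distrib, ← Finset.sum_div, Finset.sum_comm]
    set B := (hX.ball w 1).filter (fun w' => X.dist w' y = n) with hB
    by_cases hwZ : w ∈ Z
    · rw [Finset.sum_ite_eq', if_pos hwZ]
      have : 0 ≤ (∑ w' ∈ B, ∑ z ∈ Z, hX.visits y n w' z) / (B.card : ℝ) :=
        div_nonneg (Finset.sum_nonneg fun _ _ => Finset.sum_nonneg fun _ _ =>
          hX.visits_nonneg _ _ _ _) (by positivity)
      linarith
    · rw [Finset.sum_ite_eq', if_neg hwZ, zero_add]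
      obtain ⟨w₀, h1, h2⟩ := hX.exists_adj_dist w y hw
      have hne : B.Nonempty := ⟨w₀, by
        rw [hB, Finset.mem_filter, mem_ball, SimpleGraph.dist_comm, hX.dist_adj h1]
        exact ⟨le_rfl, h2⟩⟩
      rw [le_div_iff₀ (by exact_mod_cast Finset.card_pos.2 hne), one_mul]
      rw [Finset.cast_card]
      apply Finset.sum_le_sum
      intro w' hw'
      rw [hB, Finset.mem_filter, mem_ball] at hw'
      refine ih hw'.2 ?_ (fun z hz hd => hZ z hz (by omega))
      intro hw'A
      have hadj : X.Adj w' w := by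
        rw [← dist_eq_one_iff_adj]
        have : X.dist w' w ≠ 0 := fun h => by
          rw [hX.dist_eq_zero] at h; rw [h] at hw'; omega
        omega
      rcases hA w' hw'A w hadj with h | h
      · exact hwA h
      · exact hwZ (hZ w h hw.le)

theorem exists_vol_le {s : ℕ} (hB : Bisects X s) (hnh : ¬ GromovHyperbolic X) :
    ∃ C : ℝ, 0 < C ∧ ∀ D : ℕ, ∃ R : ℕ, D ≤ R ∧ (hX.vol R : ℝ) ≤ C * R ^ 2 := by
  classical
  obtain ⟨ℓ, hℓ, -⟩ := hX.exists_line hnh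
  obtain ⟨M, hM⟩ : ∃ M : ℝ, M = 3 ^ 19 * (s + 2) := ⟨_, rfl⟩
  have hM0 : 0 < M := by rw [hM]; positivity
  have hvs : (0 : ℝ) < hX.vol s := by exact_mod_cast hX.vol_pos s
  refine ⟨2 * (5 * (4 * (1 + M + s) + 1) * hX.vol s) * (M + 1), by positivity, fun D => ?_⟩
  obtain ⟨P, c, A, ζ, h, hh, hp⟩ := hX.exists_pocket hB hnh (D + s + 2)
  obtain ⟨ρ, rfl⟩ : ∃ ρ, h = ρ + s + 1 := ⟨h - s - 1, by omega⟩
  refine ⟨ρ, by omega, ?_⟩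
  obtain ⟨T, hT⟩ : ∃ T, T = 3 ^ 19 * (ρ + s + 1) := ⟨_, rfl⟩
  set F : V → V → ℝ := fun y z => ∑ w ∈ hX.ball y T, hX.visits y (X.dist w y) w z with hF
  have hmt := hX.mass_transport (fun ε hε => hX.exists_foelner hB hnh hε) F
    (fun y z => Finset.sum_nonneg fun _ _ => hX.visits_nonneg _ _ _ _)
    (fun φ y z => by
      simp only [hF]
      rw [hX.sum_ball_iso]
      simp [hX.visits_iso, hX.dist_iso]) T
  have hFsum : ∀ y : V, ∀ Z : Finset V, ∑ z ∈ Z, F y z ≤ hX.vol T * (T + 1) := by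
    intro y Z
    simp only [hF]
    rw [Finset.sum_comm, ← hX.card_ball y T, ← nsmul_eq_mul]
    apply Finset.sum_le_card_nsmul
    intro w hw
    rw [mem_ball] at hw
    refine (hX.sum_visits_le y _ w Z).trans ?_
    gcongr
  set Q := (hX.ball ζ (ρ + T)).filter (· ∈ nb X c s) with hQ
  have hQc : (Q.card : ℝ) ≤ 5 * (4 * (ρ + T + s) + 1) * hX.vol s := by
    have := Pocket.card_nb_le hX hp ζ (ρ + T) (Z := Q)
      (fun z hz => by simpa using (Finset.mem_filter.1 hz).1) (fun z hz => (Finset.mem_filter.1 hz).2)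
    exact_mod_cast this
  have hlow : ∀ y ∈ hX.ball ζ ρ, (hX.vol T : ℝ) / 2 ≤ ∑ z ∈ Q, F y z := by
    intro y hy
    rw [mem_ball] at hy
    have hyA : y ∈ A := Pocket.ball_subset hX hp (r := ρ) (by omega) hy
    set W := (hX.ball y T).filter (· ∉ A) with hW
    have hWc : (hX.vol T : ℝ) / 2 ≤ W.card := by
      have h1 := Pocket.card_le_half hX hB hℓ hp (by omega) y (Z := (hX.ball y T).filter (· ∈ A))
        (fun z hz => hT ▸ (hX.mem_ball.1 (Finset.mem_filter.1 hz).1))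
        (fun z hz => (Finset.mem_filter.1 hz).2)
      rw [← hT] at h1
      have h2 : ((hX.ball y T).filter (· ∈ A)).card + W.card = hX.vol T := by
        rw [← hX.card_ball y T, hW]
        convert Finset.card_filter_add_card_filter_not (s := hX.ball y T) (fun x => x ∈ A)
      have h3 : hX.vol T ≤ 2 * W.card := by omega
      have : (hX.vol T : ℝ) ≤ 2 * W.card := by exact_mod_cast h3
      linarith
    simp only [hF]
    rw [Finset.sum_comm]
    refine hWc.trans ?_
    rw [Finset.cast_card]
    refine le_trans ?_ (Finset.sum_le_sum_of_subset_of_nonneg (s := W) (Finset.filter_subset _ _)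
      fun _ _ _ => Finset.sum_nonneg fun _ _ => hX.visits_nonneg _ _ _ _)
    apply Finset.sum_le_sum
    intro w hw
    rw [Finset.mem_filter, mem_ball] at hw
    refine hX.one_le_sum_visits hp.closed rfl hyA hw.2 ?_
    intro z hz hd
    rw [hQ, Finset.mem_filter, mem_ball]
    have := hX.tri z y ζ
    exact ⟨by omega, hz⟩
  have hvT : (0 : ℝ) < hX.vol T := by exact_mod_cast hX.vol_pos T
  have hFzero : ∀ y z, T < X.dist z y → F y z = 0 := by
    intro y z hd
    apply Finset.sum_eq_zero
    intro w hw
    rw [mem_ball] at hw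
    exact hX.visits_eq_zero rfl (by omega)
  have hmain : (hX.vol ρ : ℝ) * (hX.vol T / 2) ≤ Q.card * (hX.vol T * (T + 1)) := by
    calc (hX.vol ρ : ℝ) * (hX.vol T / 2) = ∑ y ∈ hX.ball ζ ρ, (hX.vol T : ℝ) / 2 := by
          rw [Finset.sum_const, hX.card_ball, nsmul_eq_mul]
      _ ≤ ∑ y ∈ hX.ball ζ ρ, ∑ z ∈ Q, F y z := Finset.sum_le_sum hlow
      _ = ∑ z ∈ Q, ∑ y ∈ hX.ball ζ ρ, F y z := Finset.sum_comm
      _ ≤ ∑ z ∈ Q, hX.vol T * ((T : ℝ) + 1) := by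
          apply Finset.sum_le_sum
          intro z _
          refine le_trans ?_ ((hmt z).trans (hFsum z _))
          rw [← Finset.sum_filter_add_sum_filter_not _ (fun y => X.dist z y ≤ T)]
          rw [Finset.sum_eq_zero (s := (hX.ball ζ ρ).filter _) (fun y hy =>
            hFzero y z (not_le.1 (Finset.mem_filter.1 hy).2)), add_zero]
          apply Finset.sum_le_sum_of_subset_of_nonneg
          · intro y hy
            rw [mem_ball, SimpleGraph.dist_comm]
            exact (Finset.mem_filter.1 hy).2
          · intro y _ _
            exact Finset.sum_nonneg fun _ _ => hX.visits_nonneg _ _ _ _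
      _ = _ := by rw [Finset.sum_const, nsmul_eq_mul]
  have h1 : (hX.vol ρ : ℝ) ≤ 2 * Q.card * (T + 1) := by
    have : (hX.vol ρ : ℝ) * hX.vol T ≤ 2 * Q.card * (T + 1) * hX.vol T := by linarith
    exact le_of_mul_le_mul_right this hvT
  have hρ : (1 : ℝ) ≤ ρ := by
    have : 1 ≤ ρ := by omega
    exact_mod_cast this
  have hs0 : (0 : ℝ) ≤ s := by positivity
  have hTr : (T : ℝ) ≤ M * ρ := by
    have : (ρ : ℝ) + s + 1 ≤ (s + 2) * ρ := by nlinarith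
    have e : (T : ℝ) = 3 ^ 19 * (ρ + s + 1) := by
      rw [hT]
      norm_num
    rw [e, hM, mul_assoc]
    gcongr
  calc (hX.vol ρ : ℝ) ≤ 2 * Q.card * (T + 1) := h1
    _ ≤ 2 * (5 * (4 * (1 + M + s) + 1) * hX.vol s * ρ) * ((M + 1) * ρ) := by
      gcongr
      · refine hQc.trans ?_
        have : (5 * (4 * (ρ + T + s) + 1) : ℝ) ≤ 5 * (4 * (1 + M + s) + 1) * ρ := by
          nlinarith
        calc _ ≤ 5 * (4 * (1 + M + s) + 1) * ρ * hX.vol s := by gcongr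
          _ = _ := by ring
      · linarith
    _ = _ := by ring

end TransGraph

/-! ### The averaging operator and its kernel -/

theorem exists_hyperlim {a : ℕ → ℝ} {C : ℝ} (h : ∀ n, |a n| ≤ C) :
    ∃ l, Filter.Tendsto a (Filter.hyperfilter ℕ : Filter ℕ) (nhds l) := by
  have hm : ((Filter.hyperfilter ℕ).map a : Filter ℝ) ≤ Filter.principal (Set.Icc (-C) C) := by
    rw [Filter.le_principal_iff]
    exact Filter.Eventually.of_forall (p := fun n => a n ∈ Set.Icc (-C) C) fun n => abs_le.1 (h n)
  obtain ⟨l, -, hl⟩ := isCompact_Icc.ultrafilter_le_nhds _ hm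
  exact ⟨l, hl⟩

namespace TransGraph

variable {V : Type*} {X : SimpleGraph V} (hX : TransGraph X)
include hX

theorem norm_sub_le_mul_dist {E : Type*} [SeminormedAddCommGroup E] {U : V → E} {L : ℝ}
    (h : ∀ x y, X.Adj x y → ‖U x - U y‖ ≤ L) (x y : V) : ‖U x - U y‖ ≤ L * X.dist x y := by
  obtain ⟨n, hn⟩ : ∃ n, X.dist x y = n := ⟨_, rfl⟩
  induction n generalizing x with
  | zero =>
    rw [hX.dist_eq_zero.1 hn]
    simp
  | succ n ih =>
    obtain ⟨w, hw, hd⟩ := hX.exists_adj_dist x y hn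
    have h1 := ih w hd
    have h2 := h x w hw
    rw [hn]
    rw [hd] at h1
    have h3 := norm_sub_le_norm_sub_add_norm_sub (U x) (U w) (U y)
    push_cast
    linarith

omit hX in
/-- Averaging over balls of radius one. -/
noncomputable def avg (hX : TransGraph X) : (V → ℝ) →ₗ[ℝ] (V → ℝ) where
  toFun f x := (∑ y ∈ hX.ball x 1, f y) / hX.vol 1
  map_add' f g := by ext x; simp [Finset.sum_add_distrib, add_div]
  map_smul' c f := by ext x; simp [← Finset.mul_sum, mul_div_assoc]

theorem avg_apply (f : V → ℝ) (x : V) :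
    hX.avg f x = (∑ y ∈ hX.ball x 1, f y) / hX.vol 1 := rfl

theorem vol_pos' (r : ℕ) : (0 : ℝ) < hX.vol r := by exact_mod_cast hX.vol_pos r

theorem avg_mono {f g : V → ℝ} {x : V} (h : ∀ y ∈ hX.ball x 1, f y ≤ g y) :
    hX.avg f x ≤ hX.avg g x :=
  div_le_div_of_nonneg_right (Finset.sum_le_sum h) (hX.vol_pos' 1).le

theorem avg_const (c : ℝ) : hX.avg (fun _ => c) = fun _ => c := by
  ext x
  rw [avg_apply, Finset.sum_const, hX.card_ball, nsmul_eq_mul, mul_comm,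
    mul_div_cancel_right₀ _ (hX.vol_pos' 1).ne']

theorem avg_pow_succ (n : ℕ) (f : V → ℝ) : (hX.avg ^ (n + 1)) f = hX.avg ((hX.avg ^ n) f) := by
  rw [pow_succ']; rfl

theorem avg_pow_const (n : ℕ) (c : ℝ) : (hX.avg ^ n) (fun _ => c) = fun _ => c := by
  induction n with
  | zero => rfl
  | succ n ih => rw [avg_pow_succ, ih, avg_const]

theorem avg_pow_mono {f g : V → ℝ} (h : ∀ y, f y ≤ g y) (n : ℕ) (x : V) :
    (hX.avg ^ n) f x ≤ (hX.avg ^ n) g x := by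
  induction n generalizing x with
  | zero => exact h x
  | succ n ih =>
    rw [avg_pow_succ, avg_pow_succ]
    exact hX.avg_mono fun y _ => ih y

theorem abs_avg_pow_le {f : V → ℝ} {C : ℝ} (h : ∀ y, |f y| ≤ C) (n : ℕ) (x : V) :
    |(hX.avg ^ n) f x| ≤ C := by
  rw [abs_le]
  constructor
  · have := hX.avg_pow_mono (f := fun _ => -C) (g := f) (fun y => (abs_le.1 (h y)).1) n x
    rwa [avg_pow_const] at this
  · have := hX.avg_pow_mono (f := f) (g := fun _ => C) (fun y => (abs_le.1 (h y)).2) n x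
    rwa [avg_pow_const] at this

theorem avg_comp_iso (φ : X ≃g X) (f : V → ℝ) : hX.avg (f ∘ φ) = hX.avg f ∘ φ := by
  ext x
  simp [avg_apply, hX.sum_ball_iso]

theorem avg_pow_comp_iso (φ : X ≃g X) (f : V → ℝ) (n : ℕ) :
    (hX.avg ^ n) (f ∘ φ) = (hX.avg ^ n) f ∘ φ := by
  induction n with
  | zero => rfl
  | succ n ih => rw [avg_pow_succ, ih, avg_comp_iso, avg_pow_succ]

omit hX in
open Classical in
/-- The kernel of the `n`-th power of the averaging operator. -/
noncomputable def ker (hX : TransGraph X) (n : ℕ) (x z : V) : ℝ :=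
  (hX.avg ^ n) (fun w => if w = z then 1 else 0) x

theorem ker_nonneg (n : ℕ) (x z : V) : 0 ≤ hX.ker n x z := by
  have := hX.avg_pow_mono (f := fun _ => 0) (g := fun w => open Classical in if w = z then 1 else 0)
    (fun y => by split_ifs <;> norm_num) n x
  rwa [avg_pow_const] at this

theorem ker_succ (n : ℕ) (x z : V) :
    hX.ker (n + 1) x z = (∑ y ∈ hX.ball x 1, hX.ker n y z) / hX.vol 1 := by
  rw [ker, avg_pow_succ]; rfl

theorem ker_eq_zero {n : ℕ} {x z : V} (h : n < X.dist x z) : hX.ker n x z = 0 := by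
  induction n generalizing x with
  | zero =>
    have : x ≠ z := by rintro rfl; simp at h
    simp [ker, this]
  | succ n ih =>
    rw [ker_succ, Finset.sum_eq_zero, zero_div]
    intro y hy
    rw [mem_ball, SimpleGraph.dist_comm] at hy
    have := hX.tri x y z
    exact ih (by omega)

theorem avg_pow_eq_sum (n : ℕ) (f : V → ℝ) {x : V} {Z : Finset V}
    (hZ : ∀ z, X.dist z x ≤ n → z ∈ Z) : (hX.avg ^ n) f x = ∑ z ∈ Z, hX.ker n x z * f z := by
  classical
  induction n generalizing x with
  | zero =>
    have : x ∈ Z := hZ x (by simp)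
    simp [ker, this]
  | succ n ih =>
    rw [avg_pow_succ, avg_apply]
    simp only [ker_succ, div_mul_eq_mul_div]
    rw [← Finset.sum_div]
    congr 1
    simp only [Finset.sum_mul]
    rw [Finset.sum_comm]
    apply Finset.sum_congr rfl
    intro y hy
    rw [mem_ball] at hy
    apply ih
    intro z hz
    have := hX.tri z y x
    exact hZ z (by omega)

theorem sum_ker (n : ℕ) {x : V} {Z : Finset V} (hZ : ∀ z, X.dist z x ≤ n → z ∈ Z) :
    ∑ z ∈ Z, hX.ker n x z = 1 := by
  have := hX.avg_pow_eq_sum n (fun _ => 1) hZ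
  rw [avg_pow_const] at this
  simpa using this.symm

theorem ker_succ' (n : ℕ) (x z : V) :
    hX.ker (n + 1) x z = (∑ y ∈ hX.ball z 1, hX.ker n x y) / hX.vol 1 := by
  classical
  have h1 : hX.avg (fun w => if w = z then 1 else 0) =
      (hX.vol 1 : ℝ)⁻¹ • ∑ y ∈ hX.ball z 1, fun w => if w = y then (1 : ℝ) else 0 := by
    ext w
    simp [avg_apply, SimpleGraph.dist_comm (u := z), div_eq_inv_mul]
  have h2 : hX.ker (n + 1) x z = (hX.avg ^ n) (hX.avg (fun w => if w = z then 1 else 0)) x := by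
    rw [ker, pow_succ]
    congr
  rw [h2, h1, map_smul, map_sum]
  simp only [Pi.smul_apply, Finset.sum_apply, smul_eq_mul, div_eq_inv_mul]
  congr 1

theorem ker_symm (n : ℕ) (x z : V) : hX.ker n x z = hX.ker n z x := by
  induction n generalizing x z with
  | zero =>
    by_cases h : x = z
    · rw [h]
    · simp [ker, h, Ne.symm h]
  | succ n ih =>
    rw [ker_succ, ker_succ']
    simp [ih]

theorem ker_add (m n : ℕ) {x : V} (y : V) {Z : Finset V} (hZ : ∀ z, X.dist z x ≤ m → z ∈ Z) :
    ∑ z ∈ Z, hX.ker m x z * hX.ker n y z = hX.ker (m + n) x y := by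
  rw [ker, pow_add]
  change _ = (hX.avg ^ m) _ x
  rw [hX.avg_pow_eq_sum m _ hZ]
  apply Finset.sum_congr rfl
  intro z _
  rw [hX.ker_symm n y z]
  rfl

theorem ker_iso (φ : X ≃g X) (n : ℕ) (x z : V) : hX.ker n (φ x) (φ z) = hX.ker n x z := by
  classical
  have h : (fun w => if w = z then (1 : ℝ) else 0) = (fun w => if w = φ z then (1 : ℝ) else 0) ∘ φ := by
    ext w
    simp
  have h2 : hX.ker n x z = (hX.avg ^ n) (fun w => if w = z then (1 : ℝ) else 0) x := by
    rw [ker]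
  rw [h2, h, avg_pow_comp_iso, ker]
  congr

theorem le_ker_two {x y : V} (h : X.Adj x y) : 1 / (hX.vol 1 : ℝ) ^ 2 ≤ hX.ker 2 x y := by
  have h1 : hX.ker 1 x y = 1 / hX.vol 1 := by
    classical
    rw [ker_succ]
    simp [ker, SimpleGraph.dist_comm (u := y), hX.dist_adj h]
  rw [ker_succ, sq, ← div_div, ← h1]
  apply div_le_div_of_nonneg_right _ (hX.vol_pos' 1).le
  exact Finset.single_le_sum (f := fun w => hX.ker 1 w y) (fun w _ => hX.ker_nonneg 1 w y)
    (by simp)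

end TransGraph

/-! ### A nonconstant Lipschitz harmonic function -/

namespace TransGraph

variable {V : Type*} {X : SimpleGraph V} (hX : TransGraph X)
include hX

omit hX in
open Classical in
/-- The distribution of the walk after `n` steps, as a vector of `ℓ²`. -/
noncomputable def heatVec (hX : TransGraph X) (n : ℕ) (x : V) : lp (fun _ : V => ℝ) 2 :=
  ∑ z ∈ hX.ball x n, hX.ker n x z • lp.single 2 z (1 : ℝ)

theorem inner_heatVec (m n : ℕ) (x y : V) :
    inner ℝ (hX.heatVec m x) (hX.heatVec n y) = hX.ker (m + n) x y := by
  classical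
  have h : ∀ z, (hX.heatVec n y : V → ℝ) z = hX.ker n y z := by
    intro z
    rw [heatVec, lp.coeFn_sum, Finset.sum_apply]
    simp only [lp.coeFn_smul, Pi.smul_apply, lp.coeFn_single, smul_eq_mul]
    by_cases hz : z ∈ hX.ball y n
    · rw [Finset.sum_eq_single_of_mem z hz]
      · simp
      · intro b _ hb
        simp [hb.symm]
    · rw [Finset.sum_eq_zero, hX.ker_eq_zero]
      · rw [SimpleGraph.dist_comm]
        simpa using hz
      · intro b hb
        have : z ≠ b := by rintro rfl; exact hz hb
        simp [this]
  rw [heatVec, sum_inner, ← hX.ker_add m n y (Z := hX.ball x m) (by simp)]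
  apply Finset.sum_congr rfl
  intro z _
  rw [inner_smul_left, lp.inner_single_left, h]
  simp

omit hX in
/-- Return probabilities. -/
noncomputable def ret (hX : TransGraph X) (n : ℕ) : ℝ := hX.ker n hX.base hX.base

theorem ker_self (n : ℕ) (x : V) : hX.ker n x x = hX.ret n := by
  obtain ⟨φ, rfl⟩ := hX.trans hX.base x
  exact hX.ker_iso φ n _ _

omit hX in
/-- The energy of the walk. -/
noncomputable def energy (hX : TransGraph X) (j : ℕ) : ℝ := hX.ret (2 * j) - hX.ret (2 * j + 2)

theorem norm_heatVec_sub_sq (j : ℕ) (x y : V) :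
    ‖hX.heatVec j x - hX.heatVec j y‖ ^ 2 = 2 * hX.ret (2 * j) - 2 * hX.ker (2 * j) x y := by
  rw [norm_sub_sq_real, inner_heatVec, ← real_inner_self_eq_norm_sq, ← real_inner_self_eq_norm_sq,
    inner_heatVec, inner_heatVec, ker_self, ker_self]
  ring_nf

theorem norm_heatVec_step_sq (j : ℕ) (x : V) :
    ‖hX.heatVec (j + 2) x - hX.heatVec j x‖ ^ 2 = hX.energy j - hX.energy (j + 1) := by
  rw [norm_sub_sq_real, inner_heatVec, ← real_inner_self_eq_norm_sq, ← real_inner_self_eq_norm_sq,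
    inner_heatVec, inner_heatVec, ker_self, ker_self, ker_self, energy, energy]
  ring_nf

theorem sum_ker_norm_sq (j : ℕ) (x : V) :
    ∑ y ∈ hX.ball x 2, hX.ker 2 x y * ‖hX.heatVec j y - hX.heatVec j x‖ ^ 2 = 2 * hX.energy j := by
  simp only [norm_heatVec_sub_sq, mul_sub, Finset.sum_sub_distrib]
  have h1 := hX.sum_ker 2 (x := x) (Z := hX.ball x 2) (by simp)
  have h2 := hX.ker_add 2 (2 * j) (x := x) x (Z := hX.ball x 2) (by simp)
  rw [ker_self] at h2
  rw [← Finset.sum_mul, h1, energy]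
  have h3 : ∑ y ∈ hX.ball x 2, hX.ker 2 x y * (2 * hX.ker (2 * j) y x) = 2 * hX.ret (2 + 2 * j) := by
    rw [← h2, Finset.mul_sum]
    apply Finset.sum_congr rfl
    intro y _
    rw [hX.ker_symm (2 * j) y x]
    ring
  rw [h3, add_comm 2]
  ring

theorem energy_nonneg (j : ℕ) : 0 ≤ hX.energy j := by
  have := hX.sum_ker_norm_sq j hX.base
  have h : 0 ≤ ∑ y ∈ hX.ball hX.base 2,
      hX.ker 2 hX.base y * ‖hX.heatVec j y - hX.heatVec j hX.base‖ ^ 2 :=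
    Finset.sum_nonneg fun y _ => mul_nonneg (hX.ker_nonneg _ _ _) (by positivity)
  linarith

theorem norm_heatVec_sub_le (j : ℕ) (x y : V) :
    ‖hX.heatVec j x - hX.heatVec j y‖ ≤ √(2 * hX.vol 1 ^ 2 * hX.energy j) * X.dist x y := by
  apply hX.norm_sub_le_mul_dist
  intro x y h
  apply Real.le_sqrt_of_sq_le
  have h1 := hX.sum_ker_norm_sq j y
  have h2 : hX.ker 2 y x * ‖hX.heatVec j x - hX.heatVec j y‖ ^ 2 ≤ 2 * hX.energy j := by
    rw [← h1]
    exact Finset.single_le_sum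
      (f := fun w => hX.ker 2 y w * ‖hX.heatVec j w - hX.heatVec j y‖ ^ 2)
      (fun w _ => mul_nonneg (hX.ker_nonneg 2 y w) (by positivity)) (by simp [hX.dist_adj h])
  have h3 := mul_le_mul_of_nonneg_right (hX.le_ker_two h.symm)
    (sq_nonneg ‖hX.heatVec j x - hX.heatVec j y‖)
  have hv := hX.vol_pos' 1
  have h4 := h3.trans h2
  rw [one_div, inv_mul_le_iff₀ (by positivity)] at h4
  linarith

theorem energy_lower {s : ℕ} (hB : Bisects X s) {ℓ : ℤ → V} (hℓ : IsGeodLine X ℓ) (j : ℕ) :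
    3 ≤ 4 * ((3 * j + 1 : ℕ) : ℝ) ^ 2 * hX.vol 1 ^ 2 * hX.energy j * hX.vol j := by
  have hvj := hX.vol_pos' j
  have hv1 := hX.vol_pos' 1
  have hE := hX.energy_nonneg j
  have h1 : 1 ≤ hX.vol j * hX.ret (2 * j) := by
    have hs := hX.sum_ker j (x := hX.base) (Z := hX.ball hX.base j) (by simp)
    have hq := hX.ker_add j j (x := hX.base) hX.base (Z := hX.ball hX.base j) (by simp)
    have := sq_sum_le_card_mul_sum_sq (s := hX.ball hX.base j) (f := fun z => hX.ker j hX.base z)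
    rw [hs, hX.card_ball] at this
    rw [two_mul, ret, ← hq]
    simpa [sq] using this
  obtain ⟨r, hr⟩ : ∃ r, r = 3 * j + 1 := ⟨_, rfl⟩
  have h4 : 4 * (hX.vol j : ℝ) ≤ hX.vol r := by
    rw [hr]; exact_mod_cast hX.four_mul_vol_le hB hℓ j
  have h2 : (hX.vol r : ℝ) * (hX.ret (2 * j) - r ^ 2 * hX.vol 1 ^ 2 * hX.energy j) ≤ 1 := by
    rw [← hX.sum_ker (2 * j) (x := hX.base) (Z := hX.ball hX.base (2 * j + r))
      (fun z hz => by rw [mem_ball]; omega)]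
    refine le_trans ?_ (Finset.sum_le_sum_of_subset_of_nonneg (s := hX.ball hX.base r)
      (hX.ball_subset (by simp)) fun z _ _ => hX.ker_nonneg _ _ _)
    rw [← hX.card_ball hX.base r, ← nsmul_eq_mul]
    apply Finset.card_nsmul_le_sum
    intro y hy
    rw [mem_ball, SimpleGraph.dist_comm] at hy
    have e1 := hX.norm_heatVec_sub_sq j hX.base y
    have e2 := hX.norm_heatVec_sub_le j hX.base y
    have e3 : √(2 * hX.vol 1 ^ 2 * hX.energy j) * X.dist hX.base y ≤
        √(2 * hX.vol 1 ^ 2 * hX.energy j) * r := by gcongr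
    have e4 := pow_le_pow_left₀ (norm_nonneg _) (e2.trans e3) 2
    rw [mul_pow, Real.sq_sqrt (by positivity), e1] at e4
    linarith
  rw [← hr]
  set a := (r : ℝ) ^ 2 * hX.vol 1 ^ 2 * hX.energy j with ha
  by_contra hcon
  push Not at hcon
  have hcon' : 4 * (a * hX.vol j) < 3 := by rw [ha]; linarith
  have h5 : hX.vol j * (hX.ret (2 * j) - a) > 1 / 4 := by nlinarith
  have h6 : 0 < hX.ret (2 * j) - a := by
    by_contra h; push Not at h
    nlinarith
  nlinarith

theorem exists_energy_step {s : ℕ} (hB : Bisects X s) (hnh : ¬ GromovHyperbolic X) {ε : ℝ}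
    (hε : 0 < ε) : ∃ j, 0 < hX.energy j ∧ hX.energy j - hX.energy (j + 1) ≤ ε * hX.energy j := by
  obtain ⟨ℓ, hℓ, -⟩ := hX.exists_line hnh
  obtain ⟨C, hC, hvol⟩ := hX.exists_vol_le hB hnh
  have hpos : ∀ j, 0 < hX.energy j := by
    intro j
    refine (hX.energy_nonneg j).lt_of_ne' fun h => ?_
    have := hX.energy_lower hB hℓ j
    rw [h] at this
    norm_num at this
  by_contra hcon
  push Not at hcon
  have hstep : ∀ j, hX.energy (j + 1) ≤ (1 - ε) * hX.energy j := fun j => by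
    have := hcon j (hpos j); linarith
  have hε1 : ε < 1 := by
    by_contra h
    have h1 := hstep 0
    have h2 := hpos 1
    have h3 := hpos 0
    push Not at h
    simp only [zero_add] at h1
    nlinarith
  have hdec : ∀ j, hX.energy j ≤ (1 - ε) ^ j * hX.energy 0 := by
    intro j
    induction j with
    | zero => simp
    | succ j ih =>
      rw [pow_succ]
      have := hstep j
      have := mul_le_mul_of_nonneg_left ih (show 0 ≤ 1 - ε by linarith)
      linarith
  have t1 := tendsto_pow_const_mul_const_pow_of_abs_lt_one 4 (r := 1 - ε)
    (by rw [abs_lt]; constructor <;> linarith)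
  have hv1 := hX.vol_pos' 1
  have h0 := hpos 0
  set K := 4 * 4 ^ 2 * (hX.vol 1 : ℝ) ^ 2 * hX.energy 0 * C with hK
  have hKp : 0 < K := by positivity
  obtain ⟨N, hN⟩ := Filter.eventually_atTop.1 (t1.eventually (gt_mem_nhds (show (0 : ℝ) < 3 / K by
    positivity)))
  obtain ⟨R, hR, hvR⟩ := hvol (N + 1)
  have h1 := hN R (by omega)
  have h2 := hX.energy_lower hB hℓ R
  have hR1 : (1 : ℝ) ≤ R := by exact_mod_cast (by omega : 1 ≤ R)
  have h3 := hdec R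
  have hq : 0 ≤ (1 - ε) ^ R := pow_nonneg (by linarith) _
  rw [lt_div_iff₀ hKp] at h1
  have h5 : ((3 * R + 1 : ℕ) : ℝ) ≤ 4 * R := by push_cast; linarith
  have : 4 * ((3 * R + 1 : ℕ) : ℝ) ^ 2 * hX.vol 1 ^ 2 * hX.energy R * hX.vol R ≤
      4 * (4 * R : ℝ) ^ 2 * hX.vol 1 ^ 2 * ((1 - ε) ^ R * hX.energy 0) * (C * R ^ 2) := by
    have := hpos R
    gcongr
  have e : 4 * (4 * R : ℝ) ^ 2 * hX.vol 1 ^ 2 * ((1 - ε) ^ R * hX.energy 0) * (C * R ^ 2) =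
      R ^ 4 * (1 - ε) ^ R * K := by rw [hK]; ring
  linarith

theorem exists_almost_harmonic {s : ℕ} (hB : Bisects X s) (hnh : ¬ GromovHyperbolic X) {ε : ℝ}
    (hε : 0 < ε) : ∃ f : V → ℝ, (∀ x y, X.Adj x y → |f x - f y| ≤ 4 * hX.vol 1 ^ 2) ∧
      f hX.base = 0 ∧ 1 ≤ ∑ y ∈ hX.ball hX.base 2, |f y| ∧
      ∀ x, |(hX.avg ^ 2) f x - f x| ≤ ε := by
  have hv1 := hX.vol_pos' 1
  obtain ⟨j, hj, hD⟩ := hX.exists_energy_step hB hnh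
    (ε := ε ^ 2 / (8 * hX.vol 1 ^ 2)) (by positivity)
  obtain ⟨y, hy, hy1⟩ : ∃ y ∈ hX.ball hX.base 2,
      hX.energy j ≤ ‖hX.heatVec j y - hX.heatVec j hX.base‖ ^ 2 := by
    by_contra hcon
    push Not at hcon
    have h1 := hX.sum_ker_norm_sq j hX.base
    have h2 := hX.sum_ker 2 (x := hX.base) (Z := hX.ball hX.base 2) (by simp)
    have h3 : ∑ y ∈ hX.ball hX.base 2, hX.ker 2 hX.base y *
        ‖hX.heatVec j y - hX.heatVec j hX.base‖ ^ 2 ≤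
        ∑ y ∈ hX.ball hX.base 2, hX.ker 2 hX.base y * hX.energy j :=
      Finset.sum_le_sum fun y hy => mul_le_mul_of_nonneg_left (hcon y hy).le (hX.ker_nonneg _ _ _)
    rw [← Finset.sum_mul, h2, h1] at h3
    linarith
  set w := hX.heatVec j y - hX.heatVec j hX.base with hw
  set g : V → ℝ := fun x => inner ℝ (hX.heatVec j x) w / hX.energy j with hg
  have hwn : ‖w‖ ≤ √(2 * hX.vol 1 ^ 2 * hX.energy j) * 2 := by
    refine (hX.norm_heatVec_sub_le j y hX.base).trans ?_
    rw [mem_ball] at hy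
    gcongr
    exact_mod_cast hy
  have hgsub : ∀ a b, |g a - g b| ≤ ‖hX.heatVec j a - hX.heatVec j b‖ * ‖w‖ / hX.energy j := by
    intro a b
    rw [hg]
    dsimp only
    rw [← sub_div, ← inner_sub_left, abs_div, abs_of_pos hj]
    gcongr
    exact abs_real_inner_le_norm _ _
  have havg : ∀ x, (hX.avg ^ 2) g x = inner ℝ (hX.heatVec (j + 2) x) w / hX.energy j := by
    intro x
    have hk : ∀ z n, (hX.avg ^ 2) (fun x => hX.ker n x z) = fun x => hX.ker (n + 2) x z := by
      intro z n
      ext x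
      rw [hX.avg_pow_eq_sum 2 _ (Z := hX.ball x 2) (by simp), add_comm,
        ← hX.ker_add 2 n z (Z := hX.ball x 2) (by simp)]
      simp only [hX.ker_symm n z]
    have e : g = (hX.energy j)⁻¹ • ((fun x => hX.ker (j + j) x y) -
        (fun x => hX.ker (j + j) x hX.base)) := by
      ext a
      simp only [hg, hw, inner_sub_right, inner_heatVec, Pi.smul_apply, Pi.sub_apply, smul_eq_mul]
      rw [div_eq_inv_mul]
    rw [e, map_smul, map_sub, hk, hk, hw]
    simp only [inner_sub_right, inner_heatVec, Pi.smul_apply, Pi.sub_apply, smul_eq_mul]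
    rw [div_eq_inv_mul, show j + j + 2 = j + 2 + j by ring]
  refine ⟨fun x => g x - g hX.base, ?_, by simp, ?_, ?_⟩
  · intro a b hab
    have h1 := hgsub a b
    have h2 := hX.norm_heatVec_sub_le j a b
    rw [hX.dist_adj hab, Nat.cast_one, mul_one] at h2
    rw [sub_sub_sub_cancel_right]
    refine h1.trans ?_
    rw [div_le_iff₀ hj]
    calc _ ≤ √(2 * hX.vol 1 ^ 2 * hX.energy j) * (√(2 * hX.vol 1 ^ 2 * hX.energy j) * 2) := by
          gcongr
      _ = 4 * hX.vol 1 ^ 2 * hX.energy j := by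
          rw [← mul_assoc, Real.mul_self_sqrt (by positivity)]; ring
  · refine le_trans ?_ (Finset.single_le_sum (f := fun y => |g y - g hX.base|)
      (fun _ _ => abs_nonneg _) hy)
    refine le_trans ?_ (le_abs_self _)
    rw [hg]
    dsimp only
    rw [← sub_div, ← inner_sub_left, ← hw, real_inner_self_eq_norm_sq, le_div_iff₀ hj]
    linarith
  · intro x
    have e : (hX.avg ^ 2) (fun x => g x - g hX.base) = (hX.avg ^ 2) g - fun _ => g hX.base := by
      rw [← hX.avg_pow_const 2 (g hX.base), ← map_sub]; rfl
    rw [e]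
    simp only [Pi.sub_apply, havg, sub_sub_sub_cancel_right]
    rw [hg]
    dsimp only
    rw [← sub_div, ← inner_sub_left, abs_div, abs_of_pos hj, div_le_iff₀ hj]
    refine (abs_real_inner_le_norm _ _).trans ?_
    apply abs_le_of_sq_le_sq' _ (by positivity) |>.2
    rw [mul_pow, norm_heatVec_step_sq]
    have hw2 := pow_le_pow_left₀ (norm_nonneg _) hwn 2
    rw [mul_pow, Real.sq_sqrt (by positivity)] at hw2
    calc _ ≤ (ε ^ 2 / (8 * hX.vol 1 ^ 2) * hX.energy j) * (2 * hX.vol 1 ^ 2 * hX.energy j * 2 ^ 2) := by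
          gcongr
      _ = (ε * hX.energy j) ^ 2 := by field_simp; ring

theorem eq_zero_of_avg_eq_neg {w : V → ℝ} {M : ℝ} (hM : ∀ x, |w x| ≤ M)
    (hw : hX.avg w = fun x => -w x) : w = 0 := by
  classical
  have hv := hX.vol_pos' 1
  have hvge : (1 : ℝ) ≤ hX.vol 1 := by exact_mod_cast hX.vol_pos 1
  have hM0 : 0 ≤ M := (abs_nonneg _).trans (hM hX.base)
  have hstep : ∀ K : ℝ, 0 ≤ K → (∀ x, |w x| ≤ K) → ∀ x, |w x| ≤ (hX.vol 1 - 1) / (hX.vol 1 + 1) * K := by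
    intro K hK h x
    have h1 := congrFun hw x
    rw [avg_apply, div_eq_iff hv.ne', ← Finset.add_sum_erase _ _ (show x ∈ hX.ball x 1 by simp)] at h1
    have h2 : |∑ y ∈ (hX.ball x 1).erase x, w y| ≤ (hX.vol 1 - 1) * K := by
      refine (Finset.abs_sum_le_sum_abs _ _).trans ?_
      refine (Finset.sum_le_card_nsmul _ _ K fun y _ => h y).trans ?_
      rw [Finset.card_erase_of_mem (by simp), hX.card_ball, nsmul_eq_mul,
        Nat.cast_sub (hX.vol_pos 1), Nat.cast_one]
    have h3 : ∑ y ∈ (hX.ball x 1).erase x, w y = -(hX.vol 1 + 1) * w x := by linarith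
    rw [h3, abs_mul, abs_neg, abs_of_pos (by linarith)] at h2
    rw [div_mul_eq_mul_div, le_div_iff₀ (by linarith)]
    linarith
  set q : ℝ := (hX.vol 1 - 1) / (hX.vol 1 + 1) with hq
  have hq0 : 0 ≤ q := div_nonneg (by linarith) (by linarith)
  have hq1 : q < 1 := by rw [hq, div_lt_one (by linarith)]; linarith
  have hall : ∀ n : ℕ, ∀ x, |w x| ≤ q ^ n * M := by
    intro n
    induction n with
    | zero => simpa using hM
    | succ n ih =>
      intro x
      rw [pow_succ', mul_assoc]
      exact hstep _ (by positivity) ih x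
  ext x
  have t : Filter.Tendsto (fun n : ℕ => q ^ n * M) Filter.atTop (nhds 0) := by
    simpa using (tendsto_pow_atTop_nhds_zero_of_lt_one hq0 hq1).mul_const M
  have := ge_of_tendsto' t (fun n => hall n x)
  simpa using this

theorem exists_harmonic {s : ℕ} (hB : Bisects X s) (hnh : ¬ GromovHyperbolic X) :
    ∃ f : V → ℝ, hX.avg f = f ∧ f hX.base = 0 ∧ (∃ L, ∀ x y, X.Adj x y → |f x - f y| ≤ L) ∧
      f ≠ 0 := by
  choose F hFlip hF0 hFs hFh using fun n : ℕ => hX.exists_almost_harmonic hB hnh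
    (ε := 1 / ((n : ℝ) + 1)) (by positivity)
  have hbd : ∀ x n, |F n x| ≤ 4 * hX.vol 1 ^ 2 * X.dist x hX.base := by
    intro x n
    have := hX.norm_sub_le_mul_dist (U := F n) (fun a b h => hFlip n a b h) x hX.base
    rwa [hF0, sub_zero] at this
  choose f hf using fun x => exists_hyperlim (hbd x)
  have hlip : ∀ x y, X.Adj x y → |f x - f y| ≤ 4 * hX.vol 1 ^ 2 := fun x y h =>
    le_of_tendsto' ((hf x).sub (hf y)).abs fun n => hFlip n x y h
  have h2 : (hX.avg ^ 2) f = f := by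
    ext x
    have t1 : Filter.Tendsto (fun n => (hX.avg ^ 2) (F n) x) (Filter.hyperfilter ℕ : Filter ℕ)
        (nhds ((hX.avg ^ 2) f x)) := by
      simp only [hX.avg_pow_eq_sum 2 _ (x := x) (Z := hX.ball x 2) (by simp)]
      exact tendsto_finsetSum _ fun z _ => (hf z).const_mul _
    have t2 := t1.sub (hf x)
    have t3 : Filter.Tendsto (fun n => (hX.avg ^ 2) (F n) x - F n x)
        (Filter.hyperfilter ℕ : Filter ℕ) (nhds 0) := by
      apply squeeze_zero_norm (fun n => hFh n x)
      exact tendsto_one_div_add_atTop_nhds_zero_nat.mono_left Nat.hyperfilter_le_atTop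
    have := tendsto_nhds_unique t2 t3
    linarith
  have h1 : hX.avg f = f := by
    have hw := hX.eq_zero_of_avg_eq_neg (w := hX.avg f - f) (M := 4 * hX.vol 1 ^ 2) ?_ ?_
    · exact sub_eq_zero.1 hw
    · intro x
      have e : (hX.avg f - f) x = hX.avg (f - fun _ => f x) x := by
        rw [map_sub, avg_const]; rfl
      have hb : ∀ y ∈ hX.ball x 1, |f y - f x| ≤ 4 * hX.vol 1 ^ 2 := by
        intro y hy
        rw [mem_ball] at hy
        refine (hX.norm_sub_le_mul_dist (U := f) hlip y x).trans ?_
        have : (X.dist y x : ℝ) ≤ 1 := by exact_mod_cast hy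
        nlinarith [sq_nonneg (hX.vol 1 : ℝ)]
      rw [e, abs_le]
      constructor
      · have := hX.avg_mono (f := fun _ => -(4 * (hX.vol 1 : ℝ) ^ 2)) (g := f - fun _ => f x)
          (x := x) fun y hy => (abs_le.1 (hb y hy)).1
        rwa [avg_const] at this
      · have := hX.avg_mono (g := fun _ => 4 * (hX.vol 1 : ℝ) ^ 2) (f := f - fun _ => f x)
          (x := x) fun y hy => (abs_le.1 (hb y hy)).2
        rwa [avg_const] at this
    · ext x
      rw [map_sub]
      have : hX.avg (hX.avg f) = f := by
        rw [pow_two] at h2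
        exact h2
      rw [this]
      simp
  refine ⟨f, h1, ?_, ⟨_, hlip⟩, ?_⟩
  · refine tendsto_nhds_unique (hf hX.base) ?_
    simp only [hF0]
    exact tendsto_const_nhds
  · rintro rfl
    have t : Filter.Tendsto (fun n => ∑ y ∈ hX.ball hX.base 2, |F n y|)
        (Filter.hyperfilter ℕ : Filter ℕ) (nhds (∑ y ∈ hX.ball hX.base 2, |(0 : V → ℝ) y|)) :=
      tendsto_finsetSum _ fun y _ => (hf y).abs
    have := ge_of_tendsto' t hFs
    norm_num at this

end TransGraph

/-! ### Entropy and the gradient estimate -/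

theorem sq_sqrt_sub_sqrt_le {a b : ℝ} (ha : 0 ≤ a) (hb : 0 ≤ b) (hab : b = 0 → a = 0) :
    (√a - √b) ^ 2 ≤ a * Real.log a - a * Real.log b - a + b := by
  rcases ha.eq_or_lt with rfl | ha
  · simp [Real.sq_sqrt hb]
  have hb : 0 < b := hb.lt_of_ne fun h => ha.ne' (hab h.symm)
  have h1 := Real.log_le_sub_one_of_pos (div_pos (Real.sqrt_pos.2 hb) (Real.sqrt_pos.2 ha))
  rw [Real.log_div (Real.sqrt_pos.2 hb).ne' (Real.sqrt_pos.2 ha).ne', Real.log_sqrt hb.le,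
    Real.log_sqrt ha.le] at h1
  have h2 := mul_le_mul_of_nonneg_left h1 ha.le
  have h3 : a * (√b / √a) = √a * √b := by
    conv_lhs => rw [← Real.mul_self_sqrt ha.le]
    field_simp
    rw [Real.sqrt_sq (Real.sqrt_nonneg a)]
  rw [mul_sub _ (√b / √a), h3] at h2
  have h4 := Real.sq_sqrt ha.le
  have h5 := Real.sq_sqrt hb.le
  nlinarith

namespace TransGraph

variable {V : Type*} {X : SimpleGraph V} (hX : TransGraph X)
include hX

omit hX in
/-- The entropy of the `n`-step lazy random walk started at `x`. -/
noncomputable def ent (hX : TransGraph X) (n : ℕ) (x : V) : ℝ :=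
  ∑ z ∈ hX.ball x n, Real.negMulLog (hX.ker n x z)

theorem ent_eq_sum (n : ℕ) {x : V} {Z : Finset V} (hZ : ∀ z, X.dist z x ≤ n → z ∈ Z) :
    hX.ent n x = ∑ z ∈ Z, Real.negMulLog (hX.ker n x z) := by
  apply Finset.sum_subset
  · intro z hz
    exact hZ z (hX.mem_ball.1 hz)
  · intro z _ hz
    rw [mem_ball, not_le, SimpleGraph.dist_comm] at hz
    rw [hX.ker_eq_zero hz, Real.negMulLog_zero]

theorem ent_eq (n : ℕ) (x y : V) : hX.ent n x = hX.ent n y := by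
  obtain ⟨φ, rfl⟩ := hX.trans y x
  rw [ent, hX.sum_ball_iso, ent]
  simp only [ker_iso]

theorem ent_le (n : ℕ) (x : V) : hX.ent n x ≤ Real.log (hX.vol n) := by
  have hv := hX.vol_pos' n
  have h : ∀ z ∈ hX.ball x n, Real.negMulLog (hX.ker n x z) ≤
      hX.ker n x z * Real.log (hX.vol n) + 1 / hX.vol n - hX.ker n x z := by
    intro z _
    rcases (hX.ker_nonneg n x z).eq_or_lt with h0 | h0
    · rw [← h0]
      simp
    · have h1 := Real.log_le_sub_one_of_pos (div_pos one_pos (mul_pos h0 hv))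
      rw [Real.log_div one_ne_zero (mul_pos h0 hv).ne', Real.log_one,
        Real.log_mul h0.ne' hv.ne'] at h1
      have h2 := mul_le_mul_of_nonneg_left h1 h0.le
      have h3 : hX.ker n x z * (1 / (hX.ker n x z * hX.vol n)) = 1 / hX.vol n := by
        field_simp
      rw [mul_sub _ (1 / _), h3] at h2
      rw [Real.negMulLog]
      linarith
  refine (Finset.sum_le_sum h).trans ?_
  have h1 := hX.sum_ker n (x := x) (Z := hX.ball x n) (by simp)
  rw [Finset.sum_sub_distrib, Finset.sum_add_distrib, ← Finset.sum_mul, h1, Finset.sum_const,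
    hX.card_ball, nsmul_eq_mul, mul_one_div_cancel hv.ne']
  linarith

theorem ker_le_mul_ker {n : ℕ} {x y : V} (hy : y ∈ hX.ball x 1) (z : V) :
    hX.ker n y z ≤ hX.vol 1 * hX.ker (n + 1) x z := by
  rw [ker_succ, mul_div_cancel₀ _ (hX.vol_pos' 1).ne']
  exact Finset.single_le_sum (f := fun w => hX.ker n w z) (fun w _ => hX.ker_nonneg n w z) hy

theorem sum_sq_sqrt_ker_le (n : ℕ) (x : V) :
    ∑ y ∈ hX.ball x 1, ∑ z ∈ hX.ball x (n + 1), (√(hX.ker n y z) - √(hX.ker (n + 1) x z)) ^ 2 ≤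
      hX.vol 1 * (hX.ent (n + 1) x - hX.ent n x) := by
  have hZ : ∀ y ∈ hX.ball x 1, ∀ z, X.dist z y ≤ n → z ∈ hX.ball x (n + 1) := by
    intro y hy z hz
    rw [mem_ball] at hy ⊢
    have := hX.tri z y x
    omega
  have h1 : ∑ y ∈ hX.ball x 1, ∑ z ∈ hX.ball x (n + 1),
      (√(hX.ker n y z) - √(hX.ker (n + 1) x z)) ^ 2 ≤
      ∑ y ∈ hX.ball x 1, ∑ z ∈ hX.ball x (n + 1),
        (hX.ker n y z * Real.log (hX.ker n y z) - hX.ker n y z * Real.log (hX.ker (n + 1) x z)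
          - hX.ker n y z + hX.ker (n + 1) x z) := by
    refine Finset.sum_le_sum fun y hy => Finset.sum_le_sum fun z _ => ?_
    refine sq_sqrt_sub_sqrt_le (hX.ker_nonneg _ _ _) (hX.ker_nonneg _ _ _) fun h0 => ?_
    have := hX.ker_le_mul_ker (n := n) hy z
    rw [h0, mul_zero] at this
    exact le_antisymm this (hX.ker_nonneg _ _ _)
  refine h1.trans (le_of_eq ?_)
  have h2 : ∀ y ∈ hX.ball x 1, ∑ z ∈ hX.ball x (n + 1),
        (hX.ker n y z * Real.log (hX.ker n y z) - hX.ker n y z * Real.log (hX.ker (n + 1) x z)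
          - hX.ker n y z + hX.ker (n + 1) x z) =
      - hX.ent n x - ∑ z ∈ hX.ball x (n + 1), hX.ker n y z * Real.log (hX.ker (n + 1) x z) := by
    intro y hy
    rw [Finset.sum_add_distrib, Finset.sum_sub_distrib, Finset.sum_sub_distrib,
      hX.sum_ker n (hZ y hy), hX.sum_ker (n + 1) (by simp), hX.ent_eq n x y,
      hX.ent_eq_sum n (hZ y hy)]
    simp [Real.negMulLog]
  rw [Finset.sum_congr rfl h2, Finset.sum_sub_distrib, Finset.sum_const, hX.card_ball,
    nsmul_eq_mul, Finset.sum_comm, hX.ent_eq_sum (n + 1) (x := x) (Z := hX.ball x (n + 1)) (by simp),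
    mul_sub, Finset.mul_sum]
  simp only [← Finset.sum_mul]
  have h3 : ∀ z, ∑ y ∈ hX.ball x 1, hX.ker n y z = hX.vol 1 * hX.ker (n + 1) x z := by
    intro z
    rw [ker_succ, mul_div_cancel₀ _ (hX.vol_pos' 1).ne']
  simp only [h3, Real.negMulLog]
  rw [sub_eq_add_neg, ← Finset.sum_neg_distrib, add_comm]
  rw [sub_eq_add_neg, mul_neg]
  congr 1
  apply Finset.sum_congr rfl
  intro z _
  ring

theorem frequently_ent_le {s : ℕ} (hB : Bisects X s) (hnh : ¬ GromovHyperbolic X) :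
    ∃ᶠ n : ℕ in Filter.atTop, ∀ x, hX.ent (n + 1) x - hX.ent n x ≤ 3 / (n + 1) := by
  intro hev
  obtain ⟨n0, hn0⟩ := Filter.eventually_atTop.1 hev
  obtain ⟨C, hC, hV⟩ := hX.exists_vol_le hB hnh
  set H : ℕ → ℝ := fun n => hX.ent n hX.base with hH
  have hstep : ∀ n, n0 ≤ n → 3 / ((n : ℝ) + 1) < H (n + 1) - H n := by
    intro n hn
    have := hn0 n hn
    push Not at this
    obtain ⟨x, hx⟩ := this
    rwa [hX.ent_eq _ x hX.base, hX.ent_eq _ x hX.base] at hx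
  have hlow : ∀ n, n0 ≤ n → H n0 - 3 * Real.log (n0 + 1) ≤ H n - 3 * Real.log (n + 1) := by
    intro n hn
    induction n, hn using Nat.le_induction with
    | base => exact le_rfl
    | succ n hn ih =>
      refine ih.trans ?_
      have h1 := Real.log_le_sub_one_of_pos (x := ((n : ℝ) + 1 + 1) / (n + 1)) (by positivity)
      rw [Real.log_div (by positivity) (by positivity)] at h1
      have h2 := hstep n hn
      have h3 : ((n : ℝ) + 1 + 1) / (n + 1) - 1 = 1 / (n + 1) := by
        field_simp
        ring
      have h4 : 3 / ((n : ℝ) + 1) = 3 * (1 / (n + 1)) := by ring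
      rw [h3] at h1
      rw [h4] at h2
      push_cast
      linarith
  set K := Real.log C - (H n0 - 3 * Real.log (n0 + 1)) with hK
  obtain ⟨D, hD⟩ := exists_nat_gt (Real.exp K)
  obtain ⟨R, hR, hR2⟩ := hV (max (max D n0) 1)
  have hR0 : (0 : ℝ) < R := by exact_mod_cast (by omega : 0 < R)
  have h1 := hlow R (by omega)
  have h2 : H R ≤ Real.log (hX.vol R) := hX.ent_le R hX.base
  have h3 : Real.log (hX.vol R) ≤ Real.log C + 2 * Real.log R := by
    refine (Real.log_le_log (hX.vol_pos' R) hR2).trans (le_of_eq ?_)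
    rw [Real.log_mul hC.ne' (by positivity), Real.log_pow]
    norm_num
  have h4 : Real.log R ≤ Real.log (R + 1) := Real.log_le_log hR0 (by linarith)
  have h5 : Real.exp K < R + 1 := by
    have : (D : ℝ) ≤ R := by exact_mod_cast (by omega : D ≤ R)
    linarith
  have h6 := (Real.lt_log_iff_exp_lt (by positivity)).2 h5
  linarith

omit hX in
/-- The energy density of a pair of functions. -/
noncomputable def gam (hX : TransGraph X) (f g : V → ℝ) (x : V) : ℝ :=
  (∑ y ∈ hX.ball x 1, (f y - f x) * (g y - g x)) / hX.vol 1

theorem avg_mul_self {f : V → ℝ} (hf : hX.avg f = f) :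
    hX.avg (f * f) = f * f + hX.gam f f := by
  ext x
  have h1 : hX.avg f x = f x := by rw [hf]
  have hv := hX.vol_pos' 1
  rw [avg_apply, div_eq_iff hv.ne'] at h1
  rw [avg_apply, Pi.add_apply, gam, Pi.mul_apply, ← sub_eq_iff_eq_add', div_sub' hv.ne']
  congr 1
  have h2 : ∀ y, (f y - f x) * (f y - f x) = (f * f) y - 2 * f x * f y + f x * f x := by
    intro y
    simp only [Pi.mul_apply]
    ring
  simp only [h2, Finset.sum_add_distrib, Finset.sum_sub_distrib, ← Finset.mul_sum, h1,
    Finset.sum_const, hX.card_ball, nsmul_eq_mul]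
  ring

theorem avg_pow_mul_self {f : V → ℝ} (hf : hX.avg f = f) (n : ℕ) (x : V) :
    (hX.avg ^ n) (f * f) x = f x * f x + ∑ k ∈ Finset.range n, (hX.avg ^ k) (hX.gam f f) x := by
  induction n with
  | zero => simp
  | succ n ih =>
    rw [Finset.sum_range_succ, ← add_assoc, ← ih, pow_succ]
    change (hX.avg ^ n) (hX.avg (f * f)) x = _
    rw [hX.avg_mul_self hf, map_add]
    rfl

theorem avg_pow_eq_self {f : V → ℝ} (hf : hX.avg f = f) (n : ℕ) : (hX.avg ^ n) f = f := by
  induction n with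
  | zero => rfl
  | succ n ih => rw [avg_pow_succ, ih, hf]

theorem sq_sub_le_of_ent_le {n : ℕ} (hn : ∀ x, hX.ent (n + 1) x - hX.ent n x ≤ 3 / (n + 1))
    {f : V → ℝ} (hf : hX.avg f = f) {x y : V} (hy : y ∈ hX.ball x 1) :
    (f y - f x) ^ 2 ≤ 6 * hX.vol 1 * (hX.vol 1 + 1) *
      ((∑ k ∈ Finset.range (n + 1), (hX.avg ^ k) (hX.gam f f) x) / (n + 1 : ℕ)) := by
  have hv := hX.vol_pos' 1
  set g : V → ℝ := f - fun _ => f x with hg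
  have hg1 : hX.avg g = g := by rw [hg, map_sub, hf, avg_const]
  have hgx : g x = 0 := by simp [hg]
  have hgam : hX.gam g g = hX.gam f f := by
    ext w
    simp [gam, hg]
  have hZ : ∀ z, X.dist z y ≤ n → z ∈ hX.ball x (n + 1) := by
    intro z hz
    rw [mem_ball] at hy ⊢
    have := hX.tri z y x
    omega
  set a : V → ℝ := fun z => hX.ker n y z with ha
  set b : V → ℝ := fun z => hX.ker (n + 1) x z with hb
  have ha0 : ∀ z, 0 ≤ a z := fun z => hX.ker_nonneg n y z
  have hb0 : ∀ z, 0 ≤ b z := fun z => hX.ker_nonneg (n + 1) x z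
  have hab : ∀ z, a z ≤ hX.vol 1 * b z := fun z => hX.ker_le_mul_ker hy z
  have e1 : f y - f x = ∑ z ∈ hX.ball x (n + 1), (√(a z) - √(b z)) * ((√(a z) + √(b z)) * g z) := by
    have h1 : g y = ∑ z ∈ hX.ball x (n + 1), a z * g z := by
      rw [← hX.avg_pow_eq_sum n g hZ, hX.avg_pow_eq_self hg1]
    have h2 : g x = ∑ z ∈ hX.ball x (n + 1), b z * g z := by
      rw [← hX.avg_pow_eq_sum (n + 1) g (by simp), hX.avg_pow_eq_self hg1]
    have h3 : f y - f x = g y - g x := by simp [hg]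
    rw [h3, h1, h2, ← Finset.sum_sub_distrib]
    apply Finset.sum_congr rfl
    intro z _
    have h4 := Real.mul_self_sqrt (ha0 z)
    have h5 := Real.mul_self_sqrt (hb0 z)
    linear_combination (-g z) * h4 + g z * h5
  have e2 : ∑ z ∈ hX.ball x (n + 1), (√(a z) - √(b z)) ^ 2 ≤ hX.vol 1 * (3 / (n + 1)) := by
    refine le_trans ?_ (mul_le_mul_of_nonneg_left (hn x) hv.le)
    refine le_trans ?_ (hX.sum_sq_sqrt_ker_le n x)
    exact Finset.single_le_sum (f := fun y => ∑ z ∈ hX.ball x (n + 1),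
      (√(hX.ker n y z) - √(hX.ker (n + 1) x z)) ^ 2)
      (fun w _ => Finset.sum_nonneg fun z _ => sq_nonneg _) hy
  have e3 : ∑ z ∈ hX.ball x (n + 1), ((√(a z) + √(b z)) * g z) ^ 2 ≤
      2 * (hX.vol 1 + 1) * ∑ k ∈ Finset.range (n + 1), (hX.avg ^ k) (hX.gam f f) x := by
    have h1 := hX.avg_pow_mul_self hg1 (n + 1) x
    rw [hgx, hgam, hX.avg_pow_eq_sum (n + 1) (g * g) (x := x) (Z := hX.ball x (n + 1)) (by simp),
      mul_zero, zero_add] at h1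
    rw [← h1, Finset.mul_sum]
    refine Finset.sum_le_sum fun z _ => ?_
    have h4 := Real.mul_self_sqrt (ha0 z)
    have h5 := Real.mul_self_sqrt (hb0 z)
    have h6 : (√(a z) + √(b z)) ^ 2 ≤ 2 * (hX.vol 1 + 1) * b z := by
      nlinarith [sq_nonneg (√(a z) - √(b z)), hab z]
    calc ((√(a z) + √(b z)) * g z) ^ 2 = (√(a z) + √(b z)) ^ 2 * (g z * g z) := by ring
      _ ≤ 2 * (hX.vol 1 + 1) * b z * (g z * g z) :=
        mul_le_mul_of_nonneg_right h6 (mul_self_nonneg _)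
      _ = _ := by rw [Pi.mul_apply, mul_assoc]
  rw [e1]
  refine (Finset.sum_mul_sq_le_sq_mul_sq _ _ _).trans ?_
  refine (mul_le_mul e2 e3 (Finset.sum_nonneg fun _ _ => sq_nonneg _) (by positivity)).trans
    (le_of_eq ?_)
  push_cast
  field_simp
  ring

end TransGraph

/-! ### Asymptotic means and the energy form on Lipschitz harmonic functions -/

namespace TransGraph

variable {V : Type*} {X : SimpleGraph V} (hX : TransGraph X)
include hX

theorem abs_sub_le_of_mem_ball {f : V → ℝ} {L : ℝ} (h : ∀ x y, X.Adj x y → |f x - f y| ≤ L)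
    {x y : V} (hy : y ∈ hX.ball x 1) : |f y - f x| ≤ |L| := by
  rw [mem_ball] at hy
  rcases Nat.le_one_iff_eq_zero_or_eq_one.1 hy with h0 | h1
  · rw [hX.dist_eq_zero.1 h0, sub_self, abs_zero]
    exact abs_nonneg L
  · exact (h y x (SimpleGraph.dist_eq_one_iff_adj.1 h1)).trans (le_abs_self L)

theorem avg_eq_self_of_forall_eq {f : V → ℝ} (hf : ∀ x, ∀ y ∈ hX.ball x 1, f y = f x) (x y : V) :
    f x = f y := by
  have h := hX.norm_sub_le_mul_dist (U := f) (L := 0) (fun a b hab => by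
    rw [hf b a (by rw [mem_ball, hX.dist_adj hab]), sub_self, norm_zero]) x y
  rw [zero_mul, norm_le_zero_iff, sub_eq_zero] at h
  exact h

/-- The Liouville property. -/
theorem eq_of_bounded_harmonic {s : ℕ} (hB : Bisects X s) (hnh : ¬ GromovHyperbolic X)
    {f : V → ℝ} (hf : hX.avg f = f) {C : ℝ} (hC : ∀ x, |f x| ≤ C) (x y : V) : f x = f y := by
  have hv := hX.vol_pos' 1
  refine hX.avg_eq_self_of_forall_eq (fun x y hy => ?_) x y
  by_contra hne
  have hpos : 0 < (f y - f x) ^ 2 := by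
    have := sub_ne_zero.2 hne
    positivity
  obtain ⟨N, hN⟩ := exists_nat_gt (6 * hX.vol 1 * (hX.vol 1 + 1) * C ^ 2 / (f y - f x) ^ 2)
  obtain ⟨n, hn, hnE⟩ := Filter.frequently_atTop.1 (hX.frequently_ent_le hB hnh) N
  have h1 := hX.sq_sub_le_of_ent_le hnE hf hy
  have h2 := hX.avg_pow_mul_self hf (n + 1) x
  have h3 : (hX.avg ^ (n + 1)) (f * f) x ≤ C ^ 2 := by
    refine (le_abs_self _).trans (hX.abs_avg_pow_le (fun y => ?_) _ _)
    rw [Pi.mul_apply, ← sq, abs_pow]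
    exact pow_le_pow_left₀ (abs_nonneg _) (hC y) 2
  have h4 : ∑ k ∈ Finset.range (n + 1), (hX.avg ^ k) (hX.gam f f) x ≤ C ^ 2 := by
    nlinarith [mul_self_nonneg (f x)]
  have h5 : (f y - f x) ^ 2 ≤ 6 * hX.vol 1 * (hX.vol 1 + 1) * (C ^ 2 / (n + 1 : ℕ)) :=
    h1.trans (by gcongr)
  have hn' : (N : ℝ) < (n + 1 : ℕ) := by exact_mod_cast Nat.lt_succ_of_le hn
  rw [div_lt_iff₀ hpos] at hN
  rw [← mul_div_assoc, le_div_iff₀ (by positivity)] at h5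
  nlinarith

omit hX in
/-- Cesàro averages of the iterates of the averaging operator. -/
noncomputable def ces (hX : TransGraph X) (n : ℕ) : (V → ℝ) →ₗ[ℝ] (V → ℝ) :=
  (n : ℝ)⁻¹ • ∑ k ∈ Finset.range n, hX.avg ^ k

theorem ces_apply (n : ℕ) (f : V → ℝ) (x : V) :
    hX.ces n f x = (∑ k ∈ Finset.range n, (hX.avg ^ k) f x) / n := by
  simp [ces, div_eq_inv_mul, LinearMap.sum_apply, Finset.sum_apply]

theorem ces_const {n : ℕ} (hn : n ≠ 0) (c : ℝ) (x : V) : hX.ces n (fun _ => c) x = c := by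
  rw [ces_apply]
  simp only [avg_pow_const, Finset.sum_const, Finset.card_range, nsmul_eq_mul]
  field_simp

theorem ces_mono {f g : V → ℝ} (h : ∀ y, f y ≤ g y) (n : ℕ) (x : V) :
    hX.ces n f x ≤ hX.ces n g x := by
  rw [ces_apply, ces_apply]
  exact div_le_div_of_nonneg_right (Finset.sum_le_sum fun k _ => hX.avg_pow_mono h k x)
    (Nat.cast_nonneg n)

theorem abs_ces_le {f : V → ℝ} {C : ℝ} (h : ∀ y, |f y| ≤ C) {n : ℕ} (hn : n ≠ 0) (x : V) :
    |hX.ces n f x| ≤ C := by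
  rw [abs_le]
  constructor
  · rw [← hX.ces_const hn (-C) x]
    exact hX.ces_mono (fun y => (abs_le.1 (h y)).1) n x
  · rw [← hX.ces_const hn C x]
    exact hX.ces_mono (fun y => (abs_le.1 (h y)).2) n x

theorem ces_comp_iso (φ : X ≃g X) (f : V → ℝ) (n : ℕ) (x : V) :
    hX.ces n (f ∘ φ) x = hX.ces n f (φ x) := by
  simp [ces_apply, avg_pow_comp_iso]

theorem avg_ces_sub (n : ℕ) (f : V → ℝ) (x : V) :
    hX.avg (hX.ces n f) x - hX.ces n f x = ((hX.avg ^ n) f x - f x) / n := by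
  have h : ∀ m : ℕ, hX.avg ((∑ k ∈ Finset.range m, hX.avg ^ k) f) -
      (∑ k ∈ Finset.range m, hX.avg ^ k) f = (hX.avg ^ m) f - f := by
    intro m
    induction m with
    | zero => simp
    | succ m ih =>
      rw [Finset.sum_range_succ, LinearMap.add_apply, map_add, ← avg_pow_succ]
      linear_combination ih
  have := congrFun (h n) x
  rw [ces, LinearMap.smul_apply, map_smul]
  simp only [Pi.sub_apply, Pi.smul_apply, smul_eq_mul] at this ⊢
  rw [← mul_sub, this, div_eq_inv_mul]

omit hX in
/-- An asymptotic mean along a subsequence. -/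
noncomputable def mean (hX : TransGraph X) (ψ : ℕ → ℕ) (f : V → ℝ) (x : V) : ℝ :=
  (Filter.hyperfilter ℕ : Filter ℕ).limUnder fun j => hX.ces (ψ j + 1) f x

theorem tendsto_mean (ψ : ℕ → ℕ) {f : V → ℝ} {C : ℝ} (h : ∀ y, |f y| ≤ C) (x : V) :
    Filter.Tendsto (fun j => hX.ces (ψ j + 1) f x) (Filter.hyperfilter ℕ : Filter ℕ)
      (nhds (hX.mean ψ f x)) := by
  obtain ⟨l, hl⟩ := exists_hyperlim fun j => hX.abs_ces_le h (ψ j).succ_ne_zero x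
  exact tendsto_nhds_limUnder ⟨l, hl⟩

theorem avg_mean {ψ : ℕ → ℕ} (hψ : StrictMono ψ) {f : V → ℝ} {C : ℝ} (h : ∀ y, |f y| ≤ C) :
    hX.avg (hX.mean ψ f) = hX.mean ψ f := by
  ext x
  have t1 : Filter.Tendsto (fun j => hX.avg (hX.ces (ψ j + 1) f) x)
      (Filter.hyperfilter ℕ : Filter ℕ) (nhds (hX.avg (hX.mean ψ f) x)) := by
    simp only [avg_apply]
    exact (tendsto_finsetSum _ fun y _ => hX.tendsto_mean ψ h y).div_const _
  have t2 := t1.sub (hX.tendsto_mean ψ h x)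
  have t3 : Filter.Tendsto (fun j => hX.avg (hX.ces (ψ j + 1) f) x - hX.ces (ψ j + 1) f x)
      (Filter.hyperfilter ℕ : Filter ℕ) (nhds 0) := by
    have hC : 0 ≤ C := (abs_nonneg _).trans (h x)
    refine squeeze_zero_norm (a := fun j : ℕ => 2 * C * (1 / ((j : ℝ) + 1))) (fun j => ?_) ?_
    · rw [avg_ces_sub, Real.norm_eq_abs, abs_div, Nat.abs_cast, ← div_eq_mul_one_div]
      have h1 : |(hX.avg ^ (ψ j + 1)) f x - f x| ≤ 2 * C := by
        refine (abs_sub _ _).trans ?_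
        have := hX.abs_avg_pow_le h (ψ j + 1) x
        linarith [h x]
      have h2 : (j : ℝ) + 1 ≤ (ψ j + 1 : ℕ) := by exact_mod_cast Nat.succ_le_succ (hψ.id_le j)
      exact div_le_div₀ (by positivity) h1 (by positivity) h2
    · have := (tendsto_one_div_add_atTop_nhds_zero_nat (𝕜 := ℝ)).const_mul (2 * C)
      rw [mul_zero] at this
      exact this.mono_left Nat.hyperfilter_le_atTop
  linarith [tendsto_nhds_unique t2 t3]

theorem abs_mean_le (ψ : ℕ → ℕ) {f : V → ℝ} {C : ℝ} (h : ∀ y, |f y| ≤ C) (x : V) :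
    |hX.mean ψ f x| ≤ C :=
  le_of_tendsto' (hX.tendsto_mean ψ h x).abs fun j => hX.abs_ces_le h (ψ j).succ_ne_zero x

theorem mean_add (ψ : ℕ → ℕ) {f g : V → ℝ} {C D : ℝ} (hf : ∀ y, |f y| ≤ C) (hg : ∀ y, |g y| ≤ D)
    (x : V) : hX.mean ψ (f + g) x = hX.mean ψ f x + hX.mean ψ g x := by
  refine Filter.Tendsto.limUnder_eq ?_
  simp only [map_add, Pi.add_apply]
  exact (hX.tendsto_mean ψ hf x).add (hX.tendsto_mean ψ hg x)

theorem mean_smul (ψ : ℕ → ℕ) {f : V → ℝ} {C : ℝ} (hf : ∀ y, |f y| ≤ C) (c : ℝ) (x : V) :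
    hX.mean ψ (c • f) x = c * hX.mean ψ f x := by
  refine Filter.Tendsto.limUnder_eq ?_
  simp only [map_smul, Pi.smul_apply, smul_eq_mul]
  exact (hX.tendsto_mean ψ hf x).const_mul c

theorem mean_comp_iso (ψ : ℕ → ℕ) (φ : X ≃g X) (f : V → ℝ) (x : V) :
    hX.mean ψ (f ∘ φ) x = hX.mean ψ f (φ x) := by
  simp only [mean, ces_comp_iso]

theorem abs_gam_le {f g : V → ℝ} {L M : ℝ} (hf : ∀ x y, X.Adj x y → |f x - f y| ≤ L)
    (hg : ∀ x y, X.Adj x y → |g x - g y| ≤ M) (x : V) : |hX.gam f g x| ≤ |L| * |M| := by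
  have hv := hX.vol_pos' 1
  rw [gam, abs_div, Nat.abs_cast, div_le_iff₀ hv]
  refine (Finset.abs_sum_le_sum_abs _ _).trans ?_
  refine (Finset.sum_le_card_nsmul _ _ (|L| * |M|) fun y hy => ?_).trans (le_of_eq ?_)
  · rw [abs_mul]
    exact mul_le_mul (hX.abs_sub_le_of_mem_ball hf hy) (hX.abs_sub_le_of_mem_ball hg hy)
      (abs_nonneg _) (abs_nonneg _)
  · rw [hX.card_ball, nsmul_eq_mul, mul_comm]

theorem gam_comm (f g : V → ℝ) : hX.gam f g = hX.gam g f := by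
  ext x
  simp only [gam, mul_comm]

theorem gam_add_left (f g h : V → ℝ) : hX.gam (f + g) h = hX.gam f h + hX.gam g h := by
  ext x
  simp only [gam, Pi.add_apply, ← add_div, ← Finset.sum_add_distrib]
  congr 2
  ext y
  ring

theorem gam_smul_left (c : ℝ) (f g : V → ℝ) : hX.gam (c • f) g = c • hX.gam f g := by
  ext x
  simp only [gam, Pi.smul_apply, smul_eq_mul, ← mul_div_assoc, Finset.mul_sum]
  congr 2
  ext y
  ring

theorem gam_eq_comp {f g : V → ℝ} (φ : X ≃g X) (h : ∀ x y, g x - g y = f (φ x) - f (φ y)) :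
    hX.gam g g = hX.gam f f ∘ φ := by
  ext x
  simp only [gam, Function.comp, hX.sum_ball_iso, h]

omit hX in
/-- Lipschitz harmonic functions vanishing at the base point. -/
noncomputable def lipHarm (hX : TransGraph X) : Submodule ℝ (V → ℝ) where
  carrier := {f | hX.avg f = f ∧ f hX.base = 0 ∧ ∃ L, ∀ x y, X.Adj x y → |f x - f y| ≤ L}
  zero_mem' := ⟨map_zero _, rfl, 0, fun x y _ => by simp⟩
  add_mem' := by
    rintro f g ⟨hf, hf0, L, hL⟩ ⟨hg, hg0, M, hM⟩
    refine ⟨by rw [map_add, hf, hg], by simp [hf0, hg0], L + M, fun x y h => ?_⟩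
    rw [Pi.add_apply, Pi.add_apply, add_sub_add_comm]
    exact (abs_add_le _ _).trans (add_le_add (hL x y h) (hM x y h))
  smul_mem' := by
    rintro c f ⟨hf, hf0, L, hL⟩
    refine ⟨by rw [map_smul, hf], by simp [hf0], |c| * L, fun x y h => ?_⟩
    rw [Pi.smul_apply, Pi.smul_apply, ← smul_sub, smul_eq_mul, abs_mul]
    exact mul_le_mul_of_nonneg_left (hL x y h) (abs_nonneg c)

theorem exists_gam_bound (f g : hX.lipHarm) : ∃ C, ∀ x, |hX.gam f g x| ≤ C := by
  obtain ⟨L, hL⟩ := f.2.2.2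
  obtain ⟨M, hM⟩ := g.2.2.2
  exact ⟨_, hX.abs_gam_le hL hM⟩

theorem exists_form {s : ℕ} (hB : Bisects X s) (hnh : ¬ GromovHyperbolic X) :
    ∃ (C : ℝ) (B : hX.lipHarm →ₗ[ℝ] hX.lipHarm →ₗ[ℝ] ℝ), 0 < C ∧
      (∀ f g, B f g = B g f) ∧
      (∀ (f : hX.lipHarm) (x : V), ∀ y ∈ hX.ball x 1,
        ((f : V → ℝ) y - (f : V → ℝ) x) ^ 2 ≤ C * B f f) ∧
      (∀ (n : ℕ) (F : Fin n → hX.lipHarm) (c : ℝ),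
        (∀ x, ∀ y ∈ hX.ball x 1, ∑ i, ((F i : V → ℝ) y - (F i : V → ℝ) x) ^ 2 ≤ c) →
          ∑ i, B (F i) (F i) ≤ c) ∧
      ∀ (φ : X ≃g X) (f g : hX.lipHarm), (∀ x y, (g : V → ℝ) x - (g : V → ℝ) y =
        (f : V → ℝ) (φ x) - (f : V → ℝ) (φ y)) → B g g = B f f := by
  obtain ⟨ψ, hψ, hE⟩ := Filter.extraction_of_frequently_atTop (hX.frequently_ent_le hB hnh)
  have hbd := hX.exists_gam_bound
  have hconst : ∀ (f g : hX.lipHarm) x, hX.mean ψ (hX.gam f g) x = hX.mean ψ (hX.gam f g) hX.base := by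
    intro f g x
    obtain ⟨C, hC⟩ := hbd f g
    exact hX.eq_of_bounded_harmonic hB hnh (hX.avg_mean hψ hC) (hX.abs_mean_le ψ hC) _ _
  have hadd : ∀ f g h : hX.lipHarm, hX.mean ψ (hX.gam (f + g : hX.lipHarm) h) hX.base =
      hX.mean ψ (hX.gam f h) hX.base + hX.mean ψ (hX.gam g h) hX.base := by
    intro f g h
    obtain ⟨C, hC⟩ := hbd f h
    obtain ⟨D, hD⟩ := hbd g h
    rw [Submodule.coe_add, gam_add_left, hX.mean_add ψ hC hD]
  have hsmul : ∀ (c : ℝ) (f h : hX.lipHarm), hX.mean ψ (hX.gam (c • f : hX.lipHarm) h) hX.base =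
      c * hX.mean ψ (hX.gam f h) hX.base := by
    intro c f h
    obtain ⟨C, hC⟩ := hbd f h
    rw [Submodule.coe_smul, gam_smul_left, hX.mean_smul ψ hC]
  refine ⟨6 * hX.vol 1 * (hX.vol 1 + 1), LinearMap.mk₂ ℝ
    (fun f g : hX.lipHarm => hX.mean ψ (hX.gam f g) hX.base) hadd hsmul
    (fun f g h => ?_) (fun c f g => ?_), ?_, fun f g => ?_, fun f x y hy => ?_, fun n F c hF => ?_,
    fun φ f g h => ?_⟩
  · simp only [hX.gam_comm f]
    exact hadd g h f
  · simp only [hX.gam_comm f]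
    exact hsmul c g f
  · have hv := hX.vol_pos' 1
    positivity
  · simp only [LinearMap.mk₂_apply]
    rw [gam_comm]
  · rw [LinearMap.mk₂_apply, ← hconst f f x]
    obtain ⟨C, hC⟩ := hbd f f
    refine ge_of_tendsto' ((hX.tendsto_mean ψ hC x).const_mul _) fun j => ?_
    rw [ces_apply]
    exact hX.sq_sub_le_of_ent_le (hE j) f.2.1 hy
  · simp only [LinearMap.mk₂_apply]
    have t : Filter.Tendsto (fun j => ∑ i, hX.ces (ψ j + 1) (hX.gam (F i) (F i)) hX.base)
        (Filter.hyperfilter ℕ : Filter ℕ)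
        (nhds (∑ i, hX.mean ψ (hX.gam (F i) (F i)) hX.base)) := by
      refine tendsto_finsetSum _ fun i _ => ?_
      obtain ⟨C, hC⟩ := hbd (F i) (F i)
      exact hX.tendsto_mean ψ hC _
    refine le_of_tendsto' t fun j => ?_
    rw [← hX.ces_const (ψ j).succ_ne_zero c hX.base, ← Finset.sum_apply, ← map_sum]
    refine hX.ces_mono (fun x => ?_) _ _
    have hv := hX.vol_pos' 1
    simp only [Finset.sum_apply, gam]
    rw [← Finset.sum_div, Finset.sum_comm, div_le_iff₀ hv, mul_comm, ← hX.card_ball x,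
      ← nsmul_eq_mul]
    refine Finset.sum_le_card_nsmul _ _ _ fun y hy => ?_
    simpa only [sq] using hF x y hy
  · simp only [LinearMap.mk₂_apply]
    rw [hX.gam_eq_comp φ h, mean_comp_iso, hconst]

end TransGraph

/-! ### Finite dimension of the space of Lipschitz harmonic functions -/

theorem exists_orthonormal_basis_of_trace_bound {E : Type*} [AddCommGroup E] [Module ℝ E]
    (B : E →ₗ[ℝ] E →ₗ[ℝ] ℝ) (hsymm : ∀ f g, B f g = B g f) (hpos : ∀ f, f ≠ 0 → 0 < B f f)
    (N : ℕ) (hN : ∀ (n : ℕ) (F : Fin n → E), (∀ i j, B (F i) (F j) = if i = j then 1 else 0) →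
      n ≤ N) :
    ∃ (n : ℕ) (b : Module.Basis (Fin n) ℝ E), ∀ i j, B (b i) (b j) = if i = j then 1 else 0 := by
  let core : InnerProductSpace.Core ℝ E :=
    { inner := fun f g => B f g
      conj_inner_symm := fun f g => hsymm g f
      re_inner_nonneg := fun f => by
        rcases eq_or_ne f 0 with rfl | h
        · simp
        · exact (hpos f h).le
      add_left := fun f g h => by simp
      smul_left := fun f g c => by simp
      definite := fun f h => by
        by_contra hf
        exact (hpos f hf).ne' h }
  let _ : NormedAddCommGroup E := core.toNormedAddCommGroup
  let _ : InnerProductSpace ℝ E := InnerProductSpace.ofCore core.toCore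
  have hinner : ∀ f g : E, inner ℝ f g = B f g := fun _ _ => rfl
  have hon : ∀ (n : ℕ) (F : Fin n → E), Orthonormal ℝ F → n ≤ N := by
    intro n F hF
    refine hN n F fun i j => ?_
    rw [← hinner]
    exact orthonormal_iff_ite.1 hF i j
  have hfd : FiniteDimensional ℝ E := by
    by_contra hinf
    have hr : ((N + 1 : ℕ) : Cardinal) ≤ Module.rank ℝ E := by
      refine Cardinal.natCast_lt_aleph0.le.trans ?_
      by_contra hlt
      exact hinf (Module.rank_lt_aleph0_iff.1 (not_le.1 hlt))
    obtain ⟨t, ht, hli⟩ := exists_finset_linearIndependent_of_le_rank hr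
    have hfin : Module.finrank ℝ (Submodule.span ℝ (t : Set E)) = N + 1 := by
      rw [finrank_span_finset_eq_card hli, ht]
    let u := stdOrthonormalBasis ℝ (Submodule.span ℝ (t : Set E))
    have h1 := hon _ (fun i => (u i : E))
      (u.orthonormal.comp_linearIsometry (Submodule.subtypeₗᵢ _))
    omega
  let u := stdOrthonormalBasis ℝ E
  refine ⟨_, u.toBasis, fun i j => ?_⟩
  rw [← hinner, u.coe_toBasis]
  exact orthonormal_iff_ite.1 u.orthonormal i j

namespace TransGraph

variable {V : Type*} {X : SimpleGraph V} (hX : TransGraph X)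
include hX

theorem eq_zero_of_harmonic_nonpos {f : V → ℝ} (hf : hX.avg f = f) {x₀ : V} (h0 : f x₀ = 0)
    (hle : ∀ x, f x ≤ 0) (x : V) : f x = 0 := by
  have hv := hX.vol_pos' 1
  obtain ⟨n, hn⟩ : ∃ n, X.dist x x₀ = n := ⟨_, rfl⟩
  induction n generalizing x with
  | zero => rw [hX.dist_eq_zero.1 hn, h0]
  | succ n ih =>
    obtain ⟨w, hw, hd⟩ := hX.exists_adj_dist x x₀ hn
    have h1 : hX.avg f w = 0 := by rw [hf, ih w hd]
    rw [avg_apply, div_eq_zero_iff, or_iff_left hv.ne'] at h1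
    refine (Finset.sum_eq_zero_iff_of_nonpos fun y _ => hle y).1 h1 x ?_
    rw [mem_ball, hX.dist_adj hw]

theorem exists_basis {s : ℕ} (hB : Bisects X s) (hnh : ¬ GromovHyperbolic X) :
    ∃ (B : hX.lipHarm →ₗ[ℝ] hX.lipHarm →ₗ[ℝ] ℝ) (n : ℕ) (b : Module.Basis (Fin n) ℝ hX.lipHarm),
      (∀ i j, B (b i) (b j) = if i = j then 1 else 0) ∧
      ∀ (φ : X ≃g X) (f g : hX.lipHarm), (∀ x y, (g : V → ℝ) x - (g : V → ℝ) y =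
        (f : V → ℝ) (φ x) - (f : V → ℝ) (φ y)) → B g g = B f f := by
  obtain ⟨C, B, hC, hsymm, hgrad, htr, hinv⟩ := hX.exists_form hB hnh
  have hv : ∀ f : hX.lipHarm, f ≠ 0 → ∃ x, ∃ y ∈ hX.ball x 1, (f : V → ℝ) y ≠ (f : V → ℝ) x := by
    intro f hf
    by_contra! h
    refine hf (Subtype.ext (funext fun x => ?_))
    rw [hX.avg_eq_self_of_forall_eq h x hX.base]
    exact f.2.2.1
  have hpos : ∀ f : hX.lipHarm, f ≠ 0 → 0 < B f f := by
    intro f hf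
    obtain ⟨x, y, hy, hne⟩ := hv f hf
    have := sub_ne_zero.2 hne
    exact pos_of_mul_pos_right (lt_of_lt_of_le (by positivity) (hgrad f x y hy)) hC.le
  obtain ⟨N, hN⟩ := exists_nat_ge C
  obtain ⟨n, b, hb⟩ := exists_orthonormal_basis_of_trace_bound B hsymm hpos N fun n F hF => by
    have h1 := htr n F C fun x y hy => by
      set t : Fin n → ℝ := fun i => (F i : V → ℝ) y - (F i : V → ℝ) x with ht
      have h2 := hgrad (∑ i, t i • F i) x y hy
      have h3 : B (∑ i, t i • F i) (∑ i, t i • F i) = ∑ i, t i ^ 2 := by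
        simp [map_sum, hF, sq]
      have h4 : ((∑ i, t i • F i : hX.lipHarm) : V → ℝ) y -
          ((∑ i, t i • F i : hX.lipHarm) : V → ℝ) x = ∑ i, t i ^ 2 := by
        simp [Finset.sum_apply, ← Finset.sum_sub_distrib, ← mul_sub, sq, ht]
      rw [h3, h4] at h2
      change ∑ i, t i ^ 2 ≤ C
      by_contra hlt
      rw [not_le] at hlt
      nlinarith
    simp only [hF, if_true, Finset.sum_const, Finset.card_univ, Fintype.card_fin, nsmul_eq_mul,
      mul_one] at h1
    exact_mod_cast h1.trans hN
  exact ⟨B, n, b, hb, hinv⟩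

theorem exists_uniform_ascent {s : ℕ} (hB : Bisects X s) (hnh : ¬ GromovHyperbolic X) :
    ∃ (n : ℕ) (b : Module.Basis (Fin n) ℝ hX.lipHarm) (n0 : ℕ) (c0 : ℝ), 0 < c0 ∧
      (∀ (φ : X ≃g X) (c : Fin n → ℝ), ∑ i, c i ^ 2 = 1 → ∃ c' : Fin n → ℝ, ∑ i, c' i ^ 2 = 1 ∧
        ∀ x, ∑ i, c i * (b i : V → ℝ) (φ x) - ∑ i, c i * (b i : V → ℝ) (φ hX.base) =
          ∑ i, c' i * (b i : V → ℝ) x) ∧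
      ∀ c : Fin n → ℝ, ∑ i, c i ^ 2 = 1 → ∀ x, ∃ x', X.dist x' x ≤ n0 ∧
        c0 ≤ ∑ i, c i * ((b i : V → ℝ) x' - (b i : V → ℝ) x) := by
  obtain ⟨B, n, b, hb, hinv⟩ := hX.exists_basis hB hnh
  have hBsum : ∀ c : Fin n → ℝ, B (∑ i, c i • b i) (∑ i, c i • b i) = ∑ i, c i ^ 2 := by
    intro c
    simp [map_sum, hb, sq]
  have hcoe : ∀ (c : Fin n → ℝ) x, ((∑ i, c i • b i : hX.lipHarm) : V → ℝ) x =
      ∑ i, c i * (b i : V → ℝ) x := by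
    intro c x
    simp [Finset.sum_apply]
  have hφ : ∀ (φ : X ≃g X) (c : Fin n → ℝ), ∑ i, c i ^ 2 = 1 → ∃ c' : Fin n → ℝ,
      ∑ i, c' i ^ 2 = 1 ∧
      ∀ x, ∑ i, c i * (b i : V → ℝ) (φ x) - ∑ i, c i * (b i : V → ℝ) (φ hX.base) =
        ∑ i, c' i * (b i : V → ℝ) x := by
    intro φ c hc
    set h : hX.lipHarm := ∑ i, c i • b i with hh
    have hmem : ((h : V → ℝ) ∘ φ - fun _ => (h : V → ℝ) (φ hX.base)) ∈ hX.lipHarm := by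
      obtain ⟨h1, h2, L, hL⟩ := h.2
      refine ⟨?_, by simp, L, fun x y hxy => ?_⟩
      · rw [map_sub, avg_comp_iso, avg_const, h1]
      · simpa using hL _ _ (φ.map_adj_iff.2 hxy)
    set g : hX.lipHarm := ⟨_, hmem⟩ with hg
    have hBg : B g g = B h h := hinv φ h g fun x y => by simp [hg]
    refine ⟨fun i => b.repr g i, ?_, fun x => ?_⟩
    · rw [← hBsum, b.sum_repr, hBg, hBsum, hc]
    · rw [← hcoe, ← hcoe, ← hcoe (fun i => b.repr g i), b.sum_repr]
      rfl
  set K : Set (Fin n → ℝ) := {c | ∑ i, c i ^ 2 = 1} with hK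
  have hKc : IsCompact K := by
    refine (isCompact_univ_pi fun _ => isCompact_Icc (a := (-1 : ℝ)) (b := 1)).of_isClosed_subset
      (isClosed_eq (by fun_prop) continuous_const) fun c hc i _ => ?_
    have h1 : c i ^ 2 ≤ ∑ i, c i ^ 2 :=
      Finset.single_le_sum (f := fun i => c i ^ 2) (fun i _ => sq_nonneg _) (Finset.mem_univ i)
    have h2 : ∑ i, c i ^ 2 = 1 := hc
    rw [h2] at h1
    exact abs_le.1 ((sq_le_one_iff_abs_le_one _).1 h1)
  set U : ℕ → Set (Fin n → ℝ) := fun m =>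
    ⋃ x ∈ hX.ball hX.base m, {c | 1 / ((m : ℝ) + 1) < ∑ i, c i * (b i : V → ℝ) x} with hU
  obtain ⟨m, hm⟩ := hKc.elim_directed_cover U
    (fun m => isOpen_biUnion fun x _ => isOpen_lt continuous_const (by fun_prop)) (by
      intro c hc
      by_contra hnot
      have hle : ∀ x, ((∑ i, c i • b i : hX.lipHarm) : V → ℝ) x ≤ 0 := by
        intro x
        by_contra hlt
        rw [not_le, hcoe] at hlt
        obtain ⟨k, hk⟩ := exists_nat_one_div_lt hlt
        refine hnot (Set.mem_iUnion.2 ⟨max k (X.dist x hX.base), Set.mem_biUnion (x := x) ?_ ?_⟩)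
        · simp
        · refine lt_of_le_of_lt ?_ hk
          have : (k : ℝ) ≤ (max k (X.dist x hX.base) : ℕ) := by exact_mod_cast le_max_left _ _
          gcongr
      have h0 : (∑ i, c i • b i : hX.lipHarm) = 0 := Subtype.ext (funext fun x =>
        hX.eq_zero_of_harmonic_nonpos (∑ i, c i • b i : hX.lipHarm).2.1
          (∑ i, c i • b i : hX.lipHarm).2.2.1 hle x)
      have h1 := hBsum c
      rw [h0, map_zero] at h1
      exact zero_ne_one (h1.trans hc))
    (by
      refine Monotone.directed_le fun k l hkl => ?_
      refine Set.iUnion₂_subset fun x hx c hc => ?_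
      rw [mem_ball] at hx
      refine Set.mem_biUnion (x := x) (by
        change x ∈ hX.ball hX.base l
        rw [mem_ball]
        omega) ?_
      have hc' : 1 / ((k : ℝ) + 1) < ∑ i, c i * (b i : V → ℝ) x := hc
      refine lt_of_le_of_lt ?_ hc'
      have : (k : ℝ) ≤ l := by exact_mod_cast hkl
      gcongr)
  refine ⟨n, b, m, 1 / ((m : ℝ) + 1), by positivity, hφ, fun c hc x => ?_⟩
  obtain ⟨φ, rfl⟩ := hX.trans hX.base x
  obtain ⟨c', hc', hcc⟩ := hφ φ c hc
  obtain ⟨y, hy, hyc⟩ := Set.mem_iUnion₂.1 (hm hc')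
  refine ⟨φ y, ?_, ?_⟩
  · rw [hX.dist_iso]
    exact hX.mem_ball.1 hy
  · have h1 := hcc y
    have h2 : 1 / ((m : ℝ) + 1) < ∑ i, c' i * (b i : V → ℝ) y := hyc
    simp only [mul_sub, Finset.sum_sub_distrib]
    linarith

end TransGraph

/-! ### Packing balls using harmonic coordinates -/

theorem one_le_abs_natCast_sub {a b : ℕ} (h : a ≠ b) : 1 ≤ |(a : ℝ) - b| := by
  rcases Nat.lt_or_gt_of_ne h with h | h
  · rw [abs_sub_comm]
    have : (a : ℝ) + 1 ≤ b := by exact_mod_cast h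
    exact (by linarith : (1 : ℝ) ≤ b - a).trans (le_abs_self _)
  · have : (b : ℝ) + 1 ≤ a := by exact_mod_cast h
    exact (by linarith : (1 : ℝ) ≤ a - b).trans (le_abs_self _)

namespace TransGraph

variable {V : Type*} {X : SimpleGraph V} (hX : TransGraph X)
include hX

theorem exists_near_of_ascent {F : V → ℂ} {L : ℝ} (hL : ∀ x y, X.Adj x y → ‖F x - F y‖ ≤ L)
    (hL0 : 0 ≤ L) {n0 : ℕ} {c0 : ℝ} (hc0 : 0 < c0)
    (hasc : ∀ u : ℂ, ‖u‖ = 1 → ∀ x, ∃ x', X.dist x' x ≤ n0 ∧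
      c0 ≤ u.re * (F x' - F x).re + u.im * (F x' - F x).im) (q : ℂ) (k : ℕ) (x : V)
    (h : ‖q - F x‖ ≤ (L * n0) ^ 2 / c0 + c0 + k * (c0 / 2)) :
    ∃ x', X.dist x' x ≤ k * n0 ∧ ‖q - F x'‖ ≤ (L * n0) ^ 2 / c0 + c0 := by
  induction k generalizing x with
  | zero => exact ⟨x, by simp, by simpa using h⟩
  | succ k ih =>
    by_cases hx : ‖q - F x‖ ≤ (L * n0) ^ 2 / c0 + c0
    · exact ⟨x, by simp, hx⟩
    rw [not_le] at hx
    set D := q - F x with hD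
    have hquot : 0 ≤ (L * n0) ^ 2 / c0 := by positivity
    have hDpos : 0 < ‖D‖ := by linarith
    obtain ⟨x₁, hx₁, hc⟩ := hasc (D / ‖D‖) (by
      rw [norm_div, Complex.norm_real, norm_norm, div_self hDpos.ne']) x
    set w := F x₁ - F x with hw
    have hwn : ‖w‖ ≤ L * n0 := (hX.norm_sub_le_mul_dist hL x₁ x).trans (by
      have : (X.dist x₁ x : ℝ) ≤ n0 := by exact_mod_cast hx₁
      gcongr)
    rw [Complex.div_ofReal_re, Complex.div_ofReal_im, div_mul_eq_mul_div, div_mul_eq_mul_div,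
      ← add_div, le_div_iff₀ hDpos] at hc
    have h1 : ‖D - w‖ ^ 2 = ‖D‖ ^ 2 - 2 * (D.re * w.re + D.im * w.im) + ‖w‖ ^ 2 := by
      simp only [← Complex.normSq_eq_norm_sq, Complex.normSq_apply, Complex.sub_re,
        Complex.sub_im]
      ring
    have h2 : (L * n0) ^ 2 + c0 * c0 ≤ c0 * ‖D‖ := by
      have := mul_le_mul_of_nonneg_left hx.le hc0.le
      rw [mul_add, mul_div_cancel₀ _ hc0.ne'] at this
      exact this
    have h3 : ‖w‖ ^ 2 ≤ (L * n0) ^ 2 := pow_le_pow_left₀ (norm_nonneg _) hwn 2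
    have h4 : ‖D - w‖ ≤ ‖D‖ - c0 / 2 := by
      refine abs_le_of_sq_le_sq' ?_ (by linarith) |>.2
      nlinarith [sq_nonneg c0]
    have h5 : q - F x₁ = D - w := by rw [hD, hw]; ring
    obtain ⟨x', hx', hq⟩ := ih x₁ (by
      rw [h5]
      push_cast at h
      linarith)
    refine ⟨x', ?_, hq⟩
    have := hX.tri x' x₁ x
    rw [add_one_mul]
    omega

theorem pack_of_ascent {F : V → ℂ} {L : ℝ} (hL : ∀ x y, X.Adj x y → ‖F x - F y‖ ≤ L)
    (hL0 : 0 ≤ L) {n0 : ℕ} {c0 : ℝ} (hc0 : 0 < c0)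
    (hasc : ∀ u : ℂ, ‖u‖ = 1 → ∀ x, ∃ x', X.dist x' x ≤ n0 ∧
      c0 ≤ u.re * (F x' - F x).re + u.im * (F x' - F x).im) :
    ∃ C : ℕ, 1 ≤ C ∧ ∀ m, 1 ≤ m → ∀ I, I ^ 2 * hX.vol m ≤ hX.vol (C * m * (I + 1)) := by
  set R1 : ℝ := (L * n0) ^ 2 / c0 + c0 with hR1
  have hR1p : 0 < R1 := by positivity
  set S : ℝ := 2 * L + 2 * R1 + 1 with hS
  have hSp : 0 < S := by positivity
  obtain ⟨K, hK⟩ := exists_nat_ge (2 * S / (c0 / 2))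
  rw [div_le_iff₀ (by positivity)] at hK
  refine ⟨K * n0 + 1, by omega, fun m hm I => ?_⟩
  have hm' : (1 : ℝ) ≤ m := by exact_mod_cast hm
  have hex : ∀ p : ℕ × ℕ, ∃ x, p.1 < I → p.2 < I → X.dist x hX.base ≤ K * m * I * n0 ∧
      ‖F hX.base + (S * m : ℝ) * (⟨p.1, p.2⟩ : ℂ) - F x‖ ≤ R1 := by
    intro p
    by_cases hp : p.1 < I ∧ p.2 < I
    · obtain ⟨x, h1, h2⟩ := hX.exists_near_of_ascent hL hL0 hc0 hasc
        (F hX.base + (S * m : ℝ) * (⟨p.1, p.2⟩ : ℂ)) (K * m * I) hX.base (by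
          rw [add_sub_cancel_left, norm_mul, Complex.norm_real, Real.norm_of_nonneg (by positivity)]
          have h1 : ‖(⟨p.1, p.2⟩ : ℂ)‖ ≤ 2 * I := by
            refine (Complex.norm_le_abs_re_add_abs_im _).trans ?_
            have h1 : (p.1 : ℝ) ≤ I := by exact_mod_cast hp.1.le
            have h2 : (p.2 : ℝ) ≤ I := by exact_mod_cast hp.2.le
            simp only [Nat.abs_cast]
            linarith
          have h2 : S * m * ‖(⟨p.1, p.2⟩ : ℂ)‖ ≤ S * m * (2 * I) := by gcongr
          have h3 : 2 * S * (m * I) ≤ K * (c0 / 2) * (m * I) := by gcongr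
          push_cast
          linarith)
      exact ⟨x, fun _ _ => ⟨h1, h2⟩⟩
    · exact ⟨hX.base, fun h1 h2 => absurd ⟨h1, h2⟩ hp⟩
  choose x hx using hex
  have hcard := hX.card_mul_vol_le (Finset.range I ×ˢ Finset.range I) x (r := m)
    (R := (K * n0 + 1) * m * (I + 1)) hX.base ?_ ?_
  · rwa [Finset.card_product, Finset.card_range, ← sq] at hcard
  · intro p hp p' hp' hne
    rw [Finset.mem_product, Finset.mem_range, Finset.mem_range] at hp hp'
    obtain ⟨-, h1⟩ := hx p hp.1 hp.2
    obtain ⟨-, h2⟩ := hx p' hp'.1 hp'.2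
    by_contra hle
    rw [not_lt] at hle
    have h3 : ‖F (x p) - F (x p')‖ ≤ L * (2 * m) :=
      (hX.norm_sub_le_mul_dist hL (x p) (x p')).trans (by
        have : (X.dist (x p) (x p') : ℝ) ≤ 2 * m := by exact_mod_cast hle
        gcongr)
    have h4 : 1 ≤ ‖(⟨p.1, p.2⟩ : ℂ) - (⟨p'.1, p'.2⟩ : ℂ)‖ := by
      by_cases h : p.1 = p'.1
      · have h' : p.2 ≠ p'.2 := fun h' => hne (Prod.ext h h')
        refine le_trans ?_ (Complex.abs_im_le_norm _)
        exact one_le_abs_natCast_sub h'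
      · refine le_trans ?_ (Complex.abs_re_le_norm _)
        exact one_le_abs_natCast_sub h
    have h5 : S * m ≤ ‖((S * m : ℝ) : ℂ) * ((⟨p.1, p.2⟩ : ℂ) - (⟨p'.1, p'.2⟩ : ℂ))‖ := by
      rw [norm_mul, Complex.norm_real, Real.norm_of_nonneg (by positivity)]
      exact le_mul_of_one_le_right (by positivity) h4
    have h6 : ((S * m : ℝ) : ℂ) * ((⟨p.1, p.2⟩ : ℂ) - (⟨p'.1, p'.2⟩ : ℂ)) =
        (F hX.base + (S * m : ℝ) * (⟨p.1, p.2⟩ : ℂ) - F (x p)) -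
        (F hX.base + (S * m : ℝ) * (⟨p'.1, p'.2⟩ : ℂ) - F (x p')) + (F (x p) - F (x p')) := by
      ring
    rw [h6] at h5
    have h7 := h5.trans ((norm_add_le _ _).trans (add_le_add_left (norm_sub_le _ _) _))
    nlinarith
  · intro p hp
    rw [Finset.mem_product, Finset.mem_range, Finset.mem_range] at hp
    have h1 := (hx p hp.1 hp.2).1
    nlinarith [Nat.zero_le (K * n0 * m)]

omit hX in
theorem apply_zpow_of_translation {e : V → ℝ} {g : X ≃g X} {T : ℝ} (hg : ∀ x, e (g x) = e x + T)
    (j : ℤ) (x : V) : e ((g ^ j) x) = e x + j * T := by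
  have hinv : ∀ x, e (g⁻¹ x) = e x - T := by
    intro x
    have := hg (g⁻¹ x)
    rw [RelIso.apply_inv_self] at this
    linarith
  induction j generalizing x with
  | zero => simp
  | succ n ih =>
    rw [zpow_add_one, RelIso.mul_apply, ih, hg]
    push_cast
    ring
  | pred n ih =>
    rw [zpow_sub_one, RelIso.mul_apply, ih, hinv]
    push_cast
    ring

theorem exists_far_of_translation {s : ℕ} (hB : Bisects X s) {e : V → ℝ} {L : ℝ}
    (hL : ∀ x y, X.Adj x y → |e x - e y| ≤ L) (hL0 : 0 < L) {g : X ≃g X} {T : ℝ} (hT : 0 < T)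
    (hg : ∀ x, e (g x) = e x + T) (n : ℕ) :
    ∃ y, X.dist y hX.base ≤ n + X.dist hX.base (g hX.base) ∧
      ∀ j : ℤ, n ≤ X.dist y ((g ^ j) hX.base) := by
  obtain ⟨γ, hγ0, hγl, hγ, hgeo⟩ := hX.exists_seg hX.base (g hX.base)
  set l : ℤ := ((X.dist hX.base (g hX.base) : ℕ) : ℤ) with hl
  have hlpos : 0 < l := by
    rcases (Int.natCast_nonneg (X.dist hX.base (g hX.base))).eq_or_lt with h | h
    · exfalso
      have h1 := hX.dist_eq_zero.1 (Int.natCast_eq_zero.1 h.symm)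
      have h2 := hg hX.base
      rw [← h1] at h2
      linarith
    · exact h
  set ρ : ℤ → V := fun t => (g ^ (t / l)) (γ (t % l)) with hρ
  have hadj : ∀ t, X.Adj (ρ t) (ρ (t + 1)) := by
    intro t
    have h0 := Int.emod_nonneg t hlpos.ne'
    have h1 := Int.emod_lt_of_pos t hlpos
    have h2 := Int.mul_ediv_add_emod t l
    have h3 := (g ^ (t / l)).map_adj_iff.2 (hγ (t % l) h0 h1)
    rcases (Int.add_one_le_iff.2 h1).eq_or_lt with h4 | h4
    · have h5 : t + 1 = l * (t / l + 1) := by linarith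
      have h6 : ρ (t + 1) = (g ^ (t / l)) (γ l) := by
        simp only [hρ]
        rw [h5, Int.mul_ediv_cancel_left _ hlpos.ne', Int.mul_emod_right, hγ0, zpow_add_one,
          RelIso.mul_apply, hγl]
      rw [h4] at h3
      rw [h6]
      exact h3
    · have h5 : t + 1 = (t % l + 1) + l * (t / l) := by linarith
      have h6 : ρ (t + 1) = (g ^ (t / l)) (γ (t % l + 1)) := by
        simp only [hρ]
        rw [h5, Int.add_mul_ediv_left _ _ hlpos.ne', Int.add_mul_emod_self_left,
          Int.ediv_eq_zero_of_lt (by omega) h4, Int.emod_eq_of_lt (by omega) h4, zero_add]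
      rw [h6]
      exact h3
  have hl' : (0 : ℝ) < l := by exact_mod_cast hlpos
  have hE : ∀ t : ℤ, |e (ρ t) - (e hX.base + t * (T / l))| ≤ L * l + T := by
    intro t
    have h0 := Int.emod_nonneg t hlpos.ne'
    have h1 := Int.emod_lt_of_pos t hlpos
    have h2 : ((l : ℝ)) * (t / l : ℤ) + (t % l : ℤ) = t := by exact_mod_cast Int.mul_ediv_add_emod t l
    have h0' : (0 : ℝ) ≤ (t % l : ℤ) := by exact_mod_cast h0
    have h1' : ((t % l : ℤ) : ℝ) ≤ l := by exact_mod_cast h1.le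
    have h3 : |e (γ (t % l)) - e (γ 0)| ≤ L * l := by
      refine (hX.norm_sub_le_mul_dist (U := e) hL _ _).trans ?_
      rw [hgeo _ _ h0 h1.le le_rfl hlpos.le, sub_zero]
      have : (((t % l).natAbs : ℕ) : ℝ) ≤ l := by
        rw [← Int.cast_natCast, Int.natAbs_of_nonneg h0]
        exact h1'
      gcongr
    have h4 : (t : ℝ) * (T / l) = (t / l : ℤ) * T + (t % l : ℤ) * (T / l) := by
      rw [← h2]
      field_simp
    have h5 : ((t % l : ℤ) : ℝ) * (T / l) ≤ T := by
      rw [mul_div_assoc', div_le_iff₀ hl', mul_comm]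
      gcongr
    have h6 : 0 ≤ ((t % l : ℤ) : ℝ) * (T / l) := by positivity
    have h7 : e (ρ t) = e (γ (t % l)) + (t / l : ℤ) * T := apply_zpow_of_translation hg _ _
    rw [hγ0, abs_le] at h3
    rw [h7, h4, abs_le]
    constructor <;> linarith
  have hQG : IsBiQuasiGeodesic X ρ := by
    refine ⟨max 1 (L * l / T), 2 * (L * l + T) / L, le_max_left _ _, by positivity, hadj,
      fun a b => ?_⟩
    have h1 := hX.norm_sub_le_mul_dist (U := e) hL (ρ a) (ρ b)
    have h2 := abs_le.1 (hE a)
    have h3 := abs_le.1 (hE b)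
    have h4 : |(a : ℝ) - b| * (T / l) - 2 * (L * l + T) ≤ L * X.dist (ρ a) (ρ b) := by
      rw [Real.norm_eq_abs] at h1
      have h5 := abs_le.1 h1
      have h6 : |(a : ℝ) - b| * (T / l) = |(a - b) * (T / l)| := by
        rw [abs_mul, abs_of_pos (div_pos hT hl')]
      rw [h6]
      rcases abs_cases (((a : ℝ) - b) * (T / l)) with ⟨h, -⟩ | ⟨h, -⟩ <;> rw [h] <;> linarith
    have h5 : |(a : ℝ) - b| / max 1 (L * l / T) ≤ |(a : ℝ) - b| / (L * l / T) :=
      div_le_div_of_nonneg_left (abs_nonneg _) (by positivity) (le_max_right _ _)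
    have h6 : |(a : ℝ) - b| / (L * l / T) - 2 * (L * l + T) / L =
        (|(a : ℝ) - b| * (T / l) - 2 * (L * l + T)) / L := by
      field_simp
    have h7 : (|(a : ℝ) - b| * (T / l) - 2 * (L * l + T)) / L ≤ X.dist (ρ a) (ρ b) := by
      rw [div_le_iff₀ hL0, mul_comm _ L]
      exact h4
    linarith
  obtain ⟨y, t₀, hy, hmin⟩ := hX.exists_at_dist hB hQG n
  have h0 := Int.emod_nonneg t₀ hlpos.ne'
  have h1 := Int.emod_lt_of_pos t₀ hlpos
  have hback : (g ^ (t₀ / l)) ((g ^ (-(t₀ / l))) y) = y := by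
    rw [← RelIso.mul_apply, ← zpow_add, add_neg_cancel, zpow_zero]
    rfl
  refine ⟨(g ^ (-(t₀ / l))) y, ?_, fun j => ?_⟩
  · rw [← hX.dist_iso (g ^ (t₀ / l)), hback]
    have h2 := hX.tri y (ρ t₀) ((g ^ (t₀ / l)) hX.base)
    have h3 : X.dist (ρ t₀) ((g ^ (t₀ / l)) hX.base) ≤ X.dist hX.base (g hX.base) := by
      rw [hρ, hX.dist_iso, ← hγ0, hgeo _ _ h0 h1.le le_rfl hlpos.le]
      rw [hγ0]
      omega
    omega
  · rw [← hX.dist_iso (g ^ (t₀ / l)), hback, ← RelIso.mul_apply, ← zpow_add]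
    have h2 : ρ (l * (t₀ / l + j)) = (g ^ (t₀ / l + j)) hX.base := by
      simp only [hρ]
      rw [Int.mul_ediv_cancel_left _ hlpos.ne', Int.mul_emod_right, hγ0]
    rw [← h2]
    exact hmin _

theorem dist_zpow_le (g : X ≃g X) (x : V) (n : ℕ) :
    X.dist ((g ^ (n : ℤ)) x) x ≤ n * X.dist x (g x) := by
  induction n with
  | zero => simp
  | succ n ih =>
    have h1 := hX.tri ((g ^ ((n + 1 : ℕ) : ℤ)) x) ((g ^ (n : ℤ)) x) x
    have h2 : X.dist ((g ^ ((n + 1 : ℕ) : ℤ)) x) ((g ^ (n : ℤ)) x) = X.dist x (g x) := by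
      rw [Nat.cast_succ, zpow_add_one, RelIso.mul_apply, hX.dist_iso, SimpleGraph.dist_comm]
    rw [add_one_mul]
    omega

theorem pack_of_translation {s : ℕ} (hB : Bisects X s) {e : V → ℝ} {L : ℝ}
    (hL : ∀ x y, X.Adj x y → |e x - e y| ≤ L) (hL0 : 0 < L) {g : X ≃g X} {T : ℝ} (hT : 0 < T)
    (hg : ∀ x, e (g x) = e x + T) :
    ∃ C : ℕ, 1 ≤ C ∧ ∀ m, 1 ≤ m → ∀ I, I ^ 2 * hX.vol m ≤ hX.vol (C * m * (I + 1)) := by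
  choose y hy hfar using fun n => hX.exists_far_of_translation hB hL hL0 hT hg n
  set l := X.dist hX.base (g hX.base) with hl
  obtain ⟨K, hK⟩ := exists_nat_gt (2 * L / T)
  rw [div_lt_iff₀ hT] at hK
  set N := l + 3 with hN
  refine ⟨N + l + K * l + 1, by omega, fun m hm I => ?_⟩
  have hcard := hX.card_mul_vol_le (Finset.range I ×ˢ Finset.range I)
    (fun p : ℕ × ℕ => (g ^ ((p.2 * K * m : ℕ) : ℤ)) (y (N * m * p.1))) (r := m)
    (R := (N + l + K * l + 1) * m * (I + 1)) hX.base ?_ ?_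
  · rwa [Finset.card_product, Finset.card_range, ← sq] at hcard
  · have hlt : ∀ p q : ℕ × ℕ, q.1 < p.1 → 2 * m <
        X.dist ((g ^ ((p.2 * K * m : ℕ) : ℤ)) (y (N * m * p.1)))
          ((g ^ ((q.2 * K * m : ℕ) : ℤ)) (y (N * m * q.1))) := by
      intro p q hpq
      have h1 := hX.tri ((g ^ ((p.2 * K * m : ℕ) : ℤ)) (y (N * m * p.1)))
        ((g ^ ((q.2 * K * m : ℕ) : ℤ)) (y (N * m * q.1))) ((g ^ ((q.2 * K * m : ℕ) : ℤ)) hX.base)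
      rw [hX.dist_iso (g ^ ((q.2 * K * m : ℕ) : ℤ))] at h1
      have h2 := hfar (N * m * p.1) (-((p.2 * K * m : ℕ) : ℤ) + ((q.2 * K * m : ℕ) : ℤ))
      rw [← hX.dist_iso (g ^ ((p.2 * K * m : ℕ) : ℤ)), ← RelIso.mul_apply, ← zpow_add,
        add_neg_cancel_left] at h2
      have h3 := hy (N * m * q.1)
      have h4 : N * m * q.1 + N * m ≤ N * m * p.1 := by
        rw [← mul_add_one]
        exact Nat.mul_le_mul_left _ hpq
      have h5 : l + 3 * m ≤ N * m := by
        rw [hN, add_mul]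
        exact Nat.add_le_add_right (Nat.le_mul_of_pos_right l hm) _
      omega
    intro p _ q _ hne
    rcases lt_trichotomy q.1 p.1 with h | h | h
    · exact hlt p q h
    · have hne2 : p.2 ≠ q.2 := fun h' => hne (Prod.ext h.symm h')
      by_contra hle
      rw [not_lt] at hle
      have h1 := hX.norm_sub_le_mul_dist (U := e) hL ((g ^ ((p.2 * K * m : ℕ) : ℤ)) (y (N * m * p.1)))
          ((g ^ ((q.2 * K * m : ℕ) : ℤ)) (y (N * m * q.1)))
      have hle' : (X.dist ((g ^ ((p.2 * K * m : ℕ) : ℤ)) (y (N * m * p.1)))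
          ((g ^ ((q.2 * K * m : ℕ) : ℤ)) (y (N * m * q.1))) : ℝ) ≤ 2 * m := by exact_mod_cast hle
      have h2 := h1.trans (mul_le_mul_of_nonneg_left hle' hL0.le)
      rw [apply_zpow_of_translation hg, apply_zpow_of_translation hg, h, Real.norm_eq_abs,
        add_sub_add_left_eq_sub, ← sub_mul, abs_mul, abs_of_pos hT] at h2
      have h3 : |(((p.2 * K * m : ℕ) : ℤ) : ℝ) - (((q.2 * K * m : ℕ) : ℤ) : ℝ)| =
          |(p.2 : ℝ) - q.2| * (K * m) := by
        push_cast
        rw [mul_assoc, mul_assoc, ← sub_mul, abs_mul, abs_of_nonneg (by positivity : (0 : ℝ) ≤ K * m)]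
      rw [h3] at h2
      have h4 := one_le_abs_natCast_sub hne2
      have hm' : (1 : ℝ) ≤ m := by exact_mod_cast hm
      have h5 : (K : ℝ) * m * T ≤ |(p.2 : ℝ) - q.2| * (K * m) * T := by
        have : (K : ℝ) * m ≤ |(p.2 : ℝ) - q.2| * (K * m) :=
          le_mul_of_one_le_left (by positivity) h4
        gcongr
      nlinarith
    · rw [SimpleGraph.dist_comm]
      exact hlt q p h
  · intro p hp
    rw [Finset.mem_product, Finset.mem_range, Finset.mem_range] at hp
    have h1 := hX.tri ((g ^ ((p.2 * K * m : ℕ) : ℤ)) (y (N * m * p.1)))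
      ((g ^ ((p.2 * K * m : ℕ) : ℤ)) hX.base) hX.base
    rw [hX.dist_iso] at h1
    have h2 := hX.dist_zpow_le g hX.base (p.2 * K * m)
    rw [← hl] at h2
    have h3 := hy (N * m * p.1)
    have h4 : N * m * p.1 ≤ N * m * I := Nat.mul_le_mul_left _ hp.1.le
    have h5 : p.2 * K * m * l ≤ I * K * m * l := by
      have := hp.2.le
      gcongr
    have h6 : l ≤ l * m := Nat.le_mul_of_pos_right l hm
    have h7 : (N + l + K * l + 1) * m * (I + 1) =
      N * m * I + l * m * I + I * K * m * l + m * I + N * m + l * m + K * l * m + m := by ring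
    rw [h7]
    change X.dist ((g ^ ((p.2 * K * m : ℕ) : ℤ)) (y (N * m * p.1))) hX.base + m ≤ _
    have h8 : X.dist ((g ^ ((p.2 * K * m : ℕ) : ℤ)) (y (N * m * p.1))) hX.base ≤
      (N * m * I + l) + I * K * m * l := by omega
    omega

theorem exists_pack {s : ℕ} (hB : Bisects X s) (hnh : ¬ GromovHyperbolic X) :
    ∃ C : ℕ, 1 ≤ C ∧ ∀ m, 1 ≤ m → ∀ I, I ^ 2 * hX.vol m ≤ hX.vol (C * m * (I + 1)) := by
  obtain ⟨n, b, n0, c0, hc0, hφ, hasc⟩ := hX.exists_uniform_ascent hB hnh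
  have hlip : ∃ L : ℝ, 0 < L ∧ ∀ i x y, X.Adj x y → |(b i : V → ℝ) x - (b i : V → ℝ) y| ≤ L := by
    choose L hL using fun i => (b i).2.2.2
    refine ⟨∑ i, |L i| + 1, by positivity, fun i x y h => ?_⟩
    have := Finset.single_le_sum (f := fun i => |L i|) (fun i _ => abs_nonneg _) (Finset.mem_univ i)
    have h1 := hL i x y h
    have h2 := le_abs_self (L i)
    linarith
  obtain ⟨L, hL0, hL⟩ := hlip
  match n, b, hφ, hasc, hL with
  | 0, b, _, _, _ =>
    obtain ⟨f, h1, h2, h3, h4⟩ := hX.exists_harmonic hB hnh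
    have hsub : Subsingleton hX.lipHarm := b.repr.toEquiv.subsingleton
    have := congrArg Subtype.val (Subsingleton.elim (⟨f, h1, h2, h3⟩ : hX.lipHarm) 0)
    exact absurd this h4
  | 1, b, hφ, hasc, hL =>
    set e : V → ℝ := (b 0).1 with he
    have he0 : e hX.base = 0 := (b 0).2.2.1
    have hup : ∀ x, ∃ x', e x < e x' := by
      intro x
      obtain ⟨x', -, h⟩ := hasc (fun _ => 1) (by simp) x
      refine ⟨x', ?_⟩
      simp only [Finset.univ_unique, Finset.sum_singleton, one_mul, Fin.default_eq_zero,
        Fin.isValue] at h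
      linarith
    have hsign : ∀ x, ∃ φ : X ≃g X, (∀ y, e (φ y) = e y + e x) ∨ ∀ y, e (φ y) = e x - e y := by
      intro x
      obtain ⟨φ, hφx⟩ := hX.trans hX.base x
      obtain ⟨c', hc', h⟩ := hφ φ (fun _ => 1) (by simp)
      simp only [Finset.univ_unique, Finset.sum_singleton, one_mul, Fin.default_eq_zero,
        Fin.isValue, hφx] at h hc'
      refine ⟨φ, (mul_self_eq_one_iff.1 ((sq _).symm.trans hc')).imp ?_ ?_⟩
      · intro h1 y
        have := h y
        rw [h1, one_mul] at this
        linarith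
      · intro h1 y
        have := h y
        rw [h1] at this
        linarith
    have htr : ∃ (g : X ≃g X) (T : ℝ), 0 < T ∧ ∀ x, e (g x) = e x + T := by
      obtain ⟨x₁, h₁⟩ := hup hX.base
      obtain ⟨x₂, h₂⟩ := hup x₁
      rw [he0] at h₁
      obtain ⟨φ₁, hp₁ | hm₁⟩ := hsign x₁
      · exact ⟨φ₁, _, h₁, hp₁⟩
      obtain ⟨φ₂, hp₂ | hm₂⟩ := hsign x₂
      · exact ⟨φ₂, _, h₁.trans h₂, hp₂⟩
      refine ⟨φ₁.trans φ₂, e x₂ - e x₁, sub_pos.2 h₂, fun x => ?_⟩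
      change e (φ₂ (φ₁ x)) = _
      rw [hm₂, hm₁]
      ring
    obtain ⟨g, T, hT, hg⟩ := htr
    exact hX.pack_of_translation hB (hL 0) hL0 hT hg
  | n + 2, b, hφ, hasc, hL =>
    refine hX.pack_of_ascent (F := fun x => ⟨(b 0 : V → ℝ) x, (b 1 : V → ℝ) x⟩) (L := L + L)
      (fun x y h => ?_) (by positivity) hc0 (n0 := n0) fun u hu x => ?_
    · refine (Complex.norm_le_abs_re_add_abs_im _).trans ?_
      exact add_le_add (hL 0 x y h) (hL 1 x y h)
    · have hsum : ∀ a : Fin (n + 2) → ℝ,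
          ∑ i, (if i = 0 then u.re else if i = 1 then u.im else 0) * a i =
            u.re * a 0 + u.im * a 1 := by
        intro a
        rw [Fintype.sum_eq_add (0 : Fin (n + 2)) 1 (by simp)]
        · simp
        · rintro i ⟨h0, h1⟩
          simp [h0, h1]
      obtain ⟨x', hx', h⟩ := hasc (fun i => if i = 0 then u.re else if i = 1 then u.im else 0) (by
        simp only [sq, hsum]
        have := Complex.normSq_eq_norm_sq u
        rw [hu, Complex.normSq_apply] at this
        simpa using this) x
      refine ⟨x', hx', ?_⟩
      rw [hsum] at h
      exact h

end TransGraph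

/-! ### Quadratic growth -/

namespace TransGraph

variable {V : Type*} {X : SimpleGraph V} (hX : TransGraph X)
include hX

theorem quadGrowth {s : ℕ} (hB : Bisects X s) (hnh : ¬ GromovHyperbolic X) : QuadGrowth X := by
  obtain ⟨C, hC, hR⟩ := hX.exists_vol_le hB hnh
  obtain ⟨K, hK, hpack⟩ := hX.exists_pack hB hnh
  refine ⟨16 * C * K ^ 2, by positivity, fun v m hm => ?_⟩
  have hset : {u : V | X.dist u v ≤ m} = ↑(hX.ball v m) := by
    ext u
    exact hX.mem_ball.symm
  rw [hset, Set.ncard_coe_finset, hX.card_ball]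
  obtain ⟨R, hDR, hvol⟩ := hR (2 * (K * m))
  have hKm : 0 < K * m := Nat.mul_pos hK hm
  obtain ⟨I, hI⟩ : ∃ I, R / (K * m) = I + 1 := by
    refine ⟨R / (K * m) - 1, ?_⟩
    have : 2 ≤ R / (K * m) := (Nat.le_div_iff_mul_le hKm).2 hDR
    omega
  have hIR : K * m * (I + 1) ≤ R := by
    rw [← hI]
    exact Nat.mul_div_le _ _
  have hI1 : 1 ≤ I := by
    have : 2 ≤ R / (K * m) := (Nat.le_div_iff_mul_le hKm).2 hDR
    omega
  have hRI : R ≤ 4 * I * (K * m) := by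
    have h1 := Nat.lt_mul_div_succ R hKm
    rw [hI] at h1
    have h2 : K * m * (I + 1 + 1) ≤ K * m * (4 * I) := Nat.mul_le_mul_left _ (by omega)
    linarith
  have h1 : ((I ^ 2 * hX.vol m : ℕ) : ℝ) ≤ C * R ^ 2 :=
    le_trans (by exact_mod_cast (hpack m hm I).trans (hX.vol_mono hIR)) hvol
  have h2 : (R : ℝ) ≤ 4 * I * (K * m) := by exact_mod_cast hRI
  have hI0 : (0 : ℝ) < (I : ℝ) ^ 2 := by
    have : (0 : ℝ) < I := by exact_mod_cast hI1
    positivity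
  push_cast at h1
  refine le_of_mul_le_mul_left (h1.trans ?_) hI0
  calc C * (R : ℝ) ^ 2 ≤ C * (4 * I * (K * m)) ^ 2 := by gcongr
    _ = (I : ℝ) ^ 2 * (16 * C * K ^ 2 * m ^ 2) := by ring

end TransGraph

theorem statement_16 {V : Type*} (X : SimpleGraph V)
    (hinf : Infinite V) (hconn : X.Connected)
    (hlf : ∀ v : V, (X.neighborSet v).Finite)
    (htrans : ∀ u v : V, ∃ φ : X ≃g X, φ u = v)
    (σ : ℝ) (hσ : 0 < σ) (hubq : UBQ X σ)
    (hnh : ¬ GromovHyperbolic X) :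
    QuadGrowth X :=
  (TransGraph.mk hinf hconn hlf htrans).quadGrowth (hubq.bisects hσ) hnh
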